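/- arXiv:2009.12706 — 4 statements merged into one kernel-verified Lean document; each statement's English description precedes it below -/
import Mathlib

section
/- (Rigidity of Delaunay lattice triangulations under vertex scaling; Theorem 1.2 of the paper, embedded form.) Assume the lattice triangulation T_st determined by u₁, u₂ is Delaunay for the standard Euclidean metric. Let w : ℤ² → ℝ and suppose there exists a continuous injective map Φ : ℂ → ℂ such that: (i) for every triangle of T_st with vertex set {z₁, z₂, z₃}, the restriction of Φ to the convex hull of {z₁, z₂, z₃} coincides with an ℝ-affine map ℂ → ℂ; (ii) for all adjacent lattice indices a, b ∈ ℤ², |Φ(L a) − Φ(L b)| = e^{w(a)+w(b)} · |L a − L b|; (iii) the image is Delaunay: for every edge {L a, L b} of T_st shared by two triangles whose third vertices are L c and L d, the Euclidean angles satisfy ∠(Φ(L a), Φ(L c), Φ(L b)) + ∠(Φ(L a), Φ(L d), Φ(L b)) ≤ π. Then w is a constant function. -/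
open Real

/-- The inner angle opposite the side of length `r` in a triangle with side lengths
`p`, `q`, `r` (law of cosines). -/
noncomputable def triAngle (p q r : ℝ) : ℝ :=
  Real.arccos ((p ^ 2 + q ^ 2 - r ^ 2) / (2 * p * q))

/-- The Euclidean angle `∠(x, z, y)` at `z` between the segments `zx` and `zy`
(computed by the law of cosines from the Euclidean distances). -/
noncomputable def eAngle (x z y : ℂ) : ℝ :=
  triAngle (dist z x) (dist z y) (dist x y)

/-- The lattice point map `L(m, n) = m·u₁ + n·u₂`. -/
noncomputable def Lpt (u₁ u₂ : ℂ) (a : ℤ × ℤ) : ℂ :=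
  (a.1 : ℂ) * u₁ + (a.2 : ℂ) * u₂

/-- Adjacency of lattice indices in the lattice triangulation `T_st`. -/
def LatAdj (a b : ℤ × ℤ) : Prop :=
  a - b ∈ ({(1, 0), (-1, 0), (0, 1), (0, -1), (1, -1), (-1, 1)} : Set (ℤ × ℤ))

/-- The Delaunay condition for an assignment `P : ℤ² → ℂ` of points to the vertices of
the lattice triangulation `T_st`: for each edge of `T_st` shared by two triangles, the
two Euclidean angles opposite that edge (at the third vertices of the two triangles)
sum to at most `π`.  The three families of interior edges are
`{v, v+(1,0)}` (opposite vertices `v+(0,1)` and `v+(1,-1)`),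
`{v, v+(0,1)}` (opposite vertices `v+(1,0)` and `v+(-1,1)`), and
`{v+(1,0), v+(0,1)}` (opposite vertices `v` and `v+(1,1)`). -/
def LatDelaunay (P : ℤ × ℤ → ℂ) : Prop :=
  ∀ v : ℤ × ℤ,
    eAngle (P v) (P (v + (0, 1))) (P (v + (1, 0))) +
      eAngle (P v) (P (v + (1, -1))) (P (v + (1, 0))) ≤ π ∧
    eAngle (P v) (P (v + (1, 0))) (P (v + (0, 1))) +
      eAngle (P v) (P (v + (-1, 1))) (P (v + (0, 1))) ≤ π ∧
    eAngle (P (v + (1, 0))) (P v) (P (v + (0, 1))) +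
      eAngle (P (v + (1, 0))) (P (v + (1, 1))) (P (v + (0, 1))) ≤ π

/-- The angle opposite the side `c` in a triangle whose other two sides have squared lengths
`a` and `b`. -/
noncomputable def sqAngle (c a b : ℝ) : ℝ :=
  arccos ((a + b - c ^ 2) / (2 * √(a * b)))

/-- Sixteen times the squared area of the triangle with side `c` and with two further sides of
squared lengths `a` and `b`. -/
def heronForm (c a b : ℝ) : ℝ :=
  2 * c ^ 2 * (a + b) - (a - b) ^ 2 - c ^ 4

/-- The signed length of the projection of the side of squared length `a` to the side `c`. -/
noncomputable def sideProj (c a b : ℝ) : ℝ :=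
  (a + c ^ 2 - b) / (2 * c)

/-- The vector `S` of squared radii describes a closed convex hexagon with side lengths `c` that
winds once around the origin. -/
structure IsConvexStar (c S : Fin 6 → ℝ) : Prop where
  pos : ∀ k, 0 < S k
  heron : ∀ k, 0 ≤ heronForm (c k) (S k) (S (k + 1))
  convex : ∀ k, 0 ≤ sideProj (c k) (S k) (S (k + 1)) +
    sideProj (c (k - 1)) (S k) (S (k - 1))
  angle_sum : ∑ k, sqAngle (c k) (S k) (S (k + 1)) = 2 * π

lemma sub_sq_sideProj {c : ℝ} (hc : 0 < c) (a b : ℝ) :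
    a - sideProj c a b ^ 2 = heronForm c a b / (4 * c ^ 2) := by
  unfold sideProj heronForm
  field_simp
  ring

lemma heronForm_comm (c a b : ℝ) : heronForm c a b = heronForm c b a := by
  unfold heronForm; ring

lemma sideProj_add_sideProj {c : ℝ} (hc : 0 < c) (a b : ℝ) :
    sideProj c a b + sideProj c b a = c := by
  unfold sideProj; field_simp; ring

lemma div_sqrt_add_div_sqrt_pos {A x y : ℝ} (hx : x ^ 2 < A) (hy : y ^ 2 < A)
    (hxy : 0 < x + y) : 0 < x / √(A - x ^ 2) + y / √(A - y ^ 2) := by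
  wlog h : y ≤ x generalizing x y
  · rw [add_comm]
    exact this hy hx (by linarith) (by linarith)
  have hp : 0 < √(A - x ^ 2) := sqrt_pos.2 (by linarith)
  have hq : 0 < √(A - y ^ 2) := sqrt_pos.2 (by linarith)
  have hx0 : 0 < x := by linarith
  rcases le_or_gt 0 y with hy0 | hy0
  · positivity
  · have hpq : √(A - x ^ 2) ≤ √(A - y ^ 2) := sqrt_le_sqrt (by nlinarith)
    rw [div_add_div _ _ hp.ne' hq.ne']
    apply div_pos _ (mul_pos hp hq)
    nlinarith

lemma div_sqrt_add_div_sqrt_nonneg {A x y : ℝ} (hx : x ^ 2 < A) (hy : y ^ 2 < A)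
    (hxy : 0 ≤ x + y) : 0 ≤ x / √(A - x ^ 2) + y / √(A - y ^ 2) := by
  rcases hxy.eq_or_lt with h | h
  · obtain rfl : y = -x := by linarith
    simp [neg_div]
  · exact (div_sqrt_add_div_sqrt_pos hx hy h).le

lemma hasDerivAt_sqAngle {c : ℝ} (hc : 0 < c) (a b α β t : ℝ) (ha : 0 < a + t * α)
    (hb : 0 < b + t * β) (hQ : 0 < heronForm c (a + t * α) (b + t * β)) :
    HasDerivAt (fun t => sqAngle c (a + t * α) (b + t * β))
      (-(1 / 2) * (α / (a + t * α) * (sideProj c (a + t * α) (b + t * β) /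
          √(a + t * α - sideProj c (a + t * α) (b + t * β) ^ 2)) +
        β / (b + t * β) * (sideProj c (b + t * β) (a + t * α) /
          √(b + t * β - sideProj c (b + t * β) (a + t * α) ^ 2)))) t := by
  have hA : HasDerivAt (fun t => a + t * α) α t := by
    simpa using ((hasDerivAt_id t).mul_const α).const_add a
  have hB : HasDerivAt (fun t => b + t * β) β t := by
    simpa using ((hasDerivAt_id t).mul_const β).const_add b
  have hAB := hA.mul hB
  have hs := hAB.sqrt (mul_pos ha hb).ne'
  have hn := (hA.add hB).sub_const (c ^ 2)
  have hd := hn.div (hs.const_mul 2) (mul_pos two_pos (sqrt_pos.2 (mul_pos ha hb))).ne'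
  set A := a + t * α with hAdef
  set B := b + t * β with hBdef
  have hABs : 0 < √(A * B) := sqrt_pos.2 (mul_pos ha hb)
  have hss : √(A * B) ^ 2 = A * B := sq_sqrt (mul_pos ha hb).le
  have h1 : 1 - ((A + B - c ^ 2) / (2 * √(A * B))) ^ 2 = heronForm c A B / (4 * (A * B)) := by
    rw [div_pow, mul_pow, hss, heronForm]
    field_simp
    ring
  have h2 : ((A + B - c ^ 2) / (2 * √(A * B))) ^ 2 < 1 := by
    have : 0 < heronForm c A B / (4 * (A * B)) := by positivity
    linarith
  have h3 : (A + B - c ^ 2) / (2 * √(A * B)) ≠ -1 := by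
    intro h; rw [h] at h2; norm_num at h2
  have h4 : (A + B - c ^ 2) / (2 * √(A * B)) ≠ 1 := by
    intro h; rw [h] at h2; norm_num at h2
  have key := (Real.hasDerivAt_arccos h3 h4).comp t hd
  refine key.congr_deriv ?_
  have hq : 0 < √(heronForm c A B) := sqrt_pos.2 hQ
  have e1 : √(1 - ((A + B - c ^ 2) / (2 * √(A * B))) ^ 2) =
      √(heronForm c A B) / (2 * √(A * B)) := by
    rw [h1, sqrt_div hQ.le, sqrt_mul (by norm_num : (0:ℝ) ≤ 4)]
    congr 2
    rw [show (4:ℝ) = 2 ^ 2 by norm_num, sqrt_sq (by norm_num)]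
  have e2 : √(A - sideProj c A B ^ 2) = √(heronForm c A B) / (2 * c) := by
    rw [sub_sq_sideProj hc, sqrt_div hQ.le, show 4 * c ^ 2 = (2 * c) ^ 2 by ring,
      sqrt_sq (by positivity)]
  have e3 : √(B - sideProj c B A ^ 2) = √(heronForm c A B) / (2 * c) := by
    rw [sub_sq_sideProj hc, heronForm_comm c B A, sqrt_div hQ.le,
      show 4 * c ^ 2 = (2 * c) ^ 2 by ring, sqrt_sq (by positivity)]
  simp only [Pi.mul_apply, Pi.add_apply]
  rw [← hAdef, ← hBdef, e1, e2, e3]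
  unfold sideProj
  generalize √(heronForm c A B) = q at *
  generalize √(A * B) = s at *
  have hs0 := hABs.ne'
  field_simp
  have : s ^ 4 = A ^ 2 * B ^ 2 := by
    rw [show s ^ 4 = (s ^ 2) ^ 2 by ring, hss]; ring
  simp only [hss]
  ring

lemma heronForm_segment (c a b α β t : ℝ) :
    heronForm c (a + t * α) (b + t * β) =
      (1 - t) * heronForm c a b + t * heronForm c (a + α) (b + β) +
        t * (1 - t) * (α - β) ^ 2 := by
  unfold heronForm; ring

lemma heronForm_segment_pos {c a b α β t : ℝ} (hc : 0 < c)
    (h0 : 0 ≤ heronForm c a b) (h1 : 0 ≤ heronForm c (a + α) (b + β)) (ht0 : 0 < t)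
    (ht1 : t < 1) (h : 0 < α ∨ 0 < β) : 0 < heronForm c (a + t * α) (b + t * β) := by
  rw [heronForm_segment]
  have h2 : 0 ≤ (1 - t) * heronForm c a b := mul_nonneg (by linarith) h0
  have h3 : 0 ≤ t * heronForm c (a + α) (b + β) := mul_nonneg ht0.le h1
  have h4 : 0 < t * (1 - t) := mul_pos ht0 (by linarith)
  by_cases hαβ : α = β
  · subst hαβ
    have hα' : 0 < α := by tauto
    have : heronForm c (a + α) (b + α) = heronForm c a b + 4 * c ^ 2 * α := by
      unfold heronForm; ring
    have : 0 < heronForm c (a + α) (b + α) := by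
      rw [this]; positivity
    have := mul_pos ht0 this
    nlinarith [sq_nonneg (α - α)]
  · have : 0 < (α - β) ^ 2 := by
      have := sub_ne_zero.2 hαβ
      positivity
    have := mul_pos h4 this
    linarith

lemma continuousOn_sqAngle {X : Type*} [TopologicalSpace X] {s : Set X} (c : ℝ) {f g : X → ℝ}
    (hf : ContinuousOn f s) (hg : ContinuousOn g s) (hf0 : ∀ x ∈ s, 0 < f x)
    (hg0 : ∀ x ∈ s, 0 < g x) : ContinuousOn (fun x => sqAngle c (f x) (g x)) s := by
  unfold sqAngle
  refine continuous_arccos.comp_continuousOn (ContinuousOn.div (by fun_prop) (by fun_prop) ?_)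
  intro x hx
  have := sqrt_pos.2 (mul_pos (hf0 x hx) (hg0 x hx))
  positivity

/-- Two convex hexagons around the origin with the same side lengths coincide when the vertices of
one are at least as far from the origin as the vertices of the other. -/
theorem IsConvexStar.eq_of_le {c S S' : Fin 6 → ℝ} (hc : ∀ k, 0 < c k) (hS : IsConvexStar c S)
    (hS' : IsConvexStar c S') (hle : ∀ k, S k ≤ S' k) : ∀ k, S k = S' k := by
  set D : Fin 6 → ℝ := fun k => S' k - S k with hD
  have hD0 : ∀ k, 0 ≤ D k := fun k => sub_nonneg.2 (hle k)
  have hSD : ∀ k, S k + D k = S' k := fun k => by simp [hD]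
  set T : ℝ → Fin 6 → ℝ := fun t k => S k + t * D k with hT
  have hTpos : ∀ t, 0 ≤ t → ∀ k, 0 < T t k := fun t ht k =>
    add_pos_of_pos_of_nonneg (hS.pos k) (mul_nonneg ht (hD0 k))
  have hTQ : ∀ t, 0 < t → t < 1 → ∀ k, 0 < D k ∨ 0 < D (k + 1) →
      0 < heronForm (c k) (T t k) (T t (k + 1)) := fun t h0 h1 k hk =>
    heronForm_segment_pos (hc k) (hS.heron k)
      (by rw [hSD, hSD]; exact hS'.heron k) h0 h1 hk
  have hTconv : ∀ t, 0 < t → t < 1 → ∀ k, 0 ≤ sideProj (c k) (T t k) (T t (k + 1)) +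
      sideProj (c (k - 1)) (T t k) (T t (k - 1)) := by
    intro t h0 h1 k
    have e1 := hS.convex k
    have e2 := hS'.convex k
    have : sideProj (c k) (T t k) (T t (k + 1)) + sideProj (c (k - 1)) (T t k) (T t (k - 1)) =
        (1 - t) * (sideProj (c k) (S k) (S (k + 1)) + sideProj (c (k - 1)) (S k) (S (k - 1))) +
        t * (sideProj (c k) (S' k) (S' (k + 1)) +
          sideProj (c (k - 1)) (S' k) (S' (k - 1))) := by
      simp only [hT, hD, sideProj]; ring
    rw [this]
    exact add_nonneg (mul_nonneg (by linarith) e1) (mul_nonneg h0.le e2)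
  set f : ℝ → ℝ := fun t => ∑ k, sqAngle (c k) (T t k) (T t (k + 1)) with hf
  set g : ℝ → Fin 6 → ℝ := fun t k => D k / T t k *
    (sideProj (c k) (T t k) (T t (k + 1)) /
      √(T t k - sideProj (c k) (T t k) (T t (k + 1)) ^ 2) +
    sideProj (c (k - 1)) (T t k) (T t (k - 1)) /
      √(T t k - sideProj (c (k - 1)) (T t k) (T t (k - 1)) ^ 2)) with hg
  have hder : ∀ t, 0 < t → t < 1 → HasDerivAt f (-(1 / 2) * ∑ k, g t k) t := by
    intro t h0 h1
    have hterm : ∀ k ∈ Finset.univ, HasDerivAt (fun t => sqAngle (c k) (T t k) (T t (k + 1)))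
        (-(1 / 2) * (D k / T t k * (sideProj (c k) (T t k) (T t (k + 1)) /
          √(T t k - sideProj (c k) (T t k) (T t (k + 1)) ^ 2)) +
          D (k + 1) / T t (k + 1) * (sideProj (c k) (T t (k + 1)) (T t k) /
          √(T t (k + 1) - sideProj (c k) (T t (k + 1)) (T t k) ^ 2)))) t := by
      intro k _
      by_cases hk : 0 < D k ∨ 0 < D (k + 1)
      · exact hasDerivAt_sqAngle (hc k) _ _ _ _ _ (hTpos t h0.le k) (hTpos t h0.le (k + 1))
          (hTQ t h0 h1 k hk)
      · push Not at hk
        have hk1 : D k = 0 := le_antisymm hk.1 (hD0 k)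
        have hk2 : D (k + 1) = 0 := le_antisymm hk.2 (hD0 _)
        simp only [hk1, hk2, hT, mul_zero, add_zero, zero_div, zero_mul]
        exact hasDerivAt_const _ _
    have := HasDerivAt.fun_sum hterm
    refine this.congr_deriv ?_
    rw [← Finset.mul_sum]
    congr 1
    rw [Finset.sum_add_distrib]
    have : ∑ k, D (k + 1) / T t (k + 1) * (sideProj (c k) (T t (k + 1)) (T t k) /
          √(T t (k + 1) - sideProj (c k) (T t (k + 1)) (T t k) ^ 2)) =
        ∑ k, D k / T t k * (sideProj (c (k - 1)) (T t k) (T t (k - 1)) /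
          √(T t k - sideProj (c (k - 1)) (T t k) (T t (k - 1)) ^ 2)) := by
      rw [← Equiv.sum_comp (Equiv.addRight (1 : Fin 6))
        (fun k => D k / T t k * (sideProj (c (k - 1)) (T t k) (T t (k - 1)) /
          √(T t k - sideProj (c (k - 1)) (T t k) (T t (k - 1)) ^ 2)))]
      simp
    rw [this, ← Finset.sum_add_distrib]
    simp only [hg, mul_add]
  have hlt : ∀ t, 0 < t → t < 1 → ∀ k, 0 < D k →
      sideProj (c k) (T t k) (T t (k + 1)) ^ 2 < T t k ∧
      sideProj (c (k - 1)) (T t k) (T t (k - 1)) ^ 2 < T t k := by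
    intro t h0 h1 k hk
    constructor
    · rw [← sub_pos, sub_sq_sideProj (hc k)]
      have := hTQ t h0 h1 k (Or.inl hk)
      have := hc k
      positivity
    · rw [← sub_pos, sub_sq_sideProj (hc _), heronForm_comm]
      have h := hTQ t h0 h1 (k - 1) (Or.inr (by simpa using hk))
      rw [sub_add_cancel] at h
      have := hc (k - 1)
      positivity
  have hgnn : ∀ t, 0 < t → t < 1 → ∀ k, 0 ≤ g t k := by
    intro t h0 h1 k
    rcases (hD0 k).eq_or_lt with hk | hk
    · simp [hg, ← hk]
    · obtain ⟨i1, i2⟩ := hlt t h0 h1 k hk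
      exact mul_nonneg (div_nonneg hk.le (hTpos t h0.le k).le)
        (div_sqrt_add_div_sqrt_nonneg i1 i2 (hTconv t h0 h1 k))
  have hfc : ContinuousOn f (Set.Icc 0 1) := by
    refine continuousOn_finsetSum _ fun k _ => continuousOn_sqAngle _ ?_ ?_
      (fun t ht => hTpos t ht.1 k) (fun t ht => hTpos t ht.1 (k + 1))
    all_goals simp only [hT]; fun_prop
  have hanti : AntitoneOn f (Set.Icc 0 1) := by
    refine antitoneOn_of_deriv_nonpos (convex_Icc 0 1) hfc ?_ ?_
    · rw [interior_Icc]
      exact fun t ht => (hder t ht.1 ht.2).differentiableAt.differentiableWithinAt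
    · rw [interior_Icc]
      intro t ht
      rw [(hder t ht.1 ht.2).deriv]
      have := Finset.sum_nonneg (fun k (_ : k ∈ Finset.univ) => hgnn t ht.1 ht.2 k)
      linarith
  have hf01 : f 0 = f 1 := by
    have e0 : f 0 = 2 * π := by simpa [hf, hT] using hS.angle_sum
    have e1 : f 1 = 2 * π := by simpa [hf, hT, hSD] using hS'.angle_sum
    rw [e0, e1]
  have hconst : ∀ t ∈ Set.Icc (0 : ℝ) 1, f t = f 0 := by
    intro t ht
    apply le_antisymm
    · exact hanti (by simp) ht ht.1
    · rw [hf01]; exact hanti ht (by simp) ht.2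
  have hg0 : ∀ t, 0 < t → t < 1 → ∀ k, g t k = 0 := by
    intro t h0 h1
    have : HasDerivAt f 0 t := by
      refine (hasDerivAt_const t (f 0)).congr_of_eventuallyEq ?_
      filter_upwards [Ioo_mem_nhds h0 h1] with s hs
      exact hconst s ⟨hs.1.le, hs.2.le⟩
    have h := (hder t h0 h1).unique this
    have h : ∑ k, g t k = 0 := by linarith
    rw [Finset.sum_eq_zero_iff_of_nonneg (fun k _ => hgnn t h0 h1 k)] at h
    exact fun k => h k (Finset.mem_univ k)
  have hflat : ∀ t, 0 < t → t < 1 → ∀ k, 0 < D k → sideProj (c k) (T t k) (T t (k + 1)) +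
      sideProj (c (k - 1)) (T t k) (T t (k - 1)) = 0 := by
    intro t h0 h1 k hk
    obtain ⟨i1, i2⟩ := hlt t h0 h1 k hk
    by_contra hne
    have hpos := lt_of_le_of_ne (hTconv t h0 h1 k) (Ne.symm hne)
    have h := div_sqrt_add_div_sqrt_pos i1 i2 hpos
    have := mul_pos (div_pos hk (hTpos t h0.le k)) h
    exact this.ne' (hg0 t h0 h1 k)
  -- the discrete Laplacian of `D` vanishes
  set Δ : Fin 6 → ℝ := fun k => (D (k + 1) - D k) / c k - (D k - D (k - 1)) / c (k - 1) with hΔ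
  have hΔpos : ∀ k, 0 < D k → Δ k = 0 := by
    intro k hk
    have e1 := hflat (1 / 3) (by norm_num) (by norm_num) k hk
    have e2 := hflat (2 / 3) (by norm_num) (by norm_num) k hk
    have e3 : Δ k = 6 * ((sideProj (c k) (T (1 / 3) k) (T (1 / 3) (k + 1)) +
      sideProj (c (k - 1)) (T (1 / 3) k) (T (1 / 3) (k - 1))) -
      (sideProj (c k) (T (2 / 3) k) (T (2 / 3) (k + 1)) +
      sideProj (c (k - 1)) (T (2 / 3) k) (T (2 / 3) (k - 1)))) := by
      have := (hc k).ne'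
      have := (hc (k - 1)).ne'
      simp only [hΔ, hT, sideProj]
      field_simp
      ring
    rw [e3, e1, e2]; simp
  have hΔnn : ∀ k, 0 ≤ Δ k := by
    intro k
    rcases (hD0 k).eq_or_lt with hk | hk
    · simp only [hΔ, ← hk, sub_zero, zero_sub, neg_div, sub_neg_eq_add]
      exact add_nonneg (div_nonneg (hD0 _) (hc _).le) (div_nonneg (hD0 _) (hc _).le)
    · exact (hΔpos k hk).ge
  have hΔsum : ∑ k, Δ k = 0 := by
    simp only [hΔ, Finset.sum_sub_distrib]
    rw [← Equiv.sum_comp (Equiv.addRight (1 : Fin 6)) (fun k => (D k - D (k - 1)) / c (k - 1))]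
    simp
  have hΔ0 : ∀ k, Δ k = 0 := by
    rw [Finset.sum_eq_zero_iff_of_nonneg (fun k _ => hΔnn k)] at hΔsum
    exact fun k => hΔsum k (Finset.mem_univ k)
  have hstep : ∀ k, D k = 0 → D (k + 1) = 0 := by
    intro k hk
    have h := hΔ0 k
    simp only [hΔ, hk, sub_zero, zero_sub, neg_div, sub_neg_eq_add] at h
    have h1 := div_nonneg (hD0 (k + 1)) (hc k).le
    have h2 := div_nonneg (hD0 (k - 1)) (hc (k - 1)).le
    have h3 : D (k + 1) / c k = 0 := by linarith
    exact (div_eq_zero_iff.1 h3).resolve_right (hc k).ne'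
  suffices ∃ k, D k = 0 by
    obtain ⟨k, hk⟩ := this
    have h1 := hstep _ hk
    have h2 := hstep _ h1
    have h3 := hstep _ h2
    have h4 := hstep _ h3
    have h5 := hstep _ h4
    intro j
    have : D j = 0 := by
      have : j = k ∨ j = k + 1 ∨ j = k + 1 + 1 ∨ j = k + 1 + 1 + 1 ∨ j = k + 1 + 1 + 1 + 1 ∨
        j = k + 1 + 1 + 1 + 1 + 1 := by
        clear * -
        revert j k; decide
      rcases this with rfl | rfl | rfl | rfl | rfl | rfl <;> assumption
    simp only [hD] at this
    linarith
  by_contra hno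
  push Not at hno
  have hDpos : ∀ k, 0 < D k := fun k => lt_of_le_of_ne (hD0 k) (hno k).symm
  have hsum : ∑ k, (sideProj (c k) (T (1 / 2) k) (T (1 / 2) (k + 1)) +
      sideProj (c (k - 1)) (T (1 / 2) k) (T (1 / 2) (k - 1))) = 0 :=
    Finset.sum_eq_zero fun k _ => hflat _ (by norm_num) (by norm_num) k (hDpos k)
  rw [Finset.sum_add_distrib, ← Equiv.sum_comp (Equiv.addRight (1 : Fin 6))
    (fun k => sideProj (c (k - 1)) (T (1 / 2) k) (T (1 / 2) (k - 1))),
    ← Finset.sum_add_distrib] at hsum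
  simp only [Equiv.coe_addRight, add_sub_cancel_right, sideProj_add_sideProj (hc _)] at hsum
  exact (Finset.sum_pos (fun k _ => hc k) Finset.univ_nonempty).ne' hsum

/-- The six neighbours of the origin in the lattice triangulation, in counterclockwise order. -/
def hexDir : Fin 6 → ℤ × ℤ :=
  ![(1, 0), (0, 1), (-1, 1), (-1, 0), (0, -1), (1, -1)]

lemma hexDir_succ (k : Fin 6) : hexDir (k + 1) = hexDir k + hexDir (k + 2) := by
  revert k; decide

lemma hexDir_add_three (k : Fin 6) : hexDir (k + 3) = -hexDir k := by
  revert k; decide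

lemma hexDir_induction {p : ℤ × ℤ → Prop} (h0 : p 0)
    (hstep : ∀ v k, p v → p (v + hexDir k)) (v : ℤ × ℤ) : p v := by
  have h1 : ∀ m : ℤ, p (m, 0) := by
    intro m
    induction m using Int.induction_on with
    | zero => exact h0
    | succ i ih => simpa [hexDir] using hstep _ 0 ih
    | pred i ih => simpa [hexDir, sub_eq_add_neg] using hstep _ 3 ih
  obtain ⟨m, n⟩ := v
  induction n using Int.induction_on with
  | zero => exact h1 m
  | succ i ih => simpa [hexDir] using hstep _ 1 ih
  | pred i ih => simpa [hexDir, sub_eq_add_neg] using hstep _ 4 ih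

/-- The sides of the hexagon obtained by inverting the star of a vertex. -/
noncomputable def starSide (ℓ : Fin 6 → ℝ) (k : Fin 6) : ℝ :=
  ℓ (k + 2) / (ℓ k * ℓ (k + 1))

/-- The squared radii of the hexagon obtained by inverting the star of the vertex `v`. -/
noncomputable def starRadius (ℓ : Fin 6 → ℝ) (w : ℤ × ℤ → ℝ) (v : ℤ × ℤ) (k : Fin 6) : ℝ :=
  exp (2 * (w v - w (v + hexDir k))) / ℓ k ^ 2

/-- The vertex scaling `w` of the lattice triangulation with edge lengths `ℓ` is flat and
Delaunay, where degenerate triangles are allowed. -/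
def IsFlatDelaunay (ℓ : Fin 6 → ℝ) (w : ℤ × ℤ → ℝ) : Prop :=
  ∀ v, IsConvexStar (starSide ℓ) (starRadius ℓ w v)

lemma starSide_pos {ℓ : Fin 6 → ℝ} (hℓ : ∀ k, 0 < ℓ k) (k : Fin 6) : 0 < starSide ℓ k :=
  div_pos (hℓ _) (mul_pos (hℓ _) (hℓ _))

lemma starRadius_pos {ℓ : Fin 6 → ℝ} (hℓ : ∀ k, 0 < ℓ k) (w : ℤ × ℤ → ℝ) (v : ℤ × ℤ)
    (k : Fin 6) : 0 < starRadius ℓ w v k :=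
  div_pos (exp_pos _) (pow_pos (hℓ _) 2)

lemma IsFlatDelaunay.shift {ℓ : Fin 6 → ℝ} {w : ℤ × ℤ → ℝ} (hw : IsFlatDelaunay ℓ w)
    (u : ℤ × ℤ) (c : ℝ) : IsFlatDelaunay ℓ (fun a => w (a + u) - c) := by
  intro v
  convert hw (v + u) using 1
  funext k
  simp only [starRadius, sub_sub_sub_cancel_right, add_right_comm v u]

/-- Maximum principle for difference quotients in lattice directions. -/
lemma IsFlatDelaunay.sub_eq_of_le {ℓ : Fin 6 → ℝ} (hℓ : ∀ k, 0 < ℓ k) {w : ℤ × ℤ → ℝ}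
    (hw : IsFlatDelaunay ℓ w) {d : ℤ × ℤ} (hle : ∀ v, w (v + d) - w v ≤ w d - w 0) (v : ℤ × ℤ) :
    w (v + d) - w v = w d - w 0 := by
  induction v using hexDir_induction with
  | h0 => simp
  | hstep v k ih =>
    have key : ∀ j, starRadius ℓ w v j ≤ starRadius ℓ w (v + d) j := by
      intro j
      have h := hle (v + hexDir j)
      rw [add_right_comm] at h
      exact div_le_div_of_nonneg_right (exp_le_exp.2 (by linarith)) (sq_nonneg _)
    have := IsConvexStar.eq_of_le (starSide_pos hℓ) (hw v) (hw (v + d)) key k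
    unfold starRadius at this
    have hk := pow_pos (hℓ k) 2
    rw [div_left_inj' hk.ne', exp_eq_exp] at this
    rw [add_right_comm v (hexDir k) d]
    linarith

lemma heronForm_nonneg_bound {c a b m : ℝ} (hc0 : 0 < c) (hc : c ≤ m) (ha : 0 < a) (hb : 0 < b)
    (hQ : 0 ≤ heronForm c a b) : b ≤ 2 * a + 4 * m ^ 2 := by
  have hm : c ^ 2 ≤ m ^ 2 := by gcongr
  by_contra! h
  have h' : 2 * a + 4 * c ^ 2 < b := by linarith
  have hc2 : 0 < c ^ 2 := by positivity
  unfold heronForm at hQ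
  generalize c ^ 2 = C at *
  have h1 : b / 2 + 2 * C < b - a := by linarith
  have h2 : (b / 2 + 2 * C) ^ 2 < (b - a) ^ 2 := by gcongr
  have h3 : 2 * C * (a + b) ≤ 2 * C * (3 * b / 2) := by gcongr; linarith
  have h4 : 0 < C * (b - 4 * C) := mul_pos hc2 (by linarith)
  have h5 : 0 ≤ c ^ 4 := by positivity
  nlinarith [mul_pos hb hb]

lemma IsConvexStar.le_of_side_le {c S : Fin 6 → ℝ} (hc : ∀ k, 0 < c k) {m : ℝ}
    (hm : ∀ k, c k ≤ m) (hS : IsConvexStar c S) (k : Fin 6) : S k ≤ 188 * m ^ 2 := by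
  have hex : ∃ k, π / 3 ≤ sqAngle (c k) (S k) (S (k + 1)) := by
    by_contra! h
    have := Finset.sum_lt_sum_of_nonempty (s := Finset.univ) Finset.univ_nonempty
      (fun k _ => h k)
    rw [hS.angle_sum] at this
    simp at this
    linarith
  obtain ⟨j, hj⟩ := hex
  have h0 : S j ≤ 2 * m ^ 2 := by
    have hcos : (S j + S (j + 1) - c j ^ 2) / (2 * √(S j * S (j + 1))) ≤ 1 / 2 := by
      by_contra! h
      have : sqAngle (c j) (S j) (S (j + 1)) < π / 3 := by
        have h1 : π / 3 = arccos (1 / 2) := by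
          rw [← cos_pi_div_three, arccos_cos (by positivity) (by linarith [pi_pos])]
        rw [h1]
        unfold sqAngle
        rcases le_or_gt ((S j + S (j + 1) - c j ^ 2) / (2 * √(S j * S (j + 1)))) 1 with h2 | h2
        · exact arccos_lt_arccos (by norm_num) h h2
        · rw [arccos_of_one_le h2.le, ← h1]; positivity
      linarith
    have hp := mul_pos (hS.pos j) (hS.pos (j + 1))
    have hs := sqrt_pos.2 hp
    rw [div_le_iff₀ (by positivity)] at hcos
    have : √(S j * S (j + 1)) ≤ (S j + S (j + 1)) / 2 := by
      rw [sqrt_le_left (by linarith [hS.pos j, hS.pos (j + 1)])]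
      nlinarith [sq_nonneg (S j - S (j + 1))]
    have h2 : c j ^ 2 ≤ m ^ 2 := by
      have := hc j
      have := hm j
      gcongr
    linarith [hS.pos (j + 1)]
  have hstep : ∀ i, S (i + 1) ≤ 2 * S i + 4 * m ^ 2 := fun i =>
    heronForm_nonneg_bound (hc i) (hm i) (hS.pos i) (hS.pos _) (hS.heron i)
  have h1 := hstep j
  have h2 := hstep (j + 1)
  have h3 := hstep (j + 1 + 1)
  have h4 := hstep (j + 1 + 1 + 1)
  have h5 := hstep (j + 1 + 1 + 1 + 1)
  have : k = j ∨ k = j + 1 ∨ k = j + 1 + 1 ∨ k = j + 1 + 1 + 1 ∨ k = j + 1 + 1 + 1 + 1 ∨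
    k = j + 1 + 1 + 1 + 1 + 1 := by
    clear * -
    revert k j; decide
  have hm2 := sq_nonneg m
  rcases this with rfl | rfl | rfl | rfl | rfl | rfl <;> linarith

lemma exists_abs_sub_le {ℓ : Fin 6 → ℝ} (hℓ : ∀ k, 0 < ℓ k) :
    ∃ C : ℝ, ∀ w, IsFlatDelaunay ℓ w → ∀ v k, |w (v + hexDir k) - w v| ≤ C := by
  have hc := starSide_pos hℓ
  set m := ∑ k, starSide ℓ k
  have hm : ∀ k, starSide ℓ k ≤ m := fun k =>
    Finset.single_le_sum (fun i _ => (hc i).le) (Finset.mem_univ k)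
  set L := ∑ k, ℓ k ^ 2
  have hL : ∀ k, ℓ k ^ 2 ≤ L := fun k =>
    Finset.single_le_sum (f := fun k => ℓ k ^ 2) (fun i _ => sq_nonneg _) (Finset.mem_univ k)
  have hone : ∀ w, IsFlatDelaunay ℓ w → ∀ v k,
      w v - w (v + hexDir k) ≤ log (188 * m ^ 2 * L) / 2 := by
    intro w hw v k
    have h := (hw v).le_of_side_le hc hm k
    have hk := pow_pos (hℓ k) 2
    rw [starRadius, div_le_iff₀ hk] at h
    have h2 : exp (2 * (w v - w (v + hexDir k))) ≤ 188 * m ^ 2 * L :=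
      h.trans (by gcongr; exact hL k)
    have h3 := log_le_log (exp_pos _) h2
    rw [log_exp] at h3
    linarith
  refine ⟨log (188 * m ^ 2 * L) / 2, fun w hw v k => abs_le.2 ⟨?_, ?_⟩⟩
  · linarith [hone w hw v k]
  · have := hone w hw (v + hexDir k) (k + 3)
    rwa [hexDir_add_three, add_neg_cancel_right] at this

lemma isClosed_isFlatDelaunay {ℓ : Fin 6 → ℝ} (hℓ : ∀ k, 0 < ℓ k) :
    IsClosed {w | IsFlatDelaunay ℓ w} := by
  have hcont : ∀ v k, Continuous fun w : ℤ × ℤ → ℝ => starRadius ℓ w v k := by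
    intro v k
    unfold starRadius
    fun_prop
  have : {w | IsFlatDelaunay ℓ w} = ⋂ v, ({w | ∀ k, 0 ≤ heronForm (starSide ℓ k)
      (starRadius ℓ w v k) (starRadius ℓ w v (k + 1))} ∩
    {w | ∀ k, 0 ≤ sideProj (starSide ℓ k) (starRadius ℓ w v k) (starRadius ℓ w v (k + 1)) +
      sideProj (starSide ℓ (k - 1)) (starRadius ℓ w v k) (starRadius ℓ w v (k - 1))} ∩
    {w | ∑ k, sqAngle (starSide ℓ k) (starRadius ℓ w v k) (starRadius ℓ w v (k + 1)) =
      2 * π}) := by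
    ext w
    simp only [Set.mem_iInter, Set.mem_inter_iff, Set.mem_ofPred_eq]
    exact ⟨fun h v => ⟨⟨(h v).heron, (h v).convex⟩, (h v).angle_sum⟩,
      fun h v => ⟨starRadius_pos hℓ w v, (h v).1.1, (h v).1.2, (h v).2⟩⟩
  rw [this]
  refine isClosed_iInter fun v => ((IsClosed.inter ?_ ?_).inter ?_)
  · simp only [Set.ofPred_forall]
    refine isClosed_iInter fun k => isClosed_le continuous_const ?_
    unfold heronForm
    fun_prop
  · simp only [Set.ofPred_forall]
    refine isClosed_iInter fun k => isClosed_le continuous_const ?_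
    unfold sideProj
    fun_prop
  · refine isClosed_eq (continuous_finsetSum _ fun k _ => ?_) continuous_const
    rw [← continuousOn_univ]
    exact continuousOn_sqAngle _ (hcont v k).continuousOn (hcont v _).continuousOn
      (fun w _ => starRadius_pos hℓ w v k) (fun w _ => starRadius_pos hℓ w v _)

/-- A vertex scaling factor together with vertex positions. -/
abbrev Layout : Type := (ℤ × ℤ → ℝ) × (ℤ × ℤ → ℂ)

/-- The adjacent vertices of a layout have the distances prescribed by vertex scaling. -/
def HasScaledLengths (ℓ : Fin 6 → ℝ) (x : Layout) : Prop :=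
  ∀ v k, dist (x.2 v) (x.2 (v + hexDir k)) = exp (x.1 v + x.1 (v + hexDir k)) * ℓ k

/-- Recentre a layout at the vertex `u` and normalise it. -/
noncomputable def recentre (u : ℤ × ℤ) (x : Layout) : Layout :=
  (fun a => x.1 (a + u) - x.1 u, fun a => (exp (-2 * x.1 u) : ℂ) * (x.2 (a + u) - x.2 u))

/-- The normalised flat Delaunay layouts. -/
def flatLayouts (ℓ : Fin 6 → ℝ) : Set Layout :=
  {x | x.1 0 = 0 ∧ x.2 0 = 0 ∧ IsFlatDelaunay ℓ x.1 ∧ HasScaledLengths ℓ x}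

lemma HasScaledLengths.recentre {ℓ : Fin 6 → ℝ} {x : Layout} (hx : HasScaledLengths ℓ x)
    (u : ℤ × ℤ) : HasScaledLengths ℓ (recentre u x) := by
  intro v k
  have h := hx (v + u) k
  rw [dist_eq_norm] at h
  simp only [_root_.recentre]
  rw [dist_eq_norm, ← mul_sub, sub_sub_sub_cancel_right, norm_mul, add_right_comm v (hexDir k) u,
    h, ← mul_assoc]
  congr 1
  rw [Complex.norm_real, norm_of_nonneg (exp_pos _).le, ← exp_add]
  congr 1
  ring

lemma recentre_recentre (u v : ℤ × ℤ) (x : Layout) :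
    recentre u (recentre v x) = recentre (u + v) x := by
  unfold recentre
  ext a
  · simp [add_assoc]
  · simp only [add_assoc]
    rw [← mul_sub, ← mul_assoc, ← Complex.ofReal_mul, ← exp_add, sub_sub_sub_cancel_right]
    congr 4
    ring

lemma continuous_recentre (u : ℤ × ℤ) : Continuous (recentre u) := by
  unfold recentre
  fun_prop

lemma recentre_mem_flatLayouts {ℓ : Fin 6 → ℝ} {x : Layout} (hw : IsFlatDelaunay ℓ x.1)
    (hx : HasScaledLengths ℓ x) (u : ℤ × ℤ) : recentre u x ∈ flatLayouts ℓ :=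
  ⟨by simp [recentre], by simp [recentre], hw.shift u _, hx.recentre u⟩

lemma isClosed_flatLayouts {ℓ : Fin 6 → ℝ} (hℓ : ∀ k, 0 < ℓ k) : IsClosed (flatLayouts ℓ) := by
  refine (isClosed_eq (by fun_prop) continuous_const).inter
    ((isClosed_eq (by fun_prop) continuous_const).inter
    (((isClosed_isFlatDelaunay hℓ).preimage continuous_fst).inter ?_))
  have : IsClosed {x : Layout | ∀ v k, dist (x.2 v) (x.2 (v + hexDir k)) =
      exp (x.1 v + x.1 (v + hexDir k)) * ℓ k} := by
    simp only [Set.ofPred_forall]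
    exact isClosed_iInter fun v => isClosed_iInter fun k => isClosed_eq (by fun_prop) (by fun_prop)
  exact this

lemma isCompact_flatLayouts {ℓ : Fin 6 → ℝ} (hℓ : ∀ k, 0 < ℓ k) : IsCompact (flatLayouts ℓ) := by
  obtain ⟨C, hC⟩ := exists_abs_sub_le hℓ
  have hbound : ∀ a : ℤ × ℤ, ∃ R : ℝ, ∀ x ∈ flatLayouts ℓ, |x.1 a| ≤ R ∧ ‖x.2 a‖ ≤ R := by
    intro a
    induction a using hexDir_induction with
    | h0 => exact ⟨0, fun x hx => by simp [hx.1, hx.2.1]⟩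
    | hstep v k ih =>
      obtain ⟨R, hR⟩ := ih
      refine ⟨max (R + C) (R + exp (R + (R + C)) * ℓ k), fun x hx => ?_⟩
      obtain ⟨h1, h2⟩ := hR x hx
      have h3 := hC x.1 hx.2.2.1 v k
      have h4 : |x.1 (v + hexDir k)| ≤ R + C := by
        have := abs_add_le (x.1 v) (x.1 (v + hexDir k) - x.1 v)
        rw [add_sub_cancel] at this
        linarith
      refine ⟨h4.trans (le_max_left _ _), le_trans ?_ (le_max_right _ _)⟩
      have h5 := hx.2.2.2 v k
      have h6 : exp (x.1 v + x.1 (v + hexDir k)) ≤ exp (R + (R + C)) :=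
        exp_le_exp.2 (by linarith [le_abs_self (x.1 v), le_abs_self (x.1 (v + hexDir k))])
      have h7 := mul_le_mul_of_nonneg_right h6 (hℓ k).le
      have h8 := norm_sub_norm_le (x.2 (v + hexDir k)) (x.2 v)
      rw [dist_comm, dist_eq_norm] at h5
      linarith
  choose R hR using hbound
  refine IsCompact.of_isClosed_subset (s := (Set.univ.pi fun a => Set.Icc (-R a) (R a)) ×ˢ
    (Set.univ.pi fun a => Metric.closedBall (0 : ℂ) (R a))) ?_ (isClosed_flatLayouts hℓ) ?_
  · exact (isCompact_univ_pi fun a => isCompact_Icc).prod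
      (isCompact_univ_pi fun a => isCompact_closedBall _ _)
  · intro x hx
    refine ⟨fun a _ => abs_le.1 (hR a x hx).1, fun a _ => ?_⟩
    simpa using (hR a x hx).2

/-- In a compact recentring invariant family of layouts, the elements that grow by the largest
possible amount in direction `d` at every vertex form such a family again. -/
lemma exists_maximal_slope {ℓ : Fin 6 → ℝ} (hℓ : ∀ k, 0 < ℓ k) {K : Set Layout}
    (hK : IsClosed K) (hKℓ : K ⊆ flatLayouts ℓ) (hne : K.Nonempty)
    (hinv : ∀ x ∈ K, ∀ u, recentre u x ∈ K) (d : ℤ × ℤ) :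
    ∃ K' ⊆ K, IsClosed K' ∧ K'.Nonempty ∧ (∀ x ∈ K', ∀ u, recentre u x ∈ K') ∧
      ∃ M : ℝ, (∀ x ∈ K, x.1 d ≤ M) ∧ ∀ x ∈ K', ∀ v, x.1 (v + d) - x.1 v = M := by
  have hcpt : IsCompact K := (isCompact_flatLayouts hℓ).of_isClosed_subset hK hKℓ
  obtain ⟨y, hyK, hy⟩ := hcpt.exists_isMaxOn hne
    (f := fun x : Layout => x.1 d) (by fun_prop)
  refine ⟨K ∩ {x | ∀ v, x.1 (v + d) - x.1 v = y.1 d}, Set.inter_subset_left, hK.inter ?_,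
    ⟨y, hyK, ?_⟩, fun x hx u => ⟨hinv x hx.1 u, fun v => ?_⟩, y.1 d, fun x hx => hy hx,
    fun x hx => hx.2⟩
  · simp only [Set.ofPred_forall]
    exact isClosed_iInter fun v => isClosed_eq (by fun_prop) continuous_const
  · intro v
    obtain ⟨hy0, -, hyf, -⟩ := hKℓ hyK
    have := hyf.sub_eq_of_le hℓ (d := d) (fun v => ?_) v
    · rw [this, hy0, sub_zero]
    · have := hy (hinv y hyK v)
      simp only [recentre, Set.mem_ofPred_eq] at this
      rw [hy0, sub_zero, add_comm v d]
      exact this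
  · have := hx.2 (v + u)
    simp only [recentre, sub_sub_sub_cancel_right]
    rwa [add_right_comm]

/-- A non-constant flat Delaunay scaling factor produces a non-constant linear one among the
limits of its recentrings. -/
lemma exists_linear_limit {ℓ : Fin 6 → ℝ} (hℓ : ∀ k, 0 < ℓ k) {x : Layout}
    (hw : IsFlatDelaunay ℓ x.1) (hx : HasScaledLengths ℓ x) {a b : ℤ × ℤ} (hab : x.1 a ≠ x.1 b) :
    ∃ y ∈ closure (Set.range fun u => recentre u x), y ∈ flatLayouts ℓ ∧
      ∃ M N : ℝ, (M ≠ 0 ∨ N ≠ 0) ∧ ∀ v : ℤ × ℤ, y.1 v = M * v.1 + N * v.2 := by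
  set K := closure (Set.range fun u => recentre u x) with hKdef
  have hKℓ : K ⊆ flatLayouts ℓ := by
    refine closure_minimal ?_ (isClosed_flatLayouts hℓ)
    rintro _ ⟨u, rfl⟩
    exact recentre_mem_flatLayouts hw hx u
  have hinv : ∀ y ∈ K, ∀ u, recentre u y ∈ K := by
    intro y hy u
    refine map_mem_closure (continuous_recentre u) hy ?_
    rintro _ ⟨v, rfl⟩
    exact ⟨u + v, (recentre_recentre u v x).symm⟩
  obtain ⟨u, d, hd⟩ : ∃ u d, x.1 u < x.1 (u + d) := by
    rcases hab.lt_or_gt with h | h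
    · exact ⟨a, b - a, by simpa using h⟩
    · exact ⟨b, a - b, by simpa using h⟩
  have huK : recentre u x ∈ K := subset_closure ⟨u, rfl⟩
  obtain ⟨K₁, hK₁, hc₁, hn₁, hi₁, m, hm, hm₁⟩ :=
    exists_maximal_slope hℓ isClosed_closure hKℓ ⟨_, huK⟩ hinv d
  obtain ⟨K₂, hK₂, hc₂, hn₂, hi₂, M, -, hM⟩ :=
    exists_maximal_slope hℓ hc₁ (hK₁.trans hKℓ) hn₁ hi₁ (1, 0)
  obtain ⟨K₃, hK₃, hc₃, ⟨y, hy⟩, hi₃, N, -, hN⟩ :=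
    exists_maximal_slope hℓ hc₂ (hK₂.trans (hK₁.trans hKℓ)) hn₂ hi₂ (0, 1)
  have hyK : y ∈ K := hK₁ (hK₂ (hK₃ hy))
  have hy0 : y.1 0 = 0 := (hKℓ hyK).1
  have hM' := hM y (hK₃ hy)
  have hN' := hN y hy
  have hlin : ∀ v : ℤ × ℤ, y.1 v = M * v.1 + N * v.2 := by
    have h1 : ∀ i : ℤ, y.1 (i, 0) = M * i := by
      intro i
      induction i using Int.induction_on with
      | zero =>
        have : y.1 (0, 0) = 0 := hy0
        simp [this]
      | succ i ih =>
        have := hM' (i, 0)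
        simp only [Prod.mk_add_mk, add_zero] at this
        push_cast at ih ⊢
        linarith
      | pred i ih =>
        have := hM' (-i - 1, 0)
        simp only [Prod.mk_add_mk, add_zero, sub_add_cancel] at this
        push_cast at ih ⊢
        linarith
    rintro ⟨i, j⟩
    induction j using Int.induction_on with
    | zero => simpa using h1 i
    | succ j ih =>
      have := hN' (i, j)
      simp only [Prod.mk_add_mk, add_zero] at this
      push_cast at ih ⊢
      linarith
    | pred j ih =>
      have := hN' (i, -j - 1)
      simp only [Prod.mk_add_mk, add_zero, sub_add_cancel] at this
      push_cast at ih ⊢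
      linarith
  refine ⟨y, hyK, hKℓ hyK, M, N, ?_, hlin⟩
  by_contra! h
  have h1 := hm₁ y (hK₂ (hK₃ hy)) 0
  have h2 := hm _ huK
  simp only [recentre, add_comm d u] at h2
  rw [hlin, hlin, h.1, h.2] at h1
  simp at h1
  linarith

/-- The cross product of two plane vectors. -/
def planeCross (z w : ℂ) : ℝ := z.re * w.im - z.im * w.re

/-- The point with barycentric coordinates `1 - s - t`, `s`, `t` in the image of the lattice
triangle with vertices `v`, `v + hexDir k`, `v + hexDir (k + 1)` under the piecewise affine
extension of `P`. -/
noncomputable def trianglePoint (P : ℤ × ℤ → ℂ) (v : ℤ × ℤ) (k : Fin 6) (s t : ℝ) : ℂ :=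
  P v + s * (P (v + hexDir k) - P v) + t * (P (v + hexDir (k + 1)) - P v)

/-- The coordinates of the point with barycentric coordinates `1 - s - t`, `s`, `t` in the
lattice triangle with vertices `v`, `v + hexDir k`, `v + hexDir (k + 1)`. -/
noncomputable def hexPoint (v : ℤ × ℤ) (k : Fin 6) (s t : ℝ) : ℝ × ℝ :=
  (v.1 + s * (hexDir k).1 + t * (hexDir (k + 1)).1,
    v.2 + s * (hexDir k).2 + t * (hexDir (k + 1)).2)

/-- The piecewise affine extension of `P` is injective. -/
def IsTriangleInjective (P : ℤ × ℤ → ℂ) : Prop :=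
  ∀ v k s t v' k' s' t', 0 ≤ s → 0 ≤ t → s + t ≤ 1 → 0 ≤ s' → 0 ≤ t' → s' + t' ≤ 1 →
    trianglePoint P v k s t = trianglePoint P v' k' s' t' → (hexPoint v k s t = hexPoint v' k' s' t')

/-- The piecewise affine extension of `P` is an orientation preserving embedding. -/
structure IsHexEmbedding (P : ℤ × ℤ → ℂ) : Prop where
  oriented : ∀ v k, 0 < planeCross (P (v + hexDir k) - P v) (P (v + hexDir (k + 1)) - P v)
  injective : IsTriangleInjective P

lemma planeCross_mul_left (c z w : ℂ) :
    planeCross (c * z) (c * w) = Complex.normSq c * planeCross z w := by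
  simp only [planeCross, Complex.mul_re, Complex.mul_im, Complex.normSq_apply]; ring

lemma IsHexEmbedding.affine {P : ℤ × ℤ → ℂ} (hP : IsHexEmbedding P) {c : ℂ} (hc : c ≠ 0)
    (d : ℂ) : IsHexEmbedding (fun v => c * (P v - d)) := by
  refine ⟨fun v k => ?_, fun v k s t v' k' s' t' h1 h2 h3 h4 h5 h6 h => ?_⟩
  · rw [← mul_sub, ← mul_sub, sub_sub_sub_cancel_right, sub_sub_sub_cancel_right,
      planeCross_mul_left]
    exact mul_pos (Complex.normSq_pos.2 hc) (hP.oriented v k)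
  · refine hP.injective v k s t v' k' s' t' h1 h2 h3 h4 h5 h6 ?_
    have key : ∀ v k s t, trianglePoint (fun v => c * (P v - d)) v k s t =
        c * (trianglePoint P v k s t - d) := by
      intro v k s t
      simp only [trianglePoint]
      ring
    rw [key, key] at h
    exact sub_left_inj.1 (mul_left_cancel₀ hc h)

/-- The rotation of the triangular lattice by an angle of `π / 3`. -/
def hexRot (v : ℤ × ℤ) : ℤ × ℤ := (-v.2, v.1 + v.2)

lemma hexRot_add_hexDir (v : ℤ × ℤ) (k : Fin 6) :
    hexRot (v + hexDir k) = hexRot v + hexDir (k + 1) := by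
  have : ∀ k, hexRot (hexDir k) = hexDir (k + 1) := by decide
  rw [← this]
  simp only [hexRot, Prod.fst_add, Prod.snd_add, Prod.mk_add_mk, Prod.mk.injEq]
  constructor <;> ring

lemma hexPoint_hexRot (v : ℤ × ℤ) (k : Fin 6) (s t : ℝ) :
    hexPoint (hexRot v) (k + 1) s t =
      (-(hexPoint v k s t).2, (hexPoint v k s t).1 + (hexPoint v k s t).2) := by
  have : ∀ k, hexDir (k + 1) = hexRot (hexDir k) := by decide
  simp only [hexPoint, this, hexRot]
  push_cast
  ext <;> simp <;> ring

lemma IsHexEmbedding.hexRot {P : ℤ × ℤ → ℂ} (hP : IsHexEmbedding P) :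
    IsHexEmbedding (fun v => P (hexRot v)) := by
  refine ⟨fun v k => ?_, fun v k s t v' k' s' t' h1 h2 h3 h4 h5 h6 h => ?_⟩
  · simp only [hexRot_add_hexDir]
    exact hP.oriented _ _
  · have := hP.injective (_root_.hexRot v) (k + 1) s t (_root_.hexRot v') (k' + 1) s' t'
      h1 h2 h3 h4 h5 h6 (by simpa only [trianglePoint, hexRot_add_hexDir] using h)
    rw [hexPoint_hexRot, hexPoint_hexRot, Prod.mk.injEq, neg_inj] at this
    ext
    · linarith [this.1, this.2]
    · exact this.1

lemma IsPreconnected.neg_of_ne_zero {s : Set ℝ} (hs : IsPreconnected s) {f : ℝ → ℝ}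
    (hf : Continuous f) (h0 : ∀ x ∈ s, f x ≠ 0) {a b : ℝ} (ha : a ∈ s) (hb : b ∈ s)
    (hfa : f a < 0) : f b < 0 := by
  by_contra! h
  obtain ⟨x, hx, hx0⟩ := hs.intermediate_value ha hb hf.continuousOn ⟨hfa.le, h⟩
  exact h0 x hx hx0

/-- A curve that enters the region between two curves with a common left end through its right
end cannot continue beyond the left end without crossing. -/
lemma false_of_trapped_graph {U L C : ℝ → ℝ} {a b a' b' : ℝ} (hU : Continuous U)
    (hL : Continuous L) (hC : Continuous C) (ha' : a < a' ∧ a' < b) (hb' : a < b' ∧ b' < b)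
    (hLa : L a = U a) (hLa' : L a' < U a') (hCb : C b = U b) (hCb' : C b' < U b')
    (hLU : ∀ x ∈ Set.Ioc a b, L x ≠ U x) (hCU : ∀ x ∈ Set.Ico a b, C x ≠ U x)
    (hLC : ∀ x ∈ Set.Icc a b, L x ≠ C x) : False := by
  have hab := ha'.1.trans ha'.2
  have h1 : L b - U b < 0 := isPreconnected_Ioc.neg_of_ne_zero (hL.sub hU)
    (fun x hx => sub_ne_zero.2 (hLU x hx)) ⟨ha'.1, ha'.2.le⟩ ⟨hab, le_rfl⟩ (sub_neg.2 hLa')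
  have h2 : C a - U a < 0 := isPreconnected_Ico.neg_of_ne_zero (hC.sub hU)
    (fun x hx => sub_ne_zero.2 (hCU x hx)) ⟨hb'.1.le, hb'.2⟩ ⟨le_rfl, hab⟩ (sub_neg.2 hCb')
  have h3 : L a - C a < 0 := isPreconnected_Icc.neg_of_ne_zero (hL.sub hC)
    (fun x hx => sub_ne_zero.2 (hLC x hx)) ⟨hab.le, le_rfl⟩ ⟨le_rfl, hab.le⟩
    (by simp only [Pi.sub_apply]; linarith)
  linarith

/-- The affine function whose graph passes through `p` and `q`. -/
noncomputable def lineThrough (p q : ℂ) (x : ℝ) : ℝ :=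
  p.im + (x - p.re) * ((q.im - p.im) / (q.re - p.re))

lemma continuous_lineThrough (p q : ℂ) : Continuous (lineThrough p q) := by
  unfold lineThrough
  fun_prop

lemma lineThrough_left (p q : ℂ) : lineThrough p q p.re = p.im := by simp [lineThrough]

lemma lineThrough_right {p q : ℂ} (h : p.re < q.re) : lineThrough p q q.re = q.im := by
  have := (sub_pos.2 h).ne'
  unfold lineThrough
  field_simp
  ring

lemma exists_eq_lineThrough {p q : ℂ} (h : p.re < q.re) {x : ℝ} (hx : x ∈ Set.Icc p.re q.re) :
    ∃ s : ℝ, 0 ≤ s ∧ s ≤ 1 ∧ (x < q.re → s < 1) ∧ (p.re < x → 0 < s) ∧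
      (⟨x, lineThrough p q x⟩ : ℂ) = p + s * (q - p) := by
  have h' := sub_pos.2 h
  refine ⟨(x - p.re) / (q.re - p.re), div_nonneg (sub_nonneg.2 hx.1) h'.le,
    (div_le_one h').2 (by linarith [hx.2]), fun hq => (div_lt_one h').2 (by linarith),
    fun hp => div_pos (sub_pos.2 hp) h', ?_⟩
  apply Complex.ext
  · simp only [Complex.add_re, Complex.re_ofReal_mul, Complex.sub_re]
    field_simp
    ring
  · simp only [lineThrough, Complex.add_im, Complex.im_ofReal_mul, Complex.sub_im]
    ring

/-- The function whose graph is the polygonal curve `p₀ p₁ p₂ p₃`. -/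
noncomputable def pathThrough (p₀ p₁ p₂ p₃ : ℂ) (x : ℝ) : ℝ :=
  if x ≤ p₁.re then lineThrough p₀ p₁ x else
    if x ≤ p₂.re then lineThrough p₁ p₂ x else lineThrough p₂ p₃ x

lemma continuous_pathThrough {p₀ p₁ p₂ p₃ : ℂ} (h₀ : p₀.re < p₁.re) (h₁ : p₁.re < p₂.re) :
    Continuous (pathThrough p₀ p₁ p₂ p₃) := by
  unfold pathThrough
  refine (continuous_lineThrough _ _).if_le ((continuous_lineThrough _ _).if_le
    (continuous_lineThrough _ _) continuous_id continuous_const ?_) continuous_id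
    continuous_const ?_
  · rintro x rfl
    rw [lineThrough_right h₁, lineThrough_left]
  · rintro x rfl
    rw [if_pos h₁.le, lineThrough_right h₀, lineThrough_left]

lemma pathThrough_left {p₀ p₁ p₂ p₃ : ℂ} (h₀ : p₀.re < p₁.re) :
    pathThrough p₀ p₁ p₂ p₃ p₀.re = p₀.im := by
  rw [pathThrough, if_pos h₀.le, lineThrough_left]

lemma pathThrough_right {p₀ p₁ p₂ p₃ : ℂ} (h₁ : p₁.re < p₂.re) (h₂ : p₂.re < p₃.re) :
    pathThrough p₀ p₁ p₂ p₃ p₃.re = p₃.im := by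
  rw [pathThrough, if_neg (h₁.trans h₂).not_ge, if_neg h₂.not_ge, lineThrough_right h₂]

lemma planeCross_trans {z₁ z₂ z₃ : ℂ} (h₁ : 0 < z₁.re * z₂.re) (h₂ : 0 < z₂.re * z₃.re)
    (h₁₂ : 0 < planeCross z₁ z₂) (h₂₃ : 0 < planeCross z₂ z₃) : 0 < planeCross z₁ z₃ := by
  have key : z₂.re ^ 2 * planeCross z₁ z₃ =
      z₂.re * z₃.re * planeCross z₁ z₂ + z₁.re * z₂.re * planeCross z₂ z₃ := by
    simp only [planeCross]; ring
  have : z₂.re ≠ 0 := by rintro h; simp [h] at h₁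
  have h2 : 0 < z₂.re ^ 2 := by positivity
  exact pos_of_mul_pos_right (key ▸ by positivity) h2.le

lemma exists_eq_edge {P : ℤ × ℤ → ℂ} {v : ℤ × ℤ} {k : Fin 6}
    (h : (P v).re < (P (v + hexDir k)).re) {x : ℝ}
    (hx : x ∈ Set.Icc (P v).re (P (v + hexDir k)).re) :
    ∃ s : ℝ, 0 ≤ s ∧ s ≤ 1 ∧ (x < (P (v + hexDir k)).re → s < 1) ∧ ((P v).re < x → 0 < s) ∧
      (⟨x, lineThrough (P v) (P (v + hexDir k)) x⟩ : ℂ) = trianglePoint P v k s 0 := by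
  obtain ⟨s, h1, h2, h3, h4, h5⟩ := exists_eq_lineThrough h hx
  exact ⟨s, h1, h2, h3, h4, by rw [h5]; simp [trianglePoint]⟩

/-- Points on a monotone path of three edges. -/
lemma exists_eq_path {P : ℤ × ℤ → ℂ} {v₀ v₁ v₂ v₃ : ℤ × ℤ} {k₀ k₁ k₂ : Fin 6}
    (e₁ : v₁ = v₀ + hexDir k₀) (e₂ : v₂ = v₁ + hexDir k₁) (e₃ : v₃ = v₂ + hexDir k₂)
    (h₀ : (P v₀).re < (P v₁).re) (h₁ : (P v₁).re < (P v₂).re) (h₂ : (P v₂).re < (P v₃).re)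
    {x : ℝ} (hx : x ∈ Set.Icc (P v₀).re (P v₃).re) :
    ∃ v k s, 0 ≤ s ∧ s ≤ 1 ∧ (⟨x, pathThrough (P v₀) (P v₁) (P v₂) (P v₃) x⟩ : ℂ) =
      trianglePoint P v k s 0 ∧ ((v = v₀ ∧ k = k₀ ∧ ((P v₀).re < x → 0 < s)) ∨
        (v = v₁ ∧ k = k₁) ∨ (v = v₂ ∧ k = k₂ ∧ (x < (P v₃).re → s < 1))) := by
  subst e₁ e₂ e₃
  unfold pathThrough
  split_ifs with c₁ c₂
  · obtain ⟨s, i1, i2, i3, i4, i5⟩ := exists_eq_edge h₀ ⟨hx.1, c₁⟩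
    exact ⟨_, _, s, i1, i2, i5, Or.inl ⟨rfl, rfl, i4⟩⟩
  · obtain ⟨s, i1, i2, i3, i4, i5⟩ := exists_eq_edge h₁ ⟨(not_le.1 c₁).le, c₂⟩
    exact ⟨_, _, s, i1, i2, i5, Or.inr (Or.inl ⟨rfl, rfl⟩)⟩
  · obtain ⟨s, i1, i2, i3, i4, i5⟩ := exists_eq_edge h₂ ⟨(not_le.1 c₂).le, hx.2⟩
    exact ⟨_, _, s, i1, i2, i5, Or.inr (Or.inr ⟨rfl, rfl, i3⟩)⟩

lemma lineThrough_lt_of_planeCross {p q q' : ℂ} {x : ℝ} (hq : p.re < q.re) (hq' : p.re < q'.re)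
    (hx : p.re < x) (h : 0 < planeCross (q - p) (q' - p)) :
    lineThrough p q x < lineThrough p q' x := by
  unfold lineThrough
  have h1 : (q.im - p.im) / (q.re - p.re) < (q'.im - p.im) / (q'.re - p.re) := by
    rw [div_lt_div_iff₀ (sub_pos.2 hq) (sub_pos.2 hq')]
    simp only [planeCross, Complex.sub_re, Complex.sub_im] at h
    linarith
  have h2 := mul_lt_mul_of_pos_left h1 (sub_pos.2 hx)
  linarith

lemma lineThrough_lt_of_planeCross' {p q q' : ℂ} {x : ℝ} (hq : q.re < p.re) (hq' : q'.re < p.re)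
    (hx : x < p.re) (h : 0 < planeCross (q - p) (q' - p)) :
    lineThrough q' p x < lineThrough q p x := by
  have h1 : (p.im - q.im) / (p.re - q.re) < (p.im - q'.im) / (p.re - q'.re) := by
    rw [div_lt_div_iff₀ (sub_pos.2 hq) (sub_pos.2 hq')]
    simp only [planeCross, Complex.sub_re, Complex.sub_im] at h
    linarith
  have h2 := mul_lt_mul_of_pos_left h1 (sub_pos.2 hx)
  have key : ∀ {q : ℂ}, q.re < p.re →
      lineThrough q p x = p.im - (p.re - x) * ((p.im - q.im) / (p.re - q.re)) := by
    intro q hq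
    have := (sub_pos.2 hq).ne'
    unfold lineThrough
    field_simp
    ring
  rw [key hq, key hq']
  linarith

/-- The real parts of the vertices of an embedding cannot be ordered like the points of an
alternating geometric progression. -/
lemma IsHexEmbedding.false_of_alternating {P : ℤ × ℤ → ℂ} (hP : IsHexEmbedding P)
    (h₁ : (P (1, 0)).re < (P (0, 0)).re) (h₂ : (P (0, 0)).re < (P (0, 1)).re)
    (h₃ : (P (0, 1)).re < (P (0, 2)).re) (h₄ : (P (2, -1)).re < (P (0, 2)).re)
    (h₅ : (P (1, 0)).re < (P (1, -1)).re) (h₆ : (P (1, 0)).re < (P (2, -1)).re)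
    (h₇ : (P (1, -1)).re < (P (2, -1)).re) (h₈ : (P (2, -2)).re < (P (2, -1)).re)
    (h₉ : (P (3, -2)).re < (P (2, -1)).re) (h₁₀ : (P (3, -1)).re < (P (2, -1)).re)
    (h₁₁ : (P (3, 0)).re < (P (3, -1)).re) (h₁₂ : (P (3, 1)).re < (P (3, 0)).re)
    (h₁₃ : (P (3, 1)).re < (P (1, 0)).re) : False := by
  have c₁ : 0 < planeCross (P (0, 0) - P (1, 0)) (P (2, -1) - P (1, 0)) := by
    have o₁ := hP.oriented (1, 0) 3
    have o₂ := hP.oriented (1, 0) 4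
    simp [hexDir] at o₁ o₂
    refine planeCross_trans ?_ ?_ o₁ o₂ <;> apply mul_pos <;> simp only [Complex.sub_re] <;>
      linarith
  have c₂ : 0 < planeCross (P (1, 0) - P (2, -1)) (P (3, -1) - P (2, -1)) := by
    have o₁ := hP.oriented (2, -1) 2
    have o₂ := hP.oriented (2, -1) 3
    have o₃ := hP.oriented (2, -1) 4
    have o₄ := hP.oriented (2, -1) 5
    simp [hexDir] at o₁ o₂ o₃ o₄
    refine planeCross_trans ?_ ?_ (planeCross_trans ?_ ?_ (planeCross_trans ?_ ?_ o₁ o₂) o₃) o₄ <;>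
      apply mul_pos_of_neg_of_neg <;> simp only [Complex.sub_re] <;> linarith
  have hU : ∀ x ∈ Set.Icc (P (1, 0)).re (P (2, -1)).re, ∃ s, 0 ≤ s ∧ s ≤ 1 ∧
      (x < (P (2, -1)).re → s < 1) ∧ ((P (1, 0)).re < x → 0 < s) ∧
      (⟨x, lineThrough (P (1, 0)) (P (2, -1)) x⟩ : ℂ) = trianglePoint P (1, 0) 5 s 0 :=
    fun x hx => exists_eq_edge (P := P) (v := (1, 0)) (k := 5) h₆ hx
  have hL := fun x hx => exists_eq_path (P := P) (v₀ := (1, 0)) (v₁ := (0, 0)) (v₂ := (0, 1))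
    (v₃ := (0, 2)) (k₀ := 3) (k₁ := 1) (k₂ := 1) rfl rfl rfl h₁ h₂ h₃ (x := x) hx
  have hC := fun x hx => exists_eq_path (P := P) (v₀ := (3, 1)) (v₁ := (3, 0)) (v₂ := (3, -1))
    (v₃ := (2, -1)) (k₀ := 4) (k₁ := 4) (k₂ := 3) rfl rfl rfl h₁₂ h₁₁ h₁₀ (x := x) hx
  have inj : ∀ v k s v' k' s', 0 ≤ s → s ≤ 1 → 0 ≤ s' → s' ≤ 1 →
      trianglePoint P v k s 0 = trianglePoint P v' k' s' 0 →
      hexPoint v k s 0 = hexPoint v' k' s' 0 := fun v k s v' k' s' i1 i2 i3 i4 =>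
    hP.injective _ _ _ _ _ _ _ _ i1 le_rfl (by linarith) i3 le_rfl (by linarith)
  refine false_of_trapped_graph (continuous_lineThrough (P (1, 0)) (P (2, -1)))
    (continuous_pathThrough (p₃ := P (0, 2)) h₁ h₂) (continuous_pathThrough (p₃ := P (2, -1)) h₁₂ h₁₁)
    (a := (P (1, 0)).re) (b := (P (2, -1)).re)
    (a' := min (P (0, 0)).re (((P (1, 0)).re + (P (2, -1)).re) / 2))
    (b' := max (P (3, -1)).re (((P (1, 0)).re + (P (2, -1)).re) / 2))
    ⟨lt_min h₁ (by linarith), lt_of_le_of_lt (min_le_right _ _) (by linarith)⟩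
    ⟨lt_of_lt_of_le (by linarith) (le_max_right _ _), max_lt h₁₀ (by linarith)⟩
    ?_ ?_ ?_ ?_ ?_ ?_ ?_
  · rw [pathThrough_left h₁, lineThrough_left]
  · rw [pathThrough, if_pos (min_le_left _ _)]
    exact lineThrough_lt_of_planeCross h₁ h₆ (lt_min h₁ (by linarith)) c₁
  · rw [pathThrough_right h₁₁ h₁₀, lineThrough_right h₆]
  · have hb : max (P (3, -1)).re (((P (1, 0)).re + (P (2, -1)).re) / 2) < (P (2, -1)).re :=
      max_lt h₁₀ (by linarith)
    have h3 : (P (3, -1)).re ≤ max (P (3, -1)).re (((P (1, 0)).re + (P (2, -1)).re) / 2) :=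
      le_max_left _ _
    have key := lineThrough_lt_of_planeCross' h₆ h₁₀ hb c₂
    rw [pathThrough, if_neg (by linarith)]
    split_ifs with h
    · rw [← h3.antisymm h] at key ⊢
      rwa [lineThrough_right h₁₁, ← lineThrough_left (P (3, -1)) (P (2, -1))]
    · exact key
  · rintro x ⟨hx1, hx2⟩ heq
    obtain ⟨s, i1, i2, i3, i4, i5⟩ := hU x ⟨hx1.le, hx2⟩
    obtain ⟨v, k, s', j1, j2, j3, j4⟩ := hL x ⟨hx1.le, by linarith⟩
    rw [heq, i5] at j3
    have := inj _ _ _ _ _ _ i1 i2 j1 j2 j3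
    have i4 := i4 hx1
    rcases j4 with ⟨rfl, rfl, -⟩ | ⟨rfl, rfl⟩ | ⟨rfl, rfl, -⟩ <;>
      simp [hexPoint, hexDir] at this <;> linarith [this.1, this.2]
  · rintro x ⟨hx1, hx2⟩ heq
    obtain ⟨s, i1, i2, i3, i4, i5⟩ := hU x ⟨hx1, hx2.le⟩
    obtain ⟨v, k, s', j1, j2, j3, j4⟩ := hC x ⟨by linarith, hx2.le⟩
    rw [heq, i5] at j3
    have := inj _ _ _ _ _ _ i1 i2 j1 j2 j3
    have i3 := i3 hx2
    rcases j4 with ⟨rfl, rfl, -⟩ | ⟨rfl, rfl⟩ | ⟨rfl, rfl, -⟩ <;>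
      simp [hexPoint, hexDir] at this <;> linarith [this.1, this.2]
  · rintro x ⟨hx1, hx2⟩ heq
    obtain ⟨v, k, s, i1, i2, i3, i4⟩ := hL x ⟨hx1, by linarith⟩
    obtain ⟨v', k', s', j1, j2, j3, j4⟩ := hC x ⟨by linarith, hx2⟩
    rw [← heq, i3] at j3
    have := inj _ _ _ _ _ _ i1 i2 j1 j2 j3
    rcases i4 with ⟨rfl, rfl, -⟩ | ⟨rfl, rfl⟩ | ⟨rfl, rfl, -⟩ <;>
    rcases j4 with ⟨rfl, rfl, -⟩ | ⟨rfl, rfl⟩ | ⟨rfl, rfl, -⟩ <;>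
      simp [hexPoint, hexDir] at this <;> linarith [this.1, this.2]

lemma mem_closure_hexEmbedding_affine {P : ℤ × ℤ → ℂ} (hP : P ∈ closure {Q | IsHexEmbedding Q})
    {c : ℂ} (hc : c ≠ 0) (d : ℂ) : (fun v => c * (P v - d)) ∈ closure {Q | IsHexEmbedding Q} :=
  map_mem_closure (f := fun (Q : ℤ × ℤ → ℂ) v => c * (Q v - d)) (by fun_prop) hP
    fun _ hQ => hQ.affine hc d

lemma mem_closure_hexEmbedding_hexRot {P : ℤ × ℤ → ℂ} (hP : P ∈ closure {Q | IsHexEmbedding Q}) :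
    (fun v => P (hexRot v)) ∈ closure {Q | IsHexEmbedding Q} :=
  map_mem_closure (f := fun (Q : ℤ × ℤ → ℂ) v => Q (hexRot v)) (by fun_prop) hP
    fun _ hQ => hQ.hexRot

/-- The parameters of an alternating geometric progression that is not a limit of embeddings. -/
def IsAlternating (a b : ℝ) : Prop := a ≤ -1 ∧ -a ≤ b ∧ 1 < b

lemma not_isAlternating {P : ℤ × ℤ → ℂ} (hP : P ∈ closure {Q | IsHexEmbedding Q})
    {z c : ℂ} (hc : c ≠ 0) {a b : ℝ} (hPv : ∀ v, P v = z + c * ((a ^ v.1 * b ^ v.2 : ℝ) : ℂ)) :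
    ¬ IsAlternating a b := by
  rintro ⟨ha, hab, hb⟩
  have hP' := mem_closure_hexEmbedding_affine hP (inv_ne_zero hc) z
  obtain ⟨P', rfl, hP'v⟩ : ∃ P', P' = (fun v => c⁻¹ * (P v - z)) ∧
      ∀ m n : ℤ, (P' (m, n)).re = a ^ m * b ^ n := by
    refine ⟨_, rfl, fun m n => ?_⟩
    simp only [hPv, add_sub_cancel_left, inv_mul_cancel_left₀ hc, Complex.ofReal_re]
  set P' := fun v => c⁻¹ * (P v - z)
  have ev : ∀ u v, (P' u).re < (P' v).re → ∀ᶠ Q : ℤ × ℤ → ℂ in nhds P', (Q u).re < (Q v).re := by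
    intro u v h
    exact ContinuousAt.eventually_lt
      (Complex.continuous_re.comp (continuous_apply u)).continuousAt
      (Complex.continuous_re.comp (continuous_apply v)).continuousAt h
  have hb0 : 0 < b := by linarith
  have ha0 : a < 0 := by linarith
  have hbi : b⁻¹ < 1 := inv_lt_one_of_one_lt₀ hb
  have hbi0 : 0 < b⁻¹ := inv_pos.2 hb0
  have hbb : b * b⁻¹ = 1 := mul_inv_cancel₀ hb0.ne'
  have hai : -a * b⁻¹ ≤ 1 := by
    rw [← div_eq_mul_inv, div_le_one hb0]; exact hab
  have ha2 : 1 ≤ a ^ 2 := by nlinarith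
  have ha3 : a ^ 3 ≤ a := by nlinarith
  have hfreq := mem_closure_iff_frequently.1 hP'
  have z2 : ∀ r : ℝ, r ^ (2 : ℤ) = r ^ 2 := fun r => zpow_ofNat r 2
  have z3 : ∀ r : ℝ, r ^ (3 : ℤ) = r ^ 3 := fun r => zpow_ofNat r 3
  have zm1 : ∀ r : ℝ, r ^ (-1 : ℤ) = r⁻¹ := fun r => zpow_neg_one r
  have zm2 : ∀ r : ℝ, r ^ (-2 : ℤ) = r⁻¹ ^ 2 := fun r => by
    rw [zpow_neg, z2, inv_pow]
  have hall := (ev (1, 0) (0, 0) ?_).and <| (ev (0, 0) (0, 1) ?_).and <|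
    (ev (0, 1) (0, 2) ?_).and <| (ev (2, -1) (0, 2) ?_).and <| (ev (1, 0) (1, -1) ?_).and <|
    (ev (1, 0) (2, -1) ?_).and <| (ev (1, -1) (2, -1) ?_).and <| (ev (2, -2) (2, -1) ?_).and <|
    (ev (3, -2) (2, -1) ?_).and <| (ev (3, -1) (2, -1) ?_).and <| (ev (3, 0) (3, -1) ?_).and <|
    (ev (3, 1) (3, 0) ?_).and (ev (3, 1) (1, 0) ?_)
  · obtain ⟨Q, hQ, h₁, h₂, h₃, h₄, h₅, h₆, h₇, h₈, h₉, h₁₀, h₁₁, h₁₂, h₁₃⟩ :=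
      (hfreq.and_eventually hall).exists
    exact IsHexEmbedding.false_of_alternating hQ h₁ h₂ h₃ h₄ h₅ h₆ h₇ h₈ h₉ h₁₀ h₁₁ h₁₂ h₁₃
  all_goals
    simp only [hP'v, z2, z3, zm1, zm2, zpow_zero, zpow_one, mul_one, one_mul]
  · linarith
  · exact hb
  · nlinarith
  · nlinarith [mul_pos hbi0 hb0, mul_le_mul_of_nonneg_left hai (by linarith : 0 ≤ -a)]
  · nlinarith
  · nlinarith [mul_pos (mul_pos_of_neg_of_neg ha0 ha0) hbi0]
  · nlinarith [mul_pos (mul_pos_of_neg_of_neg ha0 ha0) hbi0, mul_pos_of_neg_of_neg ha0 (neg_neg_of_pos hbi0)]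
  · have := mul_pos (pow_pos (neg_pos.2 ha0) 2) hbi0
    nlinarith
  · have h1 := mul_pos (pow_pos (neg_pos.2 ha0) 2) hbi0
    have h2 := mul_pos (pow_pos (neg_pos.2 ha0) 3) (pow_pos hbi0 2)
    nlinarith
  · have h1 := mul_pos (pow_pos (neg_pos.2 ha0) 2) hbi0
    have h2 := mul_pos (pow_pos (neg_pos.2 ha0) 3) hbi0
    nlinarith
  · nlinarith
  · nlinarith
  · nlinarith

lemma not_isAlternating_rotations {P : ℤ × ℤ → ℂ} (hP : P ∈ closure {Q | IsHexEmbedding Q})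
    {z c : ℂ} (hc : c ≠ 0) {a b : ℝ} (ha : a ≠ 0) (hb : b ≠ 0)
    (hPv : ∀ v, P v = z + c * ((a ^ v.1 * b ^ v.2 : ℝ) : ℂ)) :
    ¬ (IsAlternating a b ∨ IsAlternating b (b / a) ∨ IsAlternating (b / a) a⁻¹ ∨
      IsAlternating a⁻¹ b⁻¹ ∨ IsAlternating b⁻¹ (a / b) ∨ IsAlternating (a / b) a) := by
  have step : ∀ {P : ℤ × ℤ → ℂ} {a b : ℝ}, a ≠ 0 → b ≠ 0 →
      (∀ v, P v = z + c * ((a ^ v.1 * b ^ v.2 : ℝ) : ℂ)) →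
      ∀ v, P (hexRot v) = z + c * ((b ^ v.1 * (b / a) ^ v.2 : ℝ) : ℂ) := by
    intro P a b ha hb h v
    rw [h, hexRot]
    congr 3
    dsimp only
    rw [zpow_add₀ hb, div_zpow, zpow_neg]
    ring
  have hd : b / a ≠ 0 := div_ne_zero hb ha
  have e1 : b / a / b = a⁻¹ := by field_simp
  have e2 : a⁻¹ / (b / a) = b⁻¹ := by field_simp
  have e3 : b⁻¹ / a⁻¹ = a / b := by field_simp
  have e4 : a / b / b⁻¹ = a := by field_simp
  have P1 := mem_closure_hexEmbedding_hexRot hP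
  have h1 := step ha hb hPv
  have P2 := mem_closure_hexEmbedding_hexRot P1
  have h2 := step (P := fun v => P (hexRot v)) hb hd h1
  rw [e1] at h2
  have P3 := mem_closure_hexEmbedding_hexRot P2
  have h3 := step (P := fun v => P (hexRot (hexRot v))) hd (inv_ne_zero ha) h2
  rw [e2] at h3
  have P4 := mem_closure_hexEmbedding_hexRot P3
  have h4 := step (P := fun v => P (hexRot (hexRot (hexRot v)))) (inv_ne_zero ha) (inv_ne_zero hb) h3
  rw [e3] at h4
  have P5 := mem_closure_hexEmbedding_hexRot P4
  have h5 := step (P := fun v => P (hexRot (hexRot (hexRot (hexRot v))))) (inv_ne_zero hb)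
    (div_ne_zero ha hb) h4
  rw [e4] at h5
  rintro (h | h | h | h | h | h)
  exacts [not_isAlternating hP hc hPv h, not_isAlternating P1 hc h1 h, not_isAlternating P2 hc h2 h,
    not_isAlternating P3 hc h3 h, not_isAlternating P4 hc h4 h, not_isAlternating P5 hc h5 h]

/-- The cosine of the angle `∠(x, z, y)`. -/
noncomputable def angleCos (x z y : ℂ) : ℝ :=
  (dist z x ^ 2 + dist z y ^ 2 - dist x y ^ 2) / (2 * dist z x * dist z y)

lemma angleCos_comm (x z y : ℂ) : angleCos x z y = angleCos y z x := by
  unfold angleCos; rw [dist_comm x y]; ring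

lemma angleCos_eq_of_sub_eq_mul {x z y u : ℂ} (hxz : x ≠ z) (h : y - z = u * (x - z)) :
    angleCos x z y = u.re / ‖u‖ := by
  have hn : 0 < ‖x - z‖ := norm_pos_iff.2 (sub_ne_zero.2 hxz)
  have e1 : dist z x = ‖x - z‖ := by rw [dist_comm, dist_eq_norm]
  have e2 : dist z y = ‖u‖ * ‖x - z‖ := by rw [dist_comm, dist_eq_norm, h, norm_mul]
  have e3 : dist x y = ‖1 - u‖ * ‖x - z‖ := by
    rw [dist_eq_norm, ← norm_mul]
    congr 1
    linear_combination -h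
  have e4 : ‖1 - u‖ ^ 2 = 1 + ‖u‖ ^ 2 - 2 * u.re := by
    rw [Complex.sq_norm, Complex.sq_norm, Complex.normSq_apply, Complex.normSq_apply]
    simp
    ring
  unfold angleCos
  rw [e1, e2, e3, mul_pow _ _ 2, mul_pow _ _ 2, e4]
  rcases eq_or_ne u 0 with rfl | hu
  · simp
  · have : 0 < ‖u‖ := norm_pos_iff.2 hu
    field_simp
    ring

/-- The sums of the cosines of the angles opposite to an edge are non-negative. -/
def HasDelaunayCos (P : ℤ × ℤ → ℂ) : Prop :=
  ∀ v k, 0 ≤ angleCos (P v) (P (v + hexDir (k + 1))) (P (v + hexDir k)) +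
    angleCos (P v) (P (v + hexDir (k - 1))) (P (v + hexDir k))

lemma sideProj_eq_angleCos {x y z : ℂ} {α β γ p q r : ℝ} (hp : 0 < p) (hq : 0 < q) (hr : 0 < r)
    (hxy : dist x y = exp (α + β) * p) (hxz : dist x z = exp (α + γ) * q)
    (hyz : dist y z = exp (β + γ) * r) :
    sideProj (r / (p * q)) (exp (2 * (α - β)) / p ^ 2) (exp (2 * (α - γ)) / q ^ 2) =
      exp (α - β) / p * angleCos x z y := by
  unfold sideProj angleCos
  rw [dist_comm z x, dist_comm z y, hxy, hxz, hyz]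
  simp only [two_mul, exp_add, exp_sub]
  have hx := exp_pos α
  have hy := exp_pos β
  have hz := exp_pos γ
  field_simp

lemma HasScaledLengths.dist_hexDir {ℓ : Fin 6 → ℝ} {x : Layout} (hx : HasScaledLengths ℓ x)
    (v : ℤ × ℤ) (k : Fin 6) : dist (x.2 (v + hexDir k)) (x.2 (v + hexDir (k + 1))) =
      exp (x.1 (v + hexDir k) + x.1 (v + hexDir (k + 1))) * ℓ (k + 2) := by
  rw [hexDir_succ, ← add_assoc]
  exact hx _ _

lemma HasScaledLengths.sideProj_add_sideProj {ℓ : Fin 6 → ℝ} (hℓ : ∀ k, 0 < ℓ k) {x : Layout}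
    (hx : HasScaledLengths ℓ x) (v : ℤ × ℤ) (k : Fin 6) :
    sideProj (starSide ℓ k) (starRadius ℓ x.1 v k) (starRadius ℓ x.1 v (k + 1)) +
      sideProj (starSide ℓ (k - 1)) (starRadius ℓ x.1 v k) (starRadius ℓ x.1 v (k - 1)) =
    exp (x.1 v - x.1 (v + hexDir k)) / ℓ k *
      (angleCos (x.2 v) (x.2 (v + hexDir (k + 1))) (x.2 (v + hexDir k)) +
        angleCos (x.2 v) (x.2 (v + hexDir (k - 1))) (x.2 (v + hexDir k))) := by
  have h1 := sideProj_eq_angleCos (hℓ k) (hℓ (k + 1)) (hℓ (k + 2)) (hx v k) (hx v (k + 1))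
    (hx.dist_hexDir v k)
  have h2 := hx.dist_hexDir v (k - 1)
  rw [sub_add_cancel, dist_comm, add_comm (x.1 _)] at h2
  have h3 := sideProj_eq_angleCos (hℓ k) (hℓ (k - 1)) (hℓ (k - 1 + 2)) (hx v k) (hx v (k - 1)) h2
  simp only [starSide, starRadius]
  rw [h1, sub_add_cancel, mul_comm (ℓ (k - 1)), h3, mul_add]

lemma IsFlatDelaunay.hasDelaunayCos {ℓ : Fin 6 → ℝ} (hℓ : ∀ k, 0 < ℓ k) {x : Layout}
    (hw : IsFlatDelaunay ℓ x.1) (hx : HasScaledLengths ℓ x) : HasDelaunayCos x.2 := by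
  intro v k
  have := (hw v).convex k
  rw [hx.sideProj_add_sideProj hℓ] at this
  exact nonneg_of_mul_nonneg_right this (div_pos (exp_pos _) (hℓ k))

lemma Complex.eq_of_norm_eq {z w : ℂ} (h : ‖z‖ = ‖w‖) (h' : ‖1 - z‖ = ‖1 - w‖) (hz : 0 ≤ z.im)
    (hw : 0 ≤ w.im) : z = w := by
  have key : ∀ z : ℂ, z.re * z.re + z.im * z.im = ‖z‖ ^ 2 := fun z => by
    rw [Complex.sq_norm, Complex.normSq_apply]
  have h1 : z.re * z.re + z.im * z.im = w.re * w.re + w.im * w.im := by rw [key, key, h]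
  have h2 : (1 - z).re * (1 - z).re + (1 - z).im * (1 - z).im =
      (1 - w).re * (1 - w).re + (1 - w).im * (1 - w).im := by rw [key, key, h']
  simp only [Complex.sub_re, Complex.sub_im, Complex.one_re, Complex.one_im] at h2
  have hre : z.re = w.re := by linarith
  refine Complex.ext hre ?_
  rw [hre] at h1
  nlinarith

lemma im_div_nonneg {a b : ℂ} (h : 0 ≤ planeCross a b) : 0 ≤ (b / a).im := by
  rw [Complex.div_im, ← sub_div]
  refine div_nonneg ?_ (Complex.normSq_nonneg _)
  unfold planeCross at h
  linarith

section LinearScaling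

variable {ℓ : Fin 6 → ℝ} {x : Layout} {M N : ℝ}

lemma HasScaledLengths.norm_sub_of_linear (hx : HasScaledLengths ℓ x)
    (hlin : ∀ v : ℤ × ℤ, x.1 v = M * v.1 + N * v.2) (v : ℤ × ℤ) :
    ‖x.2 (v + (1, 0)) - x.2 v‖ = exp (2 * x.1 v + M) * ℓ 0 ∧
    ‖x.2 (v + (0, 1)) - x.2 v‖ = exp (2 * x.1 v + N) * ℓ 1 ∧
    ‖x.2 (v + (0, 1)) - x.2 (v + (1, 0))‖ = exp (2 * x.1 v + M + N) * ℓ 2 ∧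
    ‖x.2 (v + (1, 0)) - x.2 (v + (1, 1))‖ = exp (2 * x.1 v + 2 * M + N) * ℓ 1 ∧
    ‖x.2 (v + (0, 1)) - x.2 (v + (1, 1))‖ = exp (2 * x.1 v + M + 2 * N) * ℓ 0 := by
  have e1 := hx v 0
  have e2 := hx v 1
  have e3 := hx (v + (1, 0)) 2
  have e4 := hx (v + (1, 0)) 1
  have e5 := hx (v + (0, 1)) 0
  simp only [hexDir, Matrix.cons_val, dist_eq_norm, add_assoc, Prod.mk_add_mk] at e1 e2 e3 e4 e5
  norm_num at e1 e2 e3 e4 e5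
  have w1 : x.1 (v + (1, 0)) = x.1 v + M := by
    simp only [hlin, Prod.fst_add, Prod.snd_add]; push_cast; ring
  have w2 : x.1 (v + (0, 1)) = x.1 v + N := by
    simp only [hlin, Prod.fst_add, Prod.snd_add]; push_cast; ring
  have w3 : x.1 (v + (1, 1)) = x.1 v + M + N := by
    simp only [hlin, Prod.fst_add, Prod.snd_add]; push_cast; ring
  rw [w1] at e1 e3 e4
  rw [w2] at e2 e3 e5
  rw [w3] at e4 e5
  refine ⟨?_, ?_, ?_, ?_, ?_⟩
  · rw [norm_sub_rev, e1]; ring_nf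
  · rw [norm_sub_rev, e2]; ring_nf
  · rw [norm_sub_rev, e3]; ring_nf
  · rw [e4]; ring_nf
  · rw [e5]; ring_nf

/-- Layouts for linear scaling factors have constant triangle shapes. -/
lemma HasScaledLengths.exists_shape (hℓ : ∀ k, 0 < ℓ k) (hx : HasScaledLengths ℓ x)
    (hlin : ∀ v : ℤ × ℤ, x.1 v = M * v.1 + N * v.2)
    (hor : ∀ v k, 0 ≤ planeCross (x.2 (v + hexDir k) - x.2 v) (x.2 (v + hexDir (k + 1)) - x.2 v)) :
    ∃ τ σ : ℂ, 0 ≤ τ.im ∧ 0 ≤ σ.im ∧ τ ≠ 0 ∧ τ ≠ 1 ∧ σ ≠ 0 ∧ σ ≠ 1 ∧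
      ‖τ‖ * ‖σ‖ = (ℓ 1 / ℓ 0) ^ 2 ∧ ‖1 - τ‖ * ‖1 - σ‖ = (ℓ 2 / ℓ 0) ^ 2 ∧
      (∀ v, x.2 (v + (1, 0)) ≠ x.2 v) ∧
      (∀ v, x.2 (v + (0, 1)) - x.2 v = τ * (x.2 (v + (1, 0)) - x.2 v)) ∧
      ∀ v, x.2 (v + (1, 0)) - x.2 (v + (1, 1)) = σ * (x.2 (v + (0, 1)) - x.2 (v + (1, 1))) := by
  have hlen := hx.norm_sub_of_linear hlin
  have h0 := hℓ 0
  have h1 := hℓ 1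
  have h2 := hℓ 2
  have hne : ∀ v, x.2 (v + (1, 0)) - x.2 v ≠ 0 := fun v => by
    rw [← norm_pos_iff, (hlen v).1]; positivity
  have hne' : ∀ v, x.2 (v + (0, 1)) - x.2 (v + (1, 1)) ≠ 0 := fun v => by
    rw [← norm_pos_iff, (hlen v).2.2.2.2]; positivity
  set τ : ℤ × ℤ → ℂ := fun v => (x.2 (v + (0, 1)) - x.2 v) / (x.2 (v + (1, 0)) - x.2 v) with hτ
  set σ : ℤ × ℤ → ℂ := fun v =>
    (x.2 (v + (1, 0)) - x.2 (v + (1, 1))) / (x.2 (v + (0, 1)) - x.2 (v + (1, 1))) with hσ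
  have hτn : ∀ v, ‖τ v‖ = exp (N - M) * (ℓ 1 / ℓ 0) := fun v => by
    rw [hτ, norm_div, (hlen v).1, (hlen v).2.1, mul_div_mul_comm, ← exp_sub]
    ring_nf
  have hτn' : ∀ v, ‖1 - τ v‖ = exp N * (ℓ 2 / ℓ 0) := fun v => by
    have : 1 - τ v =
        -((x.2 (v + (0, 1)) - x.2 (v + (1, 0))) / (x.2 (v + (1, 0)) - x.2 v)) := by
      have := hne v
      simp only [hτ]; field_simp; ring
    rw [this, norm_neg, norm_div, (hlen v).1, (hlen v).2.2.1, mul_div_mul_comm, ← exp_sub]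
    ring_nf
  have hσn : ∀ v, ‖σ v‖ = exp (M - N) * (ℓ 1 / ℓ 0) := fun v => by
    rw [hσ, norm_div, (hlen v).2.2.2.1, (hlen v).2.2.2.2, mul_div_mul_comm, ← exp_sub]
    ring_nf
  have hσn' : ∀ v, ‖1 - σ v‖ = exp (-N) * (ℓ 2 / ℓ 0) := fun v => by
    have : 1 - σ v =
        (x.2 (v + (0, 1)) - x.2 (v + (1, 0))) / (x.2 (v + (0, 1)) - x.2 (v + (1, 1))) := by
      have := hne' v
      simp only [hσ]; field_simp; ring
    rw [this, norm_div, (hlen v).2.2.1, (hlen v).2.2.2.2, mul_div_mul_comm, ← exp_sub]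
    ring_nf
  have hτi : ∀ v, 0 ≤ (τ v).im := fun v => im_div_nonneg (hor v 0)
  have hσi : ∀ v, 0 ≤ (σ v).im := fun v => by
    have := hor (v + (1, 1)) 3
    simp [hexDir, add_assoc] at this
    exact im_div_nonneg this
  refine ⟨τ 0, σ 0, hτi 0, hσi 0, ?_, ?_, ?_, ?_, ?_, ?_, fun v => sub_ne_zero.1 (hne v),
    fun v => ?_, fun v => ?_⟩
  · rw [← norm_pos_iff, hτn]; positivity
  · rw [ne_comm, ← sub_ne_zero, ← norm_pos_iff, hτn']; positivity
  · rw [← norm_pos_iff, hσn]; positivity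
  · rw [ne_comm, ← sub_ne_zero, ← norm_pos_iff, hσn']; positivity
  · have : exp (N - M) * exp (M - N) = 1 := by rw [← exp_add]; simp
    rw [hτn, hσn]
    linear_combination (ℓ 1 / ℓ 0) ^ 2 * this
  · have : exp N * exp (-N) = 1 := by rw [← exp_add]; simp
    rw [hτn', hσn']
    linear_combination (ℓ 2 / ℓ 0) ^ 2 * this
  · rw [Complex.eq_of_norm_eq ((hτn 0).trans (hτn v).symm) ((hτn' 0).trans (hτn' v).symm)
      (hτi 0) (hτi v)]
    exact (div_mul_cancel₀ _ (hne v)).symm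
  · rw [Complex.eq_of_norm_eq ((hσn 0).trans (hσn v).symm) ((hσn' 0).trans (hσn' v).symm)
      (hσi 0) (hσi v)]
    exact (div_mul_cancel₀ _ (hne' v)).symm

end LinearScaling

/-- A layout with constant triangle shapes is an orbit of a group of similarities. -/
lemma exists_eq_add_mul_zpow {P : ℤ × ℤ → ℂ} {τ σ : ℂ} (hτ0 : τ ≠ 0) (hτ1 : τ ≠ 1) (hσ0 : σ ≠ 0)
    (hσ1 : σ ≠ 1) (hτσ : σ ≠ τ) (hne : P (1, 0) ≠ P 0)
    (hτ : ∀ v, P (v + (0, 1)) - P v = τ * (P (v + (1, 0)) - P v))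
    (hσ : ∀ v, P (v + (1, 0)) - P (v + (1, 1)) = σ * (P (v + (0, 1)) - P (v + (1, 1)))) :
    ∃ z c : ℂ, c ≠ 0 ∧ ∀ v : ℤ × ℤ, P v = z + c *
      (((1 - τ) * σ / (τ * (1 - σ))) ^ v.1 * ((1 - τ) / (1 - σ)) ^ v.2) := by
  have hτ1' : 1 - τ ≠ 0 := sub_ne_zero.2 hτ1.symm
  have hσ1' : 1 - σ ≠ 0 := sub_ne_zero.2 hσ1.symm
  have hστ : σ - τ ≠ 0 := sub_ne_zero.2 hτσ
  set α := (1 - τ) * σ / (τ * (1 - σ)) with hα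
  set β := (1 - τ) / (1 - σ) with hβ
  have hα0 : α ≠ 0 := by rw [hα]; positivity
  have hβ0 : β ≠ 0 := by rw [hβ]; positivity
  have s2 : ∀ v, P (v + (0, 1) + (1, 0)) - P (v + (0, 1)) = β * (P (v + (1, 0)) - P v) := by
    intro v
    have e : v + (0, 1) + (1, 0) = v + (1, 1) := by simp [add_assoc]
    rw [e, hβ, div_mul_eq_mul_div, eq_div_iff hσ1']
    linear_combination -hσ v - hτ v
  have s1 : ∀ v, P (v + (1, 0) + (1, 0)) - P (v + (1, 0)) = α * (P (v + (1, 0)) - P v) := by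
    intro v
    have e : v + (1, 0) + (0, 1) = v + (1, 1) := by simp [add_assoc]
    have e' : v + (0, 1) + (1, 0) = v + (1, 1) := by simp [add_assoc]
    have h1 := hτ (v + (1, 0))
    have h2 := s2 v
    rw [e] at h1
    rw [e'] at h2
    have hαβ : τ * α = σ * β := by rw [hα, hβ]; field_simp
    apply mul_left_cancel₀ hτ0
    linear_combination -h1 - hσ v + σ * h2 - (P (v + (1, 0)) - P v) * hαβ
  set κ := τ * (1 - σ) / (σ - τ) with hκ
  have hα1 : κ * (α - 1) = 1 := by rw [hκ, hα]; field_simp; ring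
  have hβ1 : κ * (β - 1) = τ := by rw [hκ, hβ]; field_simp; ring
  refine ⟨P 0 - κ * (P (1, 0) - P 0), κ * (P (1, 0) - P 0),
    mul_ne_zero (by rw [hκ]; positivity) (sub_ne_zero.2 hne), ?_⟩
  have hd : ∀ v : ℤ × ℤ, P (v + (1, 0)) - P v = α ^ v.1 * β ^ v.2 * (P (1, 0) - P 0) ∧
      P v - κ * (P (v + (1, 0)) - P v) = P 0 - κ * (P (1, 0) - P 0) := by
    have fwd1 : ∀ v, P (v + (1, 0)) - κ * (P (v + (1, 0) + (1, 0)) - P (v + (1, 0))) =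
        P v - κ * (P (v + (1, 0)) - P v) := fun v => by
      rw [s1]; linear_combination -(P (v + (1, 0)) - P v) * hα1
    have fwd2 : ∀ v, P (v + (0, 1)) - κ * (P (v + (0, 1) + (1, 0)) - P (v + (0, 1))) =
        P v - κ * (P (v + (1, 0)) - P v) := fun v => by
      rw [s2]; linear_combination -(P (v + (1, 0)) - P v) * hβ1 + hτ v
    have h1 : ∀ m : ℤ, P ((m, 0) + (1, 0)) - P (m, 0) = α ^ m * (P (1, 0) - P 0) ∧
        P (m, 0) - κ * (P ((m, 0) + (1, 0)) - P (m, 0)) = P 0 - κ * (P (1, 0) - P 0) := by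
      intro m
      induction m using Int.induction_on with
      | zero => exact ⟨by simp; rfl, by simp; rfl⟩
      | succ i ih =>
        have e : (((i : ℤ) + 1, 0) : ℤ × ℤ) = ((i : ℤ), (0 : ℤ)) + ((1 : ℤ), (0 : ℤ)) := by simp
        rw [e, fwd1, s1, zpow_add_one₀ hα0]
        exact ⟨by rw [ih.1]; ring, ih.2⟩
      | pred i ih =>
        have e : ((-(i : ℤ), 0) : ℤ × ℤ) = (-(i : ℤ) - 1, (0 : ℤ)) + ((1 : ℤ), (0 : ℤ)) := by simp
        rw [e, fwd1, s1] at ih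
        refine ⟨?_, ih.2⟩
        apply mul_left_cancel₀ hα0
        rw [ih.1, ← mul_assoc, ← zpow_one_add₀ hα0]
        congr 2
        ring
    rintro ⟨m, n⟩
    induction n using Int.induction_on with
    | zero => simpa using h1 m
    | succ i ih =>
      have e : ((m, (i : ℤ) + 1) : ℤ × ℤ) = (m, (i : ℤ)) + ((0 : ℤ), (1 : ℤ)) := by simp
      rw [e, fwd2, s2]
      refine ⟨?_, ih.2⟩
      rw [ih.1]
      simp only [Prod.mk_add_mk, add_zero, zpow_add_one₀ hβ0]
      ring
    | pred i ih =>
      have e : ((m, -(i : ℤ)) : ℤ × ℤ) = (m, -(i : ℤ) - 1) + ((0 : ℤ), (1 : ℤ)) := by simp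
      rw [e, fwd2, s2] at ih
      refine ⟨?_, ih.2⟩
      apply mul_left_cancel₀ hβ0
      rw [ih.1]
      simp only [Prod.mk_add_mk, add_zero, sub_add_cancel, zpow_sub_one₀ hβ0]
      field_simp
  intro v
  obtain ⟨h1, h2⟩ := hd v
  rw [h1] at h2
  linear_combination h2

section RealShapes

variable {s t : ℝ}

lemma isAlternating_of_neg_of_lt_one (ht : t < 0) (hs0 : 0 < s) (hs1 : s < 1)
    (h1 : 1 ≤ |t * s| + |(1 - t) * (1 - s)|) (h2 : |(1 - t) * (1 - s)| ≤ 1 + |t * s|) :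
    IsAlternating ((1 - t) * s / (t * (1 - s))) ((1 - t) / (1 - s)) := by
  have hs : 0 < 1 - s := by linarith
  rw [abs_of_neg (mul_neg_of_neg_of_pos ht hs0), abs_of_pos (mul_pos (by linarith) hs)] at h1 h2
  refine ⟨?_, ?_, ?_⟩
  · rw [div_le_iff_of_neg (mul_neg_of_neg_of_pos ht hs)]
    nlinarith
  · have : -((1 - t) * s / (t * (1 - s))) = (1 - t) / (1 - s) * (s / (-t)) := by
      field_simp
    rw [this]
    refine mul_le_of_le_one_right (div_pos (by linarith) hs).le ?_
    rw [div_le_one (by linarith)]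
    nlinarith
  · rw [lt_div_iff₀ hs]
    linarith

lemma isAlternating_of_one_lt_of_lt_one (ht : 1 < t) (hs0 : 0 < s) (hs1 : s < 1)
    (h1 : 1 ≤ |t * s| + |(1 - t) * (1 - s)|) (h2 : |t * s| ≤ 1 + |(1 - t) * (1 - s)|) :
    IsAlternating ((1 - t) / (1 - s)) (t / s) := by
  have hs : 0 < 1 - s := by linarith
  rw [abs_of_pos (mul_pos (by linarith) hs0), abs_of_neg (mul_neg_of_neg_of_pos (by linarith) hs)]
    at h1 h2
  refine ⟨?_, ?_, ?_⟩
  · rw [div_le_iff₀ hs]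
    nlinarith
  · rw [← neg_div, div_le_div_iff₀ hs hs0]
    nlinarith
  · rw [lt_div_iff₀ hs0]
    linarith

lemma isAlternating_of_one_lt_of_neg (ht : 1 < t) (hs : s < 0)
    (h1 : |t * s| ≤ 1 + |(1 - t) * (1 - s)|) (h2 : |(1 - t) * (1 - s)| ≤ 1 + |t * s|) :
    IsAlternating (t / s) (t * (1 - s) / ((1 - t) * s)) := by
  rw [abs_of_neg (mul_neg_of_pos_of_neg (by linarith) hs),
    abs_of_neg (mul_neg_of_neg_of_pos (by linarith) (by linarith))] at h1 h2
  have hts : 0 < (1 - t) * s := mul_pos_of_neg_of_neg (by linarith) hs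
  refine ⟨?_, ?_, ?_⟩
  · rw [div_le_iff_of_neg hs]
    nlinarith
  · have : t * (1 - s) / ((1 - t) * s) = -(t / s) * ((1 - s) / (t - 1)) := by
      have : 1 - t ≠ 0 := by linarith
      have : t - 1 ≠ 0 := by linarith
      field_simp
      ring
    rw [this]
    refine le_mul_of_one_le_right ?_ ?_
    · rw [← div_neg]; exact (div_pos (by linarith) (by linarith)).le
    · rw [one_le_div (by linarith)]
      nlinarith
  · rw [lt_div_iff₀ hts]
    nlinarith

/-- A flat layout of collinear triangles of two different shapes is alternating. -/
lemma isAlternating_of_real_shapes (ht0 : t ≠ 0) (ht1 : t ≠ 1) (hs0 : s ≠ 0) (hs1 : s ≠ 1)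
    (hneg : t < 0 → 0 < s) (hmid : 0 < t → t < 1 → s < 0 ∨ 1 < s) (hone : 1 < t → s < 1)
    (h1 : 1 ≤ |t * s| + |(1 - t) * (1 - s)|) (h2 : |t * s| ≤ 1 + |(1 - t) * (1 - s)|)
    (h3 : |(1 - t) * (1 - s)| ≤ 1 + |t * s|) {a b : ℝ} (ha : a = (1 - t) * s / (t * (1 - s)))
    (hb : b = (1 - t) / (1 - s)) :
    IsAlternating a b ∨ IsAlternating b (b / a) ∨ IsAlternating (b / a) a⁻¹ ∨
      IsAlternating a⁻¹ b⁻¹ ∨ IsAlternating b⁻¹ (a / b) ∨ IsAlternating (a / b) a := by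
  have ht1' : 1 - t ≠ 0 := sub_ne_zero.2 ht1.symm
  have hs1' : 1 - s ≠ 0 := sub_ne_zero.2 hs1.symm
  have e1 : b / a = t / s := by rw [ha, hb]; field_simp
  have e2 : a / b = s / t := by rw [ha, hb]; field_simp
  have e3 : a⁻¹ = t * (1 - s) / ((1 - t) * s) := by rw [ha, inv_div]
  have e4 : a⁻¹ = (1 - s) * t / (s * (1 - t)) := by rw [e3]; ring
  have e5 : a = s * (1 - t) / ((1 - s) * t) := by rw [ha]; ring
  have e6 : b⁻¹ = (1 - s) / (1 - t) := by rw [hb, inv_div]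
  have hts : t * s = s * t := mul_comm _ _
  have hts' : (1 - t) * (1 - s) = (1 - s) * (1 - t) := mul_comm _ _
  rcases lt_or_gt_of_ne ht0 with h | h
  · have := hneg h
    rcases lt_or_gt_of_ne hs1 with h' | h'
    · left
      rw [ha, hb]
      exact isAlternating_of_neg_of_lt_one h this h' h1 h3
    · right; right; right; right; right
      rw [e2, e5]
      rw [hts, hts'] at h2 h3
      exact isAlternating_of_one_lt_of_neg h' h h2 h3
  · rcases lt_or_gt_of_ne ht1 with h' | h'
    · rw [hts, hts'] at h1 h2 h3
      rcases hmid h h' with h'' | h''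
      · right; right; right; left
        rw [e4, e6]
        exact isAlternating_of_neg_of_lt_one h'' h h' h1 h3
      · right; right; right; right; left
        rw [e6, e2]
        exact isAlternating_of_one_lt_of_lt_one h'' h h' h1 h2
    · have := hone h'
      rcases lt_or_gt_of_ne hs0 with h'' | h''
      · right; right; left
        rw [e1, e3]
        exact isAlternating_of_one_lt_of_neg h' h'' h2 h3
      · right; left
        rw [e1, hb]
        exact isAlternating_of_one_lt_of_lt_one h' h'' this h1 h2

end RealShapes

section DelaunayShapes

variable {P : ℤ × ℤ → ℂ} {τ σ : ℂ}

lemma HasDelaunayCos.shape_nonneg (hD : HasDelaunayCos P) (hτ0 : τ ≠ 0)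
    (hσ0 : σ ≠ 0) (hne : ∀ v, P (v + (1, 0)) ≠ P v)
    (hτ : ∀ v, P (v + (0, 1)) - P v = τ * (P (v + (1, 0)) - P v))
    (hσ : ∀ v, P (v + (1, 0)) - P (v + (1, 1)) = σ * (P (v + (0, 1)) - P (v + (1, 1)))) :
    0 ≤ τ.re / ‖τ‖ + σ.re / ‖σ‖ ∧
    0 ≤ ((τ - 1) / τ).re / ‖(τ - 1) / τ‖ + ((σ - 1) / σ).re / ‖(σ - 1) / σ‖ ∧
    0 ≤ (1 - τ).re / ‖1 - τ‖ + (1 - σ).re / ‖1 - σ‖ := by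
  have hE := sub_ne_zero.2 (hne 0)
  have hF : ∀ v, P (v + (0, 1)) - P (v + (1, 1)) ≠ 0 := fun v => by
    have := hne (v + (0, 1))
    rw [add_assoc] at this
    exact sub_ne_zero.2 this.symm
  have d1 := hD (1, 0) 2
  have d2 := hD 0 0
  have d3 := hD 0 1
  have t0 := hτ 0
  have s0 := hσ 0
  have s1 := hσ (0, -1)
  have s2 := hσ (-1, 0)
  have f0 := hF 0
  have f1 := hF (0, -1)
  have f2 := hF (-1, 0)
  have c0 : (0 : ℤ × ℤ) = (0, 0) := rfl
  have k0 : (2 + 1 : Fin 6) = 3 := rfl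
  have k1 : (2 - 1 : Fin 6) = 1 := rfl
  have k2 : (0 - 1 : Fin 6) = 5 := rfl
  have k3 : (1 + 1 : Fin 6) = 2 := rfl
  simp only [k0, k1, k2, k3, zero_add, sub_self, hexDir, Matrix.cons_val, Prod.mk_add_mk, c0,
    Int.reduceNeg, add_zero, neg_add_cancel, add_neg_cancel, Matrix.cons_val_zero,
    Matrix.cons_val_one] at d1 d2 d3 t0 s0 s1 s2 f0 f1 f2 hE
  have hτE := mul_ne_zero hτ0 hE
  have n1 : P (1, 0) ≠ P (0, 0) := sub_ne_zero.1 hE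
  have n2 : P (0, 1) ≠ P (0, 0) := sub_ne_zero.1 (t0 ▸ hτE)
  refine ⟨?_, ?_, ?_⟩
  · rw [angleCos_eq_of_sub_eq_mul n1 t0, angleCos_comm,
      angleCos_eq_of_sub_eq_mul (sub_ne_zero.1 f0) s0] at d1
    exact d1
  · have e1 : P (1, 0) - P (0, 1) = (τ - 1) / τ * (P (0, 0) - P (0, 1)) := by
      rw [div_mul_eq_mul_div, eq_div_iff hτ0]
      linear_combination (-1 : ℂ) * t0
    have e2 : P (0, 0) - P (1, -1) = (σ - 1) / σ * (P (1, 0) - P (1, -1)) := by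
      rw [div_mul_eq_mul_div, eq_div_iff hσ0]
      linear_combination (-1 : ℂ) * s1
    have n3 : P (1, 0) ≠ P (1, -1) := by
      refine Ne.symm (sub_ne_zero.1 ?_)
      rw [s1]
      exact mul_ne_zero hσ0 f1
    rw [angleCos_eq_of_sub_eq_mul n2.symm e1, angleCos_comm, angleCos_eq_of_sub_eq_mul n3 e2] at d2
    exact d2
  · have e1 : P (0, 1) - P (1, 0) = (1 - τ) * (P (0, 0) - P (1, 0)) := by
      linear_combination t0
    have e2 : P (0, 0) - P (-1, 1) = (1 - σ) * (P (0, 1) - P (-1, 1)) := by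
      linear_combination s2
    rw [add_comm, angleCos_eq_of_sub_eq_mul n1.symm e1, angleCos_comm,
      angleCos_eq_of_sub_eq_mul (sub_ne_zero.1 f2).symm e2] at d3
    exact d3

lemma Complex.exists_ofReal_of_one_le_re_div_norm {z : ℂ} (hz : z ≠ 0) (h : 1 ≤ z.re / ‖z‖) :
    ∃ r : ℝ, 0 < r ∧ z = r := by
  rw [one_le_div (norm_pos_iff.2 hz)] at h
  refine ⟨z.re, (norm_pos_iff.2 hz).trans_le h, ?_⟩
  exact (Complex.eq_re_of_ofReal_le (Complex.re_eq_norm.1 (le_antisymm (Complex.re_le_norm z) h)))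

lemma exists_ofReal_of_shape_nonneg {t : ℝ} (ht0 : t ≠ 0) (ht1 : t ≠ 1)
    (hσ0 : σ ≠ 0) (hσ1 : σ ≠ 1) (h1 : 0 ≤ (t : ℂ).re / ‖(t : ℂ)‖ + σ.re / ‖σ‖)
    (h2 : 0 ≤ (((t : ℂ) - 1) / t).re / ‖((t : ℂ) - 1) / t‖ + ((σ - 1) / σ).re / ‖(σ - 1) / σ‖)
    (h3 : 0 ≤ (1 - (t : ℂ)).re / ‖1 - (t : ℂ)‖ + (1 - σ).re / ‖1 - σ‖) :
    ∃ s : ℝ, σ = s ∧ (t < 0 → 0 < s) ∧ (0 < t → t < 1 → s < 0 ∨ 1 < s) ∧ (1 < t → s < 1) := by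
  have key : ∀ r : ℝ, r < 0 → (r : ℂ).re / ‖(r : ℂ)‖ = -1 := fun r hr => by
    rw [Complex.ofReal_re, Complex.norm_real, norm_eq_abs, abs_of_neg hr, div_neg,
      div_self hr.ne]
  rcases lt_or_gt_of_ne ht0 with h | h
  · rw [key t h] at h1
    obtain ⟨s, hs, rfl⟩ := Complex.exists_ofReal_of_one_le_re_div_norm hσ0 (by linarith)
    exact ⟨s, rfl, fun _ => hs, fun h' => by linarith, fun h' => by linarith⟩
  · rcases lt_or_gt_of_ne ht1 with h' | h'
    · have e : ((t : ℂ) - 1) / t = (((t - 1) / t : ℝ) : ℂ) := by push_cast; rfl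
      rw [e, key _ (div_neg_of_neg_of_pos (by linarith) h)] at h2
      obtain ⟨r, hr, hσr⟩ := Complex.exists_ofReal_of_one_le_re_div_norm
        (div_ne_zero (sub_ne_zero.2 hσ1) hσ0) (show 1 ≤ ((σ - 1) / σ).re / ‖(σ - 1) / σ‖ by linarith)
      have hr1 : (1 - (r : ℂ)) ≠ 0 := by
        intro h0
        rw [← hσr] at h0
        field_simp at h0
        norm_num at h0
      have hσs : σ = ((1 / (1 - r) : ℝ) : ℂ) := by
        push_cast
        rw [eq_div_iff hr1, ← hσr]
        field_simp
        ring
      have hr1' : 1 - r ≠ 0 := by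
        intro h0
        apply hr1
        exact_mod_cast h0
      refine ⟨_, hσs, fun h'' => by linarith, fun _ _ => ?_, fun h'' => by linarith⟩
      rcases lt_or_gt_of_ne hr1' with h0 | h0
      · left; exact div_neg_of_pos_of_neg one_pos h0
      · right; rw [lt_div_iff₀ h0]; linarith
    · have e : 1 - (t : ℂ) = ((1 - t : ℝ) : ℂ) := by push_cast; rfl
      rw [e, key _ (by linarith)] at h3
      obtain ⟨r, hr, hσr⟩ := Complex.exists_ofReal_of_one_le_re_div_norm
        (sub_ne_zero.2 hσ1.symm) (show 1 ≤ (1 - σ).re / ‖1 - σ‖ by linarith)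
      refine ⟨1 - r, ?_, fun h'' => by linarith, fun _ h'' => by linarith, fun _ => by linarith⟩
      push_cast
      rw [← hσr]
      ring

end DelaunayShapes

/-- Two nonzero complex numbers do not generate a discrete free abelian group of rank two. -/
lemma exists_ne_zero_zpow_mul_zpow_mem {α β : ℂ} (hα : α ≠ 0) (hβ : β ≠ 0) {U : Set ℂ}
    (hU : U ∈ nhds (1 : ℂ)) : ∃ u : ℤ × ℤ, u ≠ 0 ∧ α ^ u.1 * β ^ u.2 ∈ U := by
  set χ : ℤ × ℤ → ℂ := fun u => α ^ u.1 * β ^ u.2 with hχ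
  have hχn : ∀ u, ‖χ u‖ = exp (u.1 * log ‖α‖ + u.2 * log ‖β‖) := fun u => by
    rw [hχ, norm_mul, norm_zpow, norm_zpow, exp_add, ← rpow_intCast, ← rpow_intCast,
      rpow_def_of_pos (norm_pos_iff.2 hα), rpow_def_of_pos (norm_pos_iff.2 hβ), mul_comm (log _),
      mul_comm (log _)]
  have hχ0 : ∀ u, χ u ≠ 0 := fun u => by rw [← norm_pos_iff, hχn]; exact exp_pos _
  have hχd : ∀ u v, χ (u - v) = χ u / χ v := fun u v => by
    simp only [hχ, Prod.fst_sub, Prod.snd_sub, zpow_sub₀ hα, zpow_sub₀ hβ]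
    exact (div_mul_div_comm _ _ _ _)
  obtain ⟨f, hf, R, hR⟩ : ∃ f : ℕ → ℤ × ℤ, Function.Injective f ∧
      ∃ R, ∀ n, |(f n).1 * log ‖α‖ + (f n).2 * log ‖β‖| ≤ R := by
    by_cases ha : log ‖α‖ = 0
    · refine ⟨fun n => (n, 0), fun m n h => by simpa using h, 0, fun n => by simp [ha]⟩
    · refine ⟨fun n => (-⌊n * log ‖β‖ / log ‖α‖⌋, n), fun m n h => ?_, |log ‖α‖|, fun n => ?_⟩
      · simp only [Prod.mk.injEq, Nat.cast_inj] at h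
        exact h.2
      · have : ((-⌊n * log ‖β‖ / log ‖α‖⌋ : ℤ) : ℝ) * log ‖α‖ + ((n : ℤ) : ℝ) * log ‖β‖ =
            Int.fract (n * log ‖β‖ / log ‖α‖) * log ‖α‖ := by
          rw [Int.fract]
          push_cast
          field_simp
          ring
        simp only [this, abs_mul]
        rw [abs_of_nonneg (Int.fract_nonneg _)]
        exact mul_le_of_le_one_left (abs_nonneg _) (Int.fract_lt_one _).le
  obtain ⟨c, -, φ, hφ, hlim⟩ := (isCompact_closedBall (0 : ℂ) (exp R)).tendsto_subseq
    (x := fun n => χ (f n)) fun n => by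
      rw [mem_closedBall_zero_iff, hχn]
      exact exp_le_exp.2 ((le_abs_self _).trans (hR n))
  have hc : c ≠ 0 := by
    rw [← norm_pos_iff]
    refine (exp_pos (-R)).trans_le (ge_of_tendsto' hlim.norm fun n => ?_)
    rw [Function.comp_apply, hχn]
    exact exp_le_exp.2 (abs_le.1 (hR (φ n))).1
  have h1 := (hlim.comp (Filter.tendsto_add_atTop_nat 1)).div hlim hc
  rw [div_self hc] at h1
  obtain ⟨n, hn⟩ := (h1.eventually hU).exists
  refine ⟨f (φ (n + 1)) - f (φ n), sub_ne_zero.2 fun h => ?_, ?_⟩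
  · exact n.succ_ne_self (hφ.injective (hf h))
  · have := hχd (f (φ (n + 1))) (f (φ n))
    simp only [hχ] at this
    rw [this]
    exact hn

lemma planeCross_smul_add (p q : ℂ) (hpq : planeCross p q ≠ 0) (g : ℂ) :
    g = ((planeCross g q / planeCross p q : ℝ) : ℂ) * p +
      ((planeCross p g / planeCross p q : ℝ) : ℂ) * q := by
  apply Complex.ext
  · simp only [Complex.add_re, Complex.re_ofReal_mul]
    field_simp
    simp only [planeCross]
    ring
  · simp only [Complex.add_im, Complex.im_ofReal_mul]
    field_simp
    simp only [planeCross]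
    ring

/-- `g` lies in the interior of the positively oriented triangle with vertices `p`, `q`, `r`. -/
def InTriangle (p q r g : ℂ) : Prop :=
  0 < planeCross (g - p) (r - p) ∧ 0 < planeCross (q - p) (g - p) ∧
    0 < planeCross (q - p) (r - p) - planeCross (g - p) (r - p) - planeCross (q - p) (g - p)

lemma IsTriangleInjective.eq_zero_of_inTriangle {P : ℤ × ℤ → ℂ} (hP : IsTriangleInjective P)
    {u : ℤ × ℤ} (h : InTriangle (P 0) (P (1, 0)) (P (0, 1))
      ((P u + P (u + (1, 0)) + P (u + (0, 1))) / 3)) : u = 0 := by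
  obtain ⟨h1, h2, h3⟩ := h
  set g := (P u + P (u + (1, 0)) + P (u + (0, 1))) / 3 with hg
  set D := planeCross (P (1, 0) - P 0) (P (0, 1) - P 0)
  have hD : 0 < D := by linarith
  have key := planeCross_smul_add _ _ hD.ne' (g - P 0)
  set s := planeCross (g - P 0) (P (0, 1) - P 0) / D with hs
  set t := planeCross (P (1, 0) - P 0) (g - P 0) / D with ht
  have hs0 : 0 < s := div_pos h1 hD
  have ht0 : 0 < t := div_pos h2 hD
  have hst : s + t < 1 := by
    rw [hs, ht, ← add_div, div_lt_one hD]
    linarith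
  have := hP 0 0 s t u 0 (1 / 3) (1 / 3) hs0.le ht0.le hst.le (by norm_num) (by norm_num)
    (by norm_num) (by
      simp only [trianglePoint, hexDir, Matrix.cons_val_zero, Matrix.cons_val_one, zero_add]
      push_cast
      linear_combination -key + hg)
  simp only [hexPoint, hexDir, Matrix.cons_val_zero, Matrix.cons_val_one, zero_add,
    Prod.mk.injEq, Prod.fst_zero, Prod.snd_zero] at this
  push_cast at this
  obtain ⟨e1, e2⟩ := this
  have a1 : (-1 : ℝ) < u.1 := by linarith
  have a2 : (u.1 : ℝ) < 1 := by linarith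
  have a3 : (-1 : ℝ) < u.2 := by linarith
  have a4 : (u.2 : ℝ) < 1 := by linarith
  norm_cast at a1 a2 a3 a4
  ext
  · simp only [Prod.fst_zero]; omega
  · simp only [Prod.snd_zero]; omega

/-- Geometric progressions of nondegenerate triangles are not limits of embeddings. -/
lemma not_planeCross_pos_of_zpow {P : ℤ × ℤ → ℂ} (hP : P ∈ closure {Q | IsHexEmbedding Q})
    {z c α β : ℂ} (hc : c ≠ 0) (hα : α ≠ 0) (hβ : β ≠ 0)
    (hPv : ∀ v, P v = z + c * (α ^ v.1 * β ^ v.2)) : ¬ 0 < planeCross (α - 1) (β - 1) := by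
  intro hpos
  have hP' := mem_closure_hexEmbedding_affine hP (inv_ne_zero hc) z
  have e : (fun v => c⁻¹ * (P v - z)) = fun v : ℤ × ℤ => α ^ v.1 * β ^ v.2 := by
    ext v
    rw [hPv, add_sub_cancel_left, inv_mul_cancel_left₀ hc]
  rw [e] at hP'
  have hcont : Continuous fun x : ℂ × ℂ => planeCross x.1 x.2 := by
    unfold planeCross
    fun_prop
  have hopen : IsOpen {x : ℂ × ℂ × ℂ × ℂ | InTriangle x.1 x.2.1 x.2.2.1 x.2.2.2} := by
    have c1 : Continuous fun x : ℂ × ℂ × ℂ × ℂ => planeCross (x.2.2.2 - x.1) (x.2.2.1 - x.1) :=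
      hcont.comp (f := fun x : ℂ × ℂ × ℂ × ℂ => (x.2.2.2 - x.1, x.2.2.1 - x.1)) (by fun_prop)
    have c2 : Continuous fun x : ℂ × ℂ × ℂ × ℂ => planeCross (x.2.1 - x.1) (x.2.2.2 - x.1) :=
      hcont.comp (f := fun x : ℂ × ℂ × ℂ × ℂ => (x.2.1 - x.1, x.2.2.2 - x.1)) (by fun_prop)
    have c3 : Continuous fun x : ℂ × ℂ × ℂ × ℂ => planeCross (x.2.1 - x.1) (x.2.2.1 - x.1) :=
      hcont.comp (f := fun x : ℂ × ℂ × ℂ × ℂ => (x.2.1 - x.1, x.2.2.1 - x.1)) (by fun_prop)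
    exact (isOpen_lt continuous_const c1).inter ((isOpen_lt continuous_const c2).inter
      (isOpen_lt continuous_const ((c3.sub c1).sub c2)))
  obtain ⟨u, hu0, hu⟩ := exists_ne_zero_zpow_mul_zpow_mem hα hβ
    (U := {ρ | InTriangle 1 α β (ρ * ((1 + α + β) / 3))})
    ((hopen.preimage (f := fun ρ : ℂ => ((1 : ℂ), α, β, ρ * ((1 + α + β) / 3)))
      (by fun_prop)).mem_nhds (by
        simp only [planeCross, Complex.sub_re, Complex.sub_im, Complex.one_re, Complex.one_im]
          at hpos
        have e3 : (3 : ℂ) = ((3 : ℝ) : ℂ) := by norm_num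
        simp only [Set.mem_preimage, Set.mem_ofPred_eq, InTriangle, planeCross, one_mul, e3,
          Complex.sub_re, Complex.sub_im, Complex.div_ofReal_re, Complex.div_ofReal_im,
          Complex.add_re, Complex.add_im, Complex.one_re, Complex.one_im]
        refine ⟨?_, ?_, ?_⟩ <;> nlinarith))
  have hev : ∀ᶠ Q : ℤ × ℤ → ℂ in nhds fun v : ℤ × ℤ => α ^ v.1 * β ^ v.2,
      InTriangle (Q 0) (Q (1, 0)) (Q (0, 1)) ((Q u + Q (u + (1, 0)) + Q (u + (0, 1))) / 3) := by
    refine (hopen.preimage (f := fun Q : ℤ × ℤ → ℂ =>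
      (Q 0, Q (1, 0), Q (0, 1), (Q u + Q (u + (1, 0)) + Q (u + (0, 1))) / 3))
      (by fun_prop)).mem_nhds ?_
    have e' : (α ^ u.1 * β ^ u.2 + α ^ (u + (1, 0)).1 * β ^ (u + (1, 0)).2 +
        α ^ (u + (0, 1)).1 * β ^ (u + (0, 1)).2) / 3 =
        α ^ u.1 * β ^ u.2 * ((1 + α + β) / 3) := by
      simp only [Prod.fst_add, Prod.snd_add, add_zero, zpow_add_one₀ hα, zpow_add_one₀ hβ]
      ring
    simp only [Set.mem_preimage, Set.mem_ofPred_eq, e']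
    simpa using hu
  obtain ⟨Q, hQ, hQ'⟩ := ((mem_closure_iff_frequently.1 hP').and_eventually hev).exists
  exact hu0 (hQ.injective.eq_zero_of_inTriangle hQ')

lemma mem_closure_hexEmbedding_of_recentre {x y : Layout} (hx : IsHexEmbedding x.2)
    (hy : y ∈ closure (Set.range fun u => recentre u x)) :
    y.2 ∈ closure {Q | IsHexEmbedding Q} := by
  refine map_mem_closure continuous_snd hy ?_
  rintro _ ⟨u, rfl⟩
  have hshift : IsHexEmbedding (fun v => x.2 (v + u)) := by
    have hr : ∀ v k, v + hexDir k + u = v + u + hexDir k := fun v k => add_right_comm _ _ _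
    refine ⟨fun v k => ?_, fun v k s t v' k' s' t' h1 h2 h3 h4 h5 h6 h => ?_⟩
    · simp only [hr]
      exact hx.oriented _ _
    · have := hx.injective (v + u) k s t (v' + u) k' s' t' h1 h2 h3 h4 h5 h6
        (by simpa only [trianglePoint, hr] using h)
      simp only [hexPoint, Prod.fst_add, Prod.snd_add, Prod.mk.injEq] at this ⊢
      push_cast at this
      constructor <;> linarith [this.1, this.2]
  exact hshift.affine (Complex.ofReal_ne_zero.2 (exp_ne_zero (-2 * x.1 u))) (x.2 u)

lemma planeCross_nonneg_of_mem_closure {P : ℤ × ℤ → ℂ} (hP : P ∈ closure {Q | IsHexEmbedding Q})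
    (v : ℤ × ℤ) (k : Fin 6) :
    0 ≤ planeCross (P (v + hexDir k) - P v) (P (v + hexDir (k + 1)) - P v) := by
  have hcl : IsClosed {Q : ℤ × ℤ → ℂ |
      0 ≤ planeCross (Q (v + hexDir k) - Q v) (Q (v + hexDir (k + 1)) - Q v)} := by
    refine isClosed_le continuous_const ?_
    unfold planeCross
    fun_prop
  exact closure_minimal (fun Q hQ => (hQ.oriented v k).le) hcl hP

/-- Limits of embeddings with linear scaling factors have constant scaling factors. -/
lemma false_of_linear_limit {ℓ : Fin 6 → ℝ} (hℓ : ∀ k, 0 < ℓ k)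
    (h0 : ℓ 0 ^ 2 ≤ ℓ 1 ^ 2 + ℓ 2 ^ 2) (h1 : ℓ 1 ^ 2 ≤ ℓ 0 ^ 2 + ℓ 2 ^ 2)
    (h2 : ℓ 2 ^ 2 ≤ ℓ 0 ^ 2 + ℓ 1 ^ 2) {y : Layout} (hy : y ∈ flatLayouts ℓ)
    (hP : y.2 ∈ closure {Q | IsHexEmbedding Q}) {M N : ℝ} (hMN : M ≠ 0 ∨ N ≠ 0)
    (hlin : ∀ v : ℤ × ℤ, y.1 v = M * v.1 + N * v.2) : False := by
  obtain ⟨-, -, hw, hx⟩ := hy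
  obtain ⟨τ, σ, hτi, hσi, hτ0, hτ1, hσ0, hσ1, hr, hs, hne, hτ, hσ⟩ :=
    hx.exists_shape hℓ hlin (planeCross_nonneg_of_mem_closure hP)
  have hℓ0 := hℓ 0
  have hℓ1 := hℓ 1
  have hℓ2 := hℓ 2
  have hτσ : σ ≠ τ := by
    rintro rfl
    obtain ⟨n1, n2, n3, n4, n5⟩ := hx.norm_sub_of_linear hlin 0
    have e3 : y.2 (0 + (0, 1)) - y.2 (0 + (1, 0)) = (σ - 1) * (y.2 (0 + (1, 0)) - y.2 0) := by
      linear_combination hτ 0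
    have e4 : y.2 (0 + (0, 1)) - y.2 (0 + (1, 0)) =
        -((σ - 1) * (y.2 (0 + (0, 1)) - y.2 (0 + (1, 1)))) := by
      linear_combination -hσ 0
    have n3' := n3
    rw [hτ 0, norm_mul, n1] at n2
    rw [hσ 0, norm_mul, n5] at n4
    rw [e3, norm_mul, n1] at n3
    rw [e4, norm_neg, norm_mul, n5] at n3'
    have hσn : 0 < ‖σ - 1‖ := norm_pos_iff.2 (sub_ne_zero.2 hσ1)
    have hN : M = M + 2 * N := by
      have := mul_right_cancel₀ hℓ0.ne' (mul_left_cancel₀ hσn.ne' (n3.trans n3'.symm))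
      linarith [exp_injective this]
    have hM : M = N := by
      have hσn : 0 < ‖σ‖ := norm_pos_iff.2 hσ0
      have : exp (2 * y.1 0 + M) * exp (2 * y.1 0 + 2 * M + N) =
          exp (2 * y.1 0 + N) * exp (2 * y.1 0 + M + 2 * N) := by
        apply mul_left_cancel₀ (mul_pos (mul_pos hσn hℓ0) hℓ1).ne'
        linear_combination exp (2 * y.1 0 + 2 * M + N) * ℓ 1 * n2 -
          exp (2 * y.1 0 + N) * ℓ 1 * n4
      rw [← exp_add, ← exp_add] at this
      linarith [exp_injective this]
    rcases hMN with h | h <;> apply h <;> linarith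
  obtain ⟨z, c, hc, hPv⟩ := exists_eq_add_mul_zpow hτ0 hτ1 hσ0 hσ1 hτσ
    (by simpa using hne 0) hτ hσ
  have hτ1' : 1 - τ ≠ 0 := sub_ne_zero.2 hτ1.symm
  have hσ1' : 1 - σ ≠ 0 := sub_ne_zero.2 hσ1.symm
  have hστ : σ - τ ≠ 0 := sub_ne_zero.2 hτσ
  rcases hτi.lt_or_eq with hi | hi
  · have hα : (1 - τ) * σ / (τ * (1 - σ)) ≠ 0 := by positivity
    have hβ : (1 - τ) / (1 - σ) ≠ 0 := by positivity
    refine not_planeCross_pos_of_zpow hP hc hα hβ hPv ?_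
    have e1 : (1 - τ) * σ / (τ * (1 - σ)) - 1 = (σ - τ) / (τ * (1 - σ)) * 1 := by
      field_simp; ring
    have e2 : (1 - τ) / (1 - σ) - 1 = (σ - τ) / (τ * (1 - σ)) * τ := by
      field_simp; ring
    rw [e1, e2, planeCross_mul_left]
    refine mul_pos (Complex.normSq_pos.2 (by positivity)) ?_
    simpa [planeCross] using hi
  · obtain ⟨t, rfl⟩ : ∃ t : ℝ, τ = t := ⟨τ.re, Complex.ext rfl hi.symm⟩
    obtain ⟨g1, g2, g3⟩ := (hw.hasDelaunayCos hℓ hx).shape_nonneg hτ0 hσ0 hne hτ hσ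
    have ht0 : t ≠ 0 := by exact_mod_cast hτ0
    have ht1 : t ≠ 1 := by exact_mod_cast hτ1
    obtain ⟨s, rfl, hneg, hmid, hone⟩ := exists_ofReal_of_shape_nonneg ht0 ht1 hσ0 hσ1 g1 g2 g3
    have hs0 : s ≠ 0 := by exact_mod_cast hσ0
    have hs1 : s ≠ 1 := by exact_mod_cast hσ1
    have hr' : |t * s| = (ℓ 1 / ℓ 0) ^ 2 := by
      rw [← hr, Complex.norm_real, Complex.norm_real, abs_mul]; rfl
    have hs' : |(1 - t) * (1 - s)| = (ℓ 2 / ℓ 0) ^ 2 := by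
      rw [← hs, ← Complex.ofReal_one, ← Complex.ofReal_sub, ← Complex.ofReal_sub,
        Complex.norm_real, Complex.norm_real, abs_mul]; rfl
    have ha : (1 - t) * s / (t * (1 - s)) ≠ 0 := by
      exact_mod_cast (show (1 - t : ℂ) * s / (t * (1 - s)) ≠ 0 by positivity)
    have hb : (1 - t) / (1 - s) ≠ 0 := by
      exact_mod_cast (show (1 - t : ℂ) / (1 - s) ≠ 0 by positivity)
    refine not_isAlternating_rotations hP hc ha hb (fun v => by rw [hPv v]; push_cast; rfl)
      (isAlternating_of_real_shapes ht0 ht1 hs0 hs1 hneg hmid hone ?_ ?_ ?_ rfl rfl)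
    all_goals
      rw [hr', hs', div_pow, div_pow]
    · rw [← add_div, le_div_iff₀ (by positivity)]
      linarith
    · rw [div_le_iff₀ (by positivity), add_mul, div_mul_cancel₀ _ (by positivity)]
      linarith
    · rw [div_le_iff₀ (by positivity), add_mul, div_mul_cancel₀ _ (by positivity)]
      linarith

lemma hexDir_cross (k : Fin 6) :
    (hexDir k).1 * (hexDir (k + 1)).2 - (hexDir k).2 * (hexDir (k + 1)).1 = 1 := by
  revert k; decide

lemma planeCross_comm (z w : ℂ) : planeCross z w = -planeCross w z := by
  simp only [planeCross]; ring

/-- Cones over different lattice triangles at a vertex do not overlap in the image. -/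
lemma IsTriangleInjective.cone_injective {P : ℤ × ℤ → ℂ} (hP : IsTriangleInjective P)
    {v : ℤ × ℤ} {k j : Fin 6} {a b a' b' : ℝ} (ha : 0 ≤ a) (hb : 0 ≤ b) (ha' : 0 ≤ a')
    (hb' : 0 ≤ b')
    (h : (a : ℂ) * (P (v + hexDir k) - P v) + b * (P (v + hexDir (k + 1)) - P v) =
      a' * (P (v + hexDir j) - P v) + b' * (P (v + hexDir (j + 1)) - P v)) :
    a * (hexDir k).1 + b * (hexDir (k + 1)).1 = a' * (hexDir j).1 + b' * (hexDir (j + 1)).1 ∧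
    a * (hexDir k).2 + b * (hexDir (k + 1)).2 = a' * (hexDir j).2 + b' * (hexDir (j + 1)).2 := by
  set R := 1 + a + b + a' + b' with hR
  have hR0 : 0 < R := by positivity
  have h1 : ∀ x y : ℝ, x + y ≤ R → x / R + y / R ≤ 1 := fun x y hxy => by
    rw [← add_div, div_le_one hR0]; exact hxy
  have hRc : (R : ℂ) ≠ 0 := by exact_mod_cast hR0.ne'
  have key := hP v k (a / R) (b / R) v j (a' / R) (b' / R) (by positivity) (by positivity)
    (h1 _ _ (by linarith)) (by positivity) (by positivity) (h1 _ _ (by linarith)) (by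
      simp only [trianglePoint]
      push_cast
      field_simp
      linear_combination h)
  simp only [hexPoint, Prod.mk.injEq] at key
  obtain ⟨e1, e2⟩ := key
  field_simp at e1 e2
  constructor <;> linarith

lemma IsTriangleInjective.planeCross_ne_zero {P : ℤ × ℤ → ℂ} (hP : IsTriangleInjective P)
    (v : ℤ × ℤ) (k : Fin 6) :
    planeCross (P (v + hexDir k) - P v) (P (v + hexDir (k + 1)) - P v) ≠ 0 := by
  intro h0
  have hdet : ((hexDir k).1 : ℝ) * (hexDir (k + 1)).2 - (hexDir k).2 * (hexDir (k + 1)).1 = 1 :=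
    mod_cast hexDir_cross k
  set d := P (v + hexDir k) - P v with hd
  set d' := P (v + hexDir (k + 1)) - P v with hd'
  have hd0 : d ≠ 0 := fun hd0 => by
    obtain ⟨e1, e2⟩ := hP.cone_injective (v := v) (k := k) (j := k) (a := 1) (b := 0) (a' := 0)
      (b' := 0) zero_le_one le_rfl le_rfl le_rfl (by rw [← hd, hd0]; simp)
    simp only [one_mul, zero_mul, add_zero] at e1 e2
    rw [e1, e2] at hdet
    norm_num at hdet
  obtain ⟨r, hr⟩ : ∃ r : ℝ, d' = r * d := by
    refine ⟨(d' / d).re, ?_⟩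
    rw [← div_eq_iff hd0]
    refine Complex.ext rfl ?_
    rw [Complex.div_im, Complex.ofReal_im, ← sub_div]
    simp only [planeCross] at h0
    rw [show d'.im * d.re - d'.re * d.im = 0 by linarith, zero_div]
  rcases le_total 0 r with h | h
  · obtain ⟨e1, e2⟩ := hP.cone_injective (v := v) (k := k) (j := k) (a := 0) (b := 1) (a' := r)
      (b' := 0) le_rfl zero_le_one h le_rfl (by rw [← hd, ← hd', hr]; simp)
    simp only [one_mul, zero_mul, add_zero, zero_add] at e1 e2
    rw [e1, e2] at hdet
    linarith
  · obtain ⟨e1, e2⟩ := hP.cone_injective (v := v) (k := k) (j := k) (a := -r) (b := 1) (a' := 0)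
      (b' := 0) (by linarith) zero_le_one le_rfl le_rfl (by rw [← hd, ← hd', hr]; simp)
    simp only [one_mul, zero_mul, add_zero] at e1 e2
    have f1 : ((hexDir (k + 1)).1 : ℝ) = r * (hexDir k).1 := by linarith
    have f2 : ((hexDir (k + 1)).2 : ℝ) = r * (hexDir k).2 := by linarith
    rw [f1, f2] at hdet
    linarith

lemma IsTriangleInjective.planeCross_mul_pos {P : ℤ × ℤ → ℂ} (hP : IsTriangleInjective P)
    (v : ℤ × ℤ) (k : Fin 6) :
    0 < planeCross (P (v + hexDir k) - P v) (P (v + hexDir (k + 1)) - P v) *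
      planeCross (P (v + hexDir (k + 1)) - P v) (P (v + hexDir (k + 1 + 1)) - P v) := by
  have h1 := hP.planeCross_ne_zero v k
  have h2 := hP.planeCross_ne_zero v (k + 1)
  by_contra! hle
  have hlt := lt_of_le_of_ne hle (mul_ne_zero h1 h2)
  have hdet : ((hexDir (k + 1)).1 : ℝ) * (hexDir (k + 1 + 1)).2 -
      (hexDir (k + 1)).2 * (hexDir (k + 1 + 1)).1 = 1 := mod_cast hexDir_cross (k + 1)
  have hs := hexDir_succ k
  rw [show k + 2 = k + 1 + 1 by rw [add_assoc]; rfl] at hs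
  have hs1 : ((hexDir (k + 1)).1 : ℝ) = (hexDir k).1 + (hexDir (k + 1 + 1)).1 := by
    rw [hs]; push_cast [Prod.fst_add]; rfl
  have hs2 : ((hexDir (k + 1)).2 : ℝ) = (hexDir k).2 + (hexDir (k + 1 + 1)).2 := by
    rw [hs]; push_cast [Prod.snd_add]; rfl
  have key := planeCross_smul_add _ _ h2 (P (v + hexDir k) - P v)
  set a := planeCross (P (v + hexDir k) - P v) (P (v + hexDir (k + 1 + 1)) - P v) /
    planeCross (P (v + hexDir (k + 1)) - P v) (P (v + hexDir (k + 1 + 1)) - P v) with ha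
  set b := planeCross (P (v + hexDir (k + 1)) - P v) (P (v + hexDir k) - P v) /
    planeCross (P (v + hexDir (k + 1)) - P v) (P (v + hexDir (k + 1 + 1)) - P v) with hb
  have hb0 : 0 < b := by
    rw [hb, planeCross_comm]
    rcases mul_neg_iff.1 hlt with ⟨h, h'⟩ | ⟨h, h'⟩
    · exact div_pos_of_neg_of_neg (by linarith) h'
    · exact div_pos (by linarith) h'
  have hrel : ((hexDir k).1 : ℝ) = a * (hexDir (k + 1)).1 + b * (hexDir (k + 1 + 1)).1 ∧
      ((hexDir k).2 : ℝ) = a * (hexDir (k + 1)).2 + b * (hexDir (k + 1 + 1)).2 := by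
    rcases le_total 0 a with h | h
    · obtain ⟨e1, e2⟩ := hP.cone_injective (v := v) (k := k) (j := k + 1) (a := 1) (b := 0)
        (a' := a) (b' := b) zero_le_one le_rfl h hb0.le (by push_cast; linear_combination key)
      constructor <;> linarith
    · obtain ⟨e1, e2⟩ := hP.cone_injective (v := v) (k := k) (j := k + 1) (a := 1) (b := -a)
        (a' := 0) (b' := b) zero_le_one (by linarith) le_rfl hb0.le
        (by push_cast; linear_combination key)
      constructor <;> linarith
  obtain ⟨e1, e2⟩ := hrel
  have : b = -1 := by
    linear_combination (-b - 1) * hdet - (hexDir (k + 1)).1 * (hs2 + e2) +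
      (hexDir (k + 1)).2 * (hs1 + e1)
  linarith

lemma IsTriangleInjective.isHexEmbedding {P : ℤ × ℤ → ℂ} (hP : IsTriangleInjective P)
    (h0 : 0 < planeCross (P (0 + hexDir 0) - P 0) (P (0 + hexDir 1) - P 0)) :
    IsHexEmbedding P := by
  have hrot : ∀ v k j, 0 < planeCross (P (v + hexDir k) - P v) (P (v + hexDir (k + 1)) - P v) →
      0 < planeCross (P (v + hexDir j) - P v) (P (v + hexDir (j + 1)) - P v) := by
    intro v k j h
    have hstep : ∀ i, 0 < planeCross (P (v + hexDir i) - P v) (P (v + hexDir (i + 1)) - P v) →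
        0 < planeCross (P (v + hexDir (i + 1)) - P v) (P (v + hexDir (i + 1 + 1)) - P v) :=
      fun i => (pos_iff_pos_of_mul_pos (hP.planeCross_mul_pos v i)).1
    have hcyc : ∀ k j : Fin 6, j = k ∨ j = k + 1 ∨ j = k + 1 + 1 ∨ j = k + 1 + 1 + 1 ∨
        j = k + 1 + 1 + 1 + 1 ∨ j = k + 1 + 1 + 1 + 1 + 1 := by decide
    rcases hcyc k j with rfl | rfl | rfl | rfl | rfl | rfl
    exacts [h, hstep _ h, hstep _ (hstep _ h), hstep _ (hstep _ (hstep _ h)),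
      hstep _ (hstep _ (hstep _ (hstep _ h))), hstep _ (hstep _ (hstep _ (hstep _ (hstep _ h))))]
  refine ⟨fun v => ?_, hP⟩
  induction v using hexDir_induction with
  | h0 => exact fun k => hrot 0 0 k h0
  | hstep v k ih =>
    refine fun j => hrot _ (k + 2) j ?_
    have e1 : v + hexDir k + hexDir (k + 2) = v + hexDir (k + 1) := by
      rw [add_assoc, ← hexDir_succ]
    have e2 : v + hexDir k + hexDir (k + 2 + 1) = v := by
      rw [add_assoc k, show (2 + 1 : Fin 6) = 3 from rfl, hexDir_add_three, add_neg_cancel_right]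
    have := ih k
    rw [e1, e2]
    simp only [planeCross, Complex.sub_re, Complex.sub_im] at this ⊢
    linarith

lemma IsTriangleInjective.exists_isHexEmbedding {P : ℤ × ℤ → ℂ} (hP : IsTriangleInjective P) :
    ∃ Q : ℤ × ℤ → ℂ, IsHexEmbedding Q ∧ ∀ u v, dist (Q u) (Q v) = dist (P u) (P v) := by
  rcases lt_or_gt_of_ne (hP.planeCross_ne_zero 0 0) with h | h
  · refine ⟨fun v => starRingEnd ℂ (P v), IsTriangleInjective.isHexEmbedding ?_ ?_,
      fun u v => Complex.dist_conj_conj _ _⟩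
    · intro v k s t v' k' s' t' h1 h2 h3 h4 h5 h6 h
      refine hP v k s t v' k' s' t' h1 h2 h3 h4 h5 h6 ((starRingEnd ℂ).injective ?_)
      simpa [trianglePoint] using h
    · rw [show (0 + 1 : Fin 6) = 1 from rfl] at h
      simp only [planeCross, Complex.sub_re, Complex.sub_im, Complex.conj_re, Complex.conj_im]
        at h ⊢
      linarith
  · exact ⟨P, hP.isHexEmbedding h, fun _ _ => rfl⟩

lemma im_div_pos {a b : ℂ} (h : 0 < planeCross a b) : 0 < (b / a).im := by
  have ha : a ≠ 0 := by rintro rfl; simp [planeCross] at h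
  rw [Complex.div_im, ← sub_div]
  refine div_pos ?_ (Complex.normSq_pos.2 ha)
  simp only [planeCross] at h
  linarith

lemma Complex.arg_mem_Ioo_of_im_pos {z : ℂ} (h : 0 < z.im) : z.arg ∈ Set.Ioo 0 π := by
  refine ⟨lt_of_le_of_ne (Complex.arg_nonneg_iff.2 h.le) fun h0 => ?_,
    Complex.arg_lt_pi_iff.2 (Or.inr h.ne')⟩
  exact h.ne (Complex.arg_eq_zero_iff.1 h0.symm).2.symm

lemma sqAngle_norm {z w : ℂ} (hz : z ≠ 0) (hw : w ≠ 0) :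
    sqAngle ‖z - w‖ (‖z‖ ^ 2) (‖w‖ ^ 2) = |(z / w).arg| := by
  rw [← Complex.angle_eq_abs_arg hz hw, sqAngle, InnerProductGeometry.angle, ← mul_pow,
    sqrt_sq (by positivity), norm_sub_sq_real]
  congr 1
  have := norm_pos_iff.2 hz
  have := norm_pos_iff.2 hw
  field_simp
  ring

lemma heronForm_norm_nonneg (z w : ℂ) : 0 ≤ heronForm ‖z - w‖ (‖z‖ ^ 2) (‖w‖ ^ 2) := by
  have h := abs_real_inner_le_norm z w
  have h' : (inner ℝ z w) ^ 2 ≤ (‖z‖ * ‖w‖) ^ 2 := sq_le_sq' (abs_le.1 h).1 (abs_le.1 h).2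
  have e : heronForm ‖z - w‖ (‖z‖ ^ 2) (‖w‖ ^ 2) =
      4 * ((‖z‖ * ‖w‖) ^ 2 - (inner ℝ z w) ^ 2) := by
    rw [heronForm, show ‖z - w‖ ^ 4 = (‖z - w‖ ^ 2) ^ 2 by ring, norm_sub_sq_real]
    ring
  rw [e]
  linarith

lemma star_triangle {d e : ℂ} {α β γ p q r : ℝ} (hp : 0 < p) (hq : 0 < q)
    (hd : ‖d‖ = exp (α + β) * p) (he : ‖e‖ = exp (α + γ) * q) (hde : ‖d - e‖ = exp (β + γ) * r)
    (hpos : 0 < planeCross d e) :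
    sqAngle (r / (p * q)) (exp (2 * (α - β)) / p ^ 2) (exp (2 * (α - γ)) / q ^ 2) = (e / d).arg ∧
    0 ≤ heronForm (r / (p * q)) (exp (2 * (α - β)) / p ^ 2) (exp (2 * (α - γ)) / q ^ 2) := by
  have hd0 : d ≠ 0 := by rw [← norm_pos_iff, hd]; positivity
  have he0 : e ≠ 0 := by rw [← norm_pos_iff, he]; positivity
  have hc : ((exp (2 * α) : ℝ) : ℂ) ≠ 0 := Complex.ofReal_ne_zero.2 (exp_ne_zero _)
  have hcn : ‖((exp (2 * α) : ℝ) : ℂ)‖ = exp (2 * α) := by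
    rw [Complex.norm_real, norm_eq_abs, abs_of_pos (exp_pos _)]
  set z := ((exp (2 * α) : ℝ) : ℂ) / d with hz
  set w := ((exp (2 * α) : ℝ) : ℂ) / e with hw
  have hz0 : z ≠ 0 := div_ne_zero hc hd0
  have hw0 : w ≠ 0 := div_ne_zero hc he0
  have zn : ‖z‖ ^ 2 = exp (2 * (α - β)) / p ^ 2 := by
    rw [hz, norm_div, hcn, hd]
    simp only [two_mul, exp_add, exp_sub]
    field_simp
  have wn : ‖w‖ ^ 2 = exp (2 * (α - γ)) / q ^ 2 := by
    rw [hw, norm_div, hcn, he]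
    simp only [two_mul, exp_add, exp_sub]
    field_simp
  have zwn : ‖z - w‖ = r / (p * q) := by
    have : z - w = -(((exp (2 * α) : ℝ) : ℂ) * (d - e) / (d * e)) := by
      rw [hz, hw]; field_simp; ring
    rw [this, norm_neg, norm_div, norm_mul, norm_mul, hcn, hd, he, hde]
    simp only [two_mul, exp_add]
    field_simp
  have hzw : z / w = e / d := by rw [hz, hw]; field_simp
  rw [← zn, ← wn, ← zwn]
  refine ⟨?_, heronForm_norm_nonneg z w⟩
  rw [sqAngle_norm hz0 hw0, hzw,
    abs_of_pos (Complex.arg_mem_Ioo_of_im_pos (im_div_pos hpos)).1]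

/-- If the direction `0` lies in the sector between the angles `s` and `t`, then it is a
non-negative combination of the bounding directions. -/
lemma exists_cone_of_sector {d p q : ℂ} {R R' s t : ℝ} (hR : 0 < R) (hR' : 0 < R')
    (hp : p = d * (R * Complex.exp (s * Complex.I))) (hq : q = d * (R' * Complex.exp (t * Complex.I)))
    (hpq : 0 < planeCross p q) (hs : s ≤ 2 * π) (ht : 2 * π ≤ t) (hst : t - s < π) :
    ∃ a b : ℝ, 0 ≤ a ∧ 0 ≤ b ∧ d = a * p + b * q := by
  have him : ∀ (R s : ℝ), ((R : ℂ) * Complex.exp (s * Complex.I)).im = R * sin s := fun R s => by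
    rw [Complex.im_ofReal_mul, Complex.exp_ofReal_mul_I_im]
  have hc : ∀ u : ℂ, planeCross d (d * u) = Complex.normSq d * u.im := fun u => by
    simp only [planeCross, Complex.mul_re, Complex.mul_im, Complex.normSq_apply]; ring
  refine ⟨_, _, div_nonneg ?_ hpq.le, div_nonneg ?_ hpq.le, planeCross_smul_add p q hpq.ne' d⟩
  · rw [hq, hc, him, ← sin_sub_two_pi]
    exact mul_nonneg (Complex.normSq_nonneg _) (mul_nonneg hR'.le
      (sin_nonneg_of_nonneg_of_le_pi (by linarith) (by linarith)))
  · rw [hp, planeCross_comm, hc, him]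
    have : 0 ≤ - sin s := by
      rw [← sin_neg, ← sin_add_two_pi]
      exact sin_nonneg_of_nonneg_of_le_pi (by linarith) (by linarith)
    nlinarith [mul_nonneg (Complex.normSq_nonneg d) (mul_nonneg hR.le this)]

lemma sum_arg_eq_two_pi {d : Fin 6 → ℂ} (hd : ∀ k, 0 < planeCross (d k) (d (k + 1)))
    (h2 : ∀ a b : ℝ, 0 ≤ a → 0 ≤ b → d 0 ≠ a * d 2 + b * d 3)
    (h3 : ∀ a b : ℝ, 0 ≤ a → 0 ≤ b → d 0 ≠ a * d 3 + b * d 4) :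
    ∑ k, (d (k + 1) / d k).arg = 2 * π := by
  have hd0 : ∀ k, d k ≠ 0 := fun k h => by simpa [h, planeCross] using hd k
  have hθ := fun k => Complex.arg_mem_Ioo_of_im_pos (im_div_pos (hd k))
  have hζ : ∀ k, d (k + 1) = d k * (‖d (k + 1) / d k‖ *
      Complex.exp ((d (k + 1) / d k).arg * Complex.I)) := fun k => by
    rw [Complex.norm_mul_exp_arg_mul_I, mul_div_cancel₀ _ (hd0 k)]
  have hR : ∀ k, 0 < ‖d (k + 1) / d k‖ := fun k =>
    norm_pos_iff.2 (div_ne_zero (hd0 _) (hd0 _))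
  generalize hθd : (fun k => (d (k + 1) / d k).arg) = θ at *
  generalize hRd : (fun k => ‖d (k + 1) / d k‖) = R at *
  replace hθd := fun k => congrFun hθd k
  replace hRd := fun k => congrFun hRd k
  simp only [hθd, hRd] at *
  have comp : ∀ {a b c : ℂ} {r r' s s' : ℝ}, b = a * (r * Complex.exp (s * Complex.I)) →
      c = b * (r' * Complex.exp (s' * Complex.I)) →
      c = a * ((r * r' : ℝ) * Complex.exp ((s + s' : ℝ) * Complex.I)) := by
    intro a b c r r' s s' hb hc
    rw [hc, hb]
    push_cast
    rw [add_mul, Complex.exp_add]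
    ring
  have c2 := comp (hζ 0) (hζ 1)
  have c3 := comp c2 (hζ 2)
  have c4 := comp c3 (hζ 3)
  have c5 := comp c4 (hζ 4)
  have c6 := comp c5 (hζ 5)
  simp only [Fin.reduceAdd] at c2 c3 c4 c5 c6
  have hd2 := hd 2
  have hd3 := hd 3
  simp only [Fin.reduceAdd] at hd2 hd3
  have p0 := hR 0
  have p1 := hR 1
  have p2 := hR 2
  have p3 := hR 3
  have p4 := hR 4
  have p5 := hR 5
  have t0 := hθ 0
  have t1 := hθ 1
  have t2 := hθ 2
  have t3 := hθ 3
  have t4 := hθ 4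
  have t5 := hθ 5
  have hprod := mul_left_cancel₀ (hd0 0) (c6.symm.trans (mul_one _).symm)
  have hnorm := congrArg norm hprod
  rw [norm_mul, Complex.norm_exp_ofReal_mul_I, mul_one, Complex.norm_real, norm_eq_abs,
    abs_of_pos (by positivity), norm_one] at hnorm
  rw [hnorm, Complex.ofReal_one, one_mul, Complex.exp_eq_one_iff] at hprod
  obtain ⟨n, hn⟩ := hprod
  rw [← mul_assoc] at hn
  have hsum : θ 0 + θ 1 + θ 2 + θ 3 + θ 4 + θ 5 = n * (2 * π) := by
    exact_mod_cast mul_right_cancel₀ Complex.I_ne_zero hn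
  rw [Fin.sum_univ_six, hsum]
  have hπ := pi_pos
  have n0 : (0 : ℝ) < n := by
    by_contra! h
    nlinarith [t0.1, t1.1, t2.1, t3.1, t4.1, t5.1]
  have n3 : (n : ℝ) < 3 := by
    by_contra! h
    nlinarith [t0.2, t1.2, t2.2, t3.2, t4.2, t5.2]
  norm_cast at n0 n3
  obtain rfl | rfl : n = 1 ∨ n = 2 := by omega
  · simp
  · exfalso
    push_cast at hsum
    rcases le_total (θ 0 + θ 1 + θ 2) (2 * π) with h | h
    · obtain ⟨a, b, ha, hb, hab⟩ := exists_cone_of_sector (by positivity) (by positivity) c3 c4 hd3 h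
        (by linarith [t4.2, t5.2]) (by linarith [t3.2])
      exact h3 a b ha hb hab
    · obtain ⟨a, b, ha, hb, hab⟩ := exists_cone_of_sector (by positivity) (by positivity) c2 c3 hd2
        (by linarith [t0.2, t1.2]) h (by linarith [t2.2])
      exact h2 a b ha hb hab

lemma IsHexEmbedding.isFlatDelaunay {ℓ : Fin 6 → ℝ} (hℓ : ∀ k, 0 < ℓ k) {x : Layout}
    (hx : HasScaledLengths ℓ x) (hP : IsHexEmbedding x.2) (hD : HasDelaunayCos x.2) :
    IsFlatDelaunay ℓ x.1 := by
  intro v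
  have hlen : ∀ k, ‖x.2 (v + hexDir k) - x.2 v‖ = exp (x.1 v + x.1 (v + hexDir k)) * ℓ k :=
    fun k => by rw [← hx, dist_comm, dist_eq_norm]
  have hside : ∀ k, ‖(x.2 (v + hexDir k) - x.2 v) - (x.2 (v + hexDir (k + 1)) - x.2 v)‖ =
      exp (x.1 (v + hexDir k) + x.1 (v + hexDir (k + 1))) * ℓ (k + 2) := fun k => by
    rw [sub_sub_sub_cancel_right, ← dist_eq_norm, hx.dist_hexDir]
  have htri := fun k => star_triangle (hℓ k) (hℓ (k + 1)) (hlen k) (hlen (k + 1)) (hside k)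
    (hP.oriented v k)
  refine ⟨fun k => starRadius_pos hℓ _ _ _, fun k => (htri k).2, fun k => ?_, ?_⟩
  · rw [hx.sideProj_add_sideProj hℓ]
    exact mul_nonneg (div_pos (exp_pos _) (hℓ k)).le (hD v k)
  · refine (Finset.sum_congr rfl fun k _ => (htri k).1).trans
      (sum_arg_eq_two_pi (d := fun k => x.2 (v + hexDir k) - x.2 v) (hP.oriented v) ?_ ?_)
    · intro a b ha hb h
      have := hP.injective.cone_injective (v := v) (k := 0) (j := 2) zero_le_one le_rfl ha hb
        (by push_cast; linear_combination h)
      simp [hexDir] at this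
      linarith
    · intro a b ha hb h
      have := hP.injective.cone_injective (v := v) (k := 0) (j := 3) zero_le_one le_rfl ha hb
        (by push_cast; linear_combination h)
      simp [hexDir] at this
      linarith

lemma abs_angleCos_le_one (x z y : ℂ) : |angleCos x z y| ≤ 1 := by
  have h := abs_real_inner_div_norm_mul_norm_le_one (x - z) (y - z)
  have e := norm_sub_sq_real (x - z) (y - z)
  rw [sub_sub_sub_cancel_right] at e
  have : angleCos x z y = inner ℝ (x - z) (y - z) / (‖x - z‖ * ‖y - z‖) := by
    rw [angleCos, dist_comm z x, dist_comm z y, dist_eq_norm, dist_eq_norm, dist_eq_norm, e,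
      mul_assoc, ← mul_div_mul_left (inner ℝ (x - z) (y - z)) _ two_ne_zero]
    ring
  rwa [this]

lemma angleCos_add_nonneg {x z y x' z' y' : ℂ} (h : eAngle x z y + eAngle x' z' y' ≤ π) :
    0 ≤ angleCos x z y + angleCos x' z' y' := by
  change arccos (angleCos x z y) + arccos (angleCos x' z' y') ≤ π at h
  have h1 := abs_le.1 (abs_angleCos_le_one x z y)
  have h2 := abs_le.1 (abs_angleCos_le_one x' z' y')
  by_contra! hlt
  have := strictAntiOn_arccos (Set.mem_Icc.2 h1)
    (Set.mem_Icc.2 ⟨neg_le_neg h2.2, by linarith [h2.1]⟩)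
    (show angleCos x z y < -angleCos x' z' y' by linarith)
  rw [arccos_neg] at this
  linarith

lemma LatDelaunay.hasDelaunayCos {P : ℤ × ℤ → ℂ} (hP : LatDelaunay P) : HasDelaunayCos P := by
  have hk : ∀ v, 0 ≤ angleCos (P v) (P (v + (0, 1))) (P (v + (1, 0))) +
        angleCos (P v) (P (v + (1, -1))) (P (v + (1, 0))) ∧
      0 ≤ angleCos (P v) (P (v + (1, 0))) (P (v + (0, 1))) +
        angleCos (P v) (P (v + (-1, 1))) (P (v + (0, 1))) ∧
      0 ≤ angleCos (P (v + (1, 0))) (P v) (P (v + (0, 1))) +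
        angleCos (P (v + (1, 0))) (P (v + (1, 1))) (P (v + (0, 1))) := fun v =>
    ⟨angleCos_add_nonneg (hP v).1, angleCos_add_nonneg (hP v).2.1, angleCos_add_nonneg (hP v).2.2⟩
  intro v k
  obtain ⟨a0, a1, -⟩ := hk v
  have b2 := (hk (v + (-1, 0))).2.2
  have b3 := (hk (v + (-1, 0))).1
  have b4 := (hk (v + (0, -1))).2.1
  have b5 := (hk (v + (0, -1))).2.2
  simp only [add_assoc, Prod.mk_add_mk, Int.reduceNeg, Int.reduceAdd, add_zero, zero_add,
    show ((0, 0) : ℤ × ℤ) = 0 from rfl] at b2 b3 b4 b5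
  fin_cases k
  · exact a0
  · rw [add_comm]; exact a1
  · exact b2
  · rw [add_comm, angleCos_comm, angleCos_comm (P v)]; exact b3
  · rw [angleCos_comm, angleCos_comm (P v)]; exact b4
  · rw [add_comm, angleCos_comm, angleCos_comm (P v)]; exact b5

/-- The squared side lengths of a Delaunay lattice triangulation satisfy the nonobtuseness
condition. -/
lemma HasDelaunayCos.sq_le {ℓ : Fin 6 → ℝ} (hℓ : ∀ k, 0 < ℓ k) (h3 : ∀ k, ℓ (k + 3) = ℓ k)
    {P : ℤ × ℤ → ℂ} (hP : HasDelaunayCos P) (hl : ∀ v k, dist (P v) (P (v + hexDir k)) = ℓ k)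
    (k : Fin 6) : ℓ k ^ 2 ≤ ℓ (k + 1) ^ 2 + ℓ (k + 2) ^ 2 := by
  have hd : ∀ k, dist (P (0 + hexDir k)) (P (0 + hexDir (k + 1))) = ℓ (k + 2) := fun k => by
    rw [hexDir_succ, ← add_assoc, hl]
  have h := hP 0 k
  have e1 := hd k
  have e2 := hd (k - 1)
  rw [sub_add_cancel] at e2
  have g1 : ∀ k : Fin 6, k - 1 + 2 = k + 1 := by decide
  have g2 : ∀ k : Fin 6, k - 1 + 3 = k + 2 := by decide
  have f1 : ℓ (k - 1 + 2) = ℓ (k + 1) := by rw [g1]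
  have f2 : ℓ (k - 1) = ℓ (k + 2) := by rw [← h3, g2]
  rw [f1] at e2
  unfold angleCos at h
  rw [dist_comm (P (0 + hexDir (k + 1))) (P 0), dist_comm (P (0 + hexDir (k - 1))) (P 0),
    dist_comm (P (0 + hexDir (k + 1))), hl, hl, hl, f2, e1, e2,
    mul_right_comm, add_comm (ℓ (k + 2) ^ 2), ← add_div] at h
  have := hℓ (k + 1)
  have := hℓ (k + 2)
  rw [div_nonneg_iff] at h
  rcases h with ⟨h, -⟩ | ⟨-, h⟩
  · linarith
  · have : 0 < 2 * ℓ (k + 2) * ℓ (k + 1) := by positivity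
    linarith

/-- The point of the plane with coordinates `q` with respect to `u₁`, `u₂`. -/
noncomputable def realPoint (u₁ u₂ : ℂ) (q : ℝ × ℝ) : ℂ := q.1 * u₁ + q.2 * u₂

lemma realPoint_injective {u₁ u₂ : ℂ} (hind : LinearIndependent ℝ ![u₁, u₂]) :
    Function.Injective (realPoint u₁ u₂) := by
  intro q q' h
  have := LinearIndependent.pair_iff.1 hind (q.1 - q'.1) (q.2 - q'.2) (by
    simp only [realPoint] at h
    simp only [Complex.real_smul]
    push_cast
    linear_combination h)
  exact Prod.ext (sub_eq_zero.1 this.1) (sub_eq_zero.1 this.2)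

lemma realPoint_hexPoint (u₁ u₂ : ℂ) (v : ℤ × ℤ) (k : Fin 6) (s t : ℝ) :
    realPoint u₁ u₂ (hexPoint v k s t) = trianglePoint (Lpt u₁ u₂) v k s t := by
  simp only [realPoint, hexPoint, trianglePoint, Lpt, Prod.fst_add, Prod.snd_add]
  push_cast
  ring

lemma map_add_of_affine_on_convexHull {Φ : ℂ → ℂ} {S : Set ℂ} {A : ℂ →ᵃ[ℝ] ℂ}
    (h : ∀ z ∈ convexHull ℝ S, Φ z = A z) {p q r : ℂ} (hp : p ∈ S) (hq : q ∈ S) (hr : r ∈ S)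
    {s t : ℝ} (hs : 0 ≤ s) (ht : 0 ≤ t) (hst : s + t ≤ 1) :
    Φ (p + s * (q - p) + t * (r - p)) = Φ p + s * (Φ q - Φ p) + t * (Φ r - Φ p) := by
  have hsub := subset_convexHull ℝ S
  have hmem : p + s * (q - p) + t * (r - p) ∈ convexHull ℝ S := by
    have := (convex_convexHull ℝ S).sum_mem (t := Finset.univ) (w := ![1 - s - t, s, t])
      (z := ![p, q, r]) (by
        intro i _
        fin_cases i
        · simp; linarith
        · exact hs
        · exact ht) (by
        simp only [Fin.sum_univ_three, Matrix.cons_val]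
        ring) (by
        intro i _
        fin_cases i
        exacts [hsub hp, hsub hq, hsub hr])
    convert this using 1
    simp [Fin.sum_univ_three]
    ring
  rw [h _ hmem, h p (hsub hp), h q (hsub hq), h r (hsub hr)]
  have hA : ∀ z, A z = A.linear z + A 0 := fun z => congrFun A.decomp z
  rw [hA (p + s * (q - p) + t * (r - p)), hA p, hA q, hA r, ← Complex.real_smul,
    ← Complex.real_smul, map_add, map_add, map_smul, map_smul, map_sub, map_sub,
    Complex.real_smul, Complex.real_smul]
  ring

lemma map_trianglePoint {u₁ u₂ : ℂ} {Φ : ℂ → ℂ}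
    (haffdown : ∀ v : ℤ × ℤ, ∃ A : ℂ →ᵃ[ℝ] ℂ, ∀ z ∈ convexHull ℝ
      ({Lpt u₁ u₂ v, Lpt u₁ u₂ (v + (1, 0)), Lpt u₁ u₂ (v + (0, 1))} : Set ℂ), Φ z = A z)
    (haffup : ∀ v : ℤ × ℤ, ∃ A : ℂ →ᵃ[ℝ] ℂ, ∀ z ∈ convexHull ℝ
      ({Lpt u₁ u₂ (v + (1, 0)), Lpt u₁ u₂ (v + (0, 1)), Lpt u₁ u₂ (v + (1, 1))} : Set ℂ),
        Φ z = A z)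
    (v : ℤ × ℤ) (k : Fin 6) {s t : ℝ} (hs : 0 ≤ s) (ht : 0 ≤ t) (hst : s + t ≤ 1) :
    Φ (trianglePoint (Lpt u₁ u₂) v k s t) =
      trianglePoint (fun a => Φ (Lpt u₁ u₂ a)) v k s t := by
  obtain ⟨A0, h0⟩ := haffdown v
  obtain ⟨A1, h1⟩ := haffup (v + (-1, 0))
  obtain ⟨A2, h2⟩ := haffdown (v + (-1, 0))
  obtain ⟨A3, h3⟩ := haffup (v + (-1, -1))
  obtain ⟨A4, h4⟩ := haffdown (v + (0, -1))
  obtain ⟨A5, h5⟩ := haffup (v + (0, -1))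
  simp only [add_assoc, Prod.mk_add_mk, Int.reduceNeg, Int.reduceAdd, add_zero, zero_add,
    show ((0, 0) : ℤ × ℤ) = 0 from rfl] at h1 h2 h3 h4 h5
  unfold trianglePoint
  fin_cases k
  · exact map_add_of_affine_on_convexHull h0 (by simp) (by simp [hexDir]) (by simp [hexDir]) hs ht hst
  · exact map_add_of_affine_on_convexHull h1 (by simp) (by simp [hexDir]) (by simp [hexDir]) hs ht hst
  · exact map_add_of_affine_on_convexHull h2 (by simp) (by simp [hexDir]) (by simp [hexDir]) hs ht hst
  · exact map_add_of_affine_on_convexHull h3 (by simp) (by simp [hexDir]) (by simp [hexDir]) hs ht hst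
  · exact map_add_of_affine_on_convexHull h4 (by simp) (by simp [hexDir]) (by simp [hexDir]) hs ht hst
  · exact map_add_of_affine_on_convexHull h5 (by simp) (by simp [hexDir]) (by simp [hexDir]) hs ht hst

/-- (Rigidity of Delaunay lattice triangulations under vertex scaling, Theorem 1.2,
embedded form.)  Suppose the lattice triangulation `T_st` determined by the
ℝ-linearly independent vectors `u₁, u₂` is Delaunay.  If `w : ℤ² → ℝ` and there is a
continuous injective `Φ : ℂ → ℂ` which is affine on each triangle of `T_st`, scales
each edge `{L a, L b}` by the factor `e^{w(a)+w(b)}`, and whose image triangulation is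
Delaunay, then `w` is constant. -/
theorem lattice_vertex_scaling_rigidity
    (u₁ u₂ : ℂ) (hind : LinearIndependent ℝ ![u₁, u₂])
    (hstd : LatDelaunay (Lpt u₁ u₂))
    (w : ℤ × ℤ → ℝ) (Φ : ℂ → ℂ)
    (hcont : Continuous Φ) (hinj : Function.Injective Φ)
    (haffdown : ∀ v : ℤ × ℤ, ∃ A : ℂ →ᵃ[ℝ] ℂ,
      ∀ z ∈ convexHull ℝ
          ({Lpt u₁ u₂ v, Lpt u₁ u₂ (v + (1, 0)), Lpt u₁ u₂ (v + (0, 1))} : Set ℂ),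
        Φ z = A z)
    (haffup : ∀ v : ℤ × ℤ, ∃ A : ℂ →ᵃ[ℝ] ℂ,
      ∀ z ∈ convexHull ℝ
          ({Lpt u₁ u₂ (v + (1, 0)), Lpt u₁ u₂ (v + (0, 1)),
            Lpt u₁ u₂ (v + (1, 1))} : Set ℂ),
        Φ z = A z)
    (hlen : ∀ a b : ℤ × ℤ, LatAdj a b →
      dist (Φ (Lpt u₁ u₂ a)) (Φ (Lpt u₁ u₂ b)) =
        Real.exp (w a + w b) * dist (Lpt u₁ u₂ a) (Lpt u₁ u₂ b))
    (himg : LatDelaunay (fun a => Φ (Lpt u₁ u₂ a))) :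
    ∀ a b : ℤ × ℤ, w a = w b := by
  intro a b
  by_contra hab
  have hdir : ∀ v k, Lpt u₁ u₂ (v + hexDir k) - Lpt u₁ u₂ v = Lpt u₁ u₂ (hexDir k) := by
    intro v k
    simp only [Lpt, Prod.fst_add, Prod.snd_add]
    push_cast
    ring
  have hinjL : ∀ k, Lpt u₁ u₂ (hexDir k) ≠ 0 := by
    intro k h
    have h1 := realPoint_injective hind (a₁ := ((hexDir k).1, (hexDir k).2)) (a₂ := 0)
      (by simpa [realPoint, Lpt] using h)
    have h2 : hexDir k = 0 := by
      simp only [Prod.ext_iff, Prod.fst_zero, Prod.snd_zero, Int.cast_eq_zero] at h1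
      exact Prod.ext h1.1 h1.2
    revert h2
    clear h1 h
    revert k
    decide
  set ℓ : Fin 6 → ℝ := fun k => ‖Lpt u₁ u₂ (hexDir k)‖
  have hℓ : ∀ k, 0 < ℓ k := fun k => norm_pos_iff.2 (hinjL k)
  have hl : ∀ v k, dist (Lpt u₁ u₂ v) (Lpt u₁ u₂ (v + hexDir k)) = ℓ k := fun v k => by
    rw [dist_comm, dist_eq_norm, hdir]
  have hℓ3 : ∀ k, ℓ (k + 3) = ℓ k := fun k => by
    change ‖Lpt u₁ u₂ (hexDir (k + 3))‖ = ‖Lpt u₁ u₂ (hexDir k)‖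
    rw [hexDir_add_three, ← norm_neg]
    congr 1
    simp only [Lpt, Prod.fst_neg, Prod.snd_neg]
    push_cast
    ring
  have hsq := hstd.hasDelaunayCos.sq_le hℓ hℓ3 hl
  set P : ℤ × ℤ → ℂ := fun a => Φ (Lpt u₁ u₂ a) with hP
  have hPinj : IsTriangleInjective P := by
    intro v k s t v' k' s' t' h1 h2 h3 h4 h5 h6 h
    rw [hP, ← map_trianglePoint haffdown haffup v k h1 h2 h3,
      ← map_trianglePoint haffdown haffup v' k' h4 h5 h6] at h
    refine realPoint_injective hind ?_
    rw [realPoint_hexPoint, realPoint_hexPoint]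
    exact hinj h
  obtain ⟨Q, hQ, hQd⟩ := hPinj.exists_isHexEmbedding
  have hx : HasScaledLengths ℓ (w, Q) := by
    intro v k
    have hadj : LatAdj v (v + hexDir k) := by
      rw [LatAdj, sub_add_cancel_left]
      fin_cases k <;> simp [hexDir]
    rw [hQd, hP]
    simp only
    rw [hlen _ _ hadj, hl]
  have hD : HasDelaunayCos Q := by
    have := himg.hasDelaunayCos
    intro v k
    have := this v k
    simp only [angleCos, hQd] at this ⊢
    exact this
  have hw := hQ.isFlatDelaunay hℓ (x := (w, Q)) hx hD
  obtain ⟨y, hy, hyf, M, N, hMN, hlin⟩ := exists_linear_limit hℓ (x := (w, Q)) hw hx hab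
  have h0 := hsq 0
  have h1 := hsq 1
  have h2 := hsq 2
  simp only [Fin.reduceAdd, zero_add] at h0 h1 h2
  rw [show ℓ 3 = ℓ 0 from hℓ3 0] at h1 h2
  rw [show ℓ 4 = ℓ 1 from hℓ3 1] at h2
  exact false_of_linear_limit hℓ h0 (by linarith) h2 hyf
    (mem_closure_hexEmbedding_of_recentre (x := (w, Q)) hQ hy) hMN hlin
end

section
/- (Maximum principle, Theorem 3.1.) Let (x, y) be a generalized PL metric on the star triangulation of an n-gon (n ≥ 3) which is Delaunay (a_i(0) + b_i(0) ≤ π for all i, where 0 denotes the zero conformal factor). Let w₀ ∈ ℝ and w : ℤ/nℤ → ℝ be such that: (a) the vertex-scaled lengths (x_i(w), x_{i+1}(w), y_i(w)) satisfy the weak triangle inequalities for every i and the scaled metric is Delaunay (a_i(w) + b_i(w) ≤ π for all i); (b) α(w) ≥ α(0) (equivalently, the discrete curvature at v₀ of the scaled metric is at most that of the original metric); (c) w₀ ≥ w_i for all i ∈ ℤ/nℤ. Then w_i = w₀ for all i ∈ ℤ/nℤ. -/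
open Real

/-- Positive reals `p, q, r` satisfying the weak triangle inequalities
(a generalized triangle). -/
def IsGenTri (p q r : ℝ) : Prop :=
  0 < p ∧ 0 < q ∧ 0 < r ∧ p ≤ q + r ∧ q ≤ p + r ∧ r ≤ p + q

/-! Star triangulation of an `n`-gon: interior vertex `v₀`, boundary vertices
`vᵢ, i ∈ ℤ/nℤ`, triangles `Δ v₀ vᵢ v_{i+1}`; `x i` is the length of `v₀vᵢ` and
`y i` the length of `vᵢv_{i+1}`.  Conformal factors: `w0` at `v₀`, `w i` at `vᵢ`. -/

/-- Scaled length of the edge `v₀ vᵢ`. -/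
noncomputable def Xl (n : ℕ) (x : ZMod n → ℝ) (w0 : ℝ) (w : ZMod n → ℝ) (i : ZMod n) : ℝ :=
  Real.exp (w0 + w i) * x i

/-- Scaled length of the edge `vᵢ v_{i+1}`. -/
noncomputable def Yl (n : ℕ) (y : ZMod n → ℝ) (w : ZMod n → ℝ) (i : ZMod n) : ℝ :=
  Real.exp (w i + w (i + 1)) * y i

/-- The angle `cᵢ(w)` at `v₀` in the triangle `Δ v₀ vᵢ v_{i+1}` in the scaled metric. -/
noncomputable def cAng (n : ℕ) (x y : ZMod n → ℝ) (w0 : ℝ) (w : ZMod n → ℝ) (i : ZMod n) : ℝ :=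
  triAngle (Xl n x w0 w i) (Xl n x w0 w (i + 1)) (Yl n y w i)

/-- The angle `aᵢ(w)` at `v_{i+1}` in the triangle `Δ v₀ vᵢ v_{i+1}` in the scaled metric. -/
noncomputable def aAng (n : ℕ) (x y : ZMod n → ℝ) (w0 : ℝ) (w : ZMod n → ℝ) (i : ZMod n) : ℝ :=
  triAngle (Xl n x w0 w (i + 1)) (Yl n y w i) (Xl n x w0 w i)

/-- The angle `bᵢ(w)` at `v_{i-1}` in the triangle `Δ v₀ v_{i-1} vᵢ` in the scaled metric. -/
noncomputable def bAng (n : ℕ) (x y : ZMod n → ℝ) (w0 : ℝ) (w : ZMod n → ℝ) (i : ZMod n) : ℝ :=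
  triAngle (Xl n x w0 w (i - 1)) (Yl n y w (i - 1)) (Xl n x w0 w i)

/-- The cone angle `α(w)` at the interior vertex `v₀` of the scaled metric. -/
noncomputable def coneAngle (n : ℕ) [NeZero n] (x y : ZMod n → ℝ) (w0 : ℝ)
    (w : ZMod n → ℝ) : ℝ :=
  ∑ i : ZMod n, cAng n x y w0 w i

/-- The apex angle of a triangle in terms of the squares `p`, `q` of the adjacent sides and the
square `S` of the opposite side. -/
noncomputable def apexAngle (p q S : ℝ) : ℝ :=
  Real.arccos ((p + q - S) / (2 * √(p * q)))

/-- The cotangent of an angle with cosine `u / (2 * √q)`. -/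
noncomputable def cotOf (q u : ℝ) : ℝ :=
  u / √(4 * q - u ^ 2)

lemma cotOf_neg (q u : ℝ) : cotOf q (-u) = -cotOf q u := by
  simp [cotOf, neg_div]

lemma cotOf_add_pos {q u v : ℝ} (hu : u ^ 2 < 4 * q) (hv : v ^ 2 < 4 * q) (h : 0 < u + v) :
    0 < cotOf q u + cotOf q v := by
  wlog huv : v ≤ u generalizing u v
  · rw [add_comm]
    exact this hv hu (by linarith) (by linarith)
  have hu0 : 0 < u := by linarith
  have hsu : 0 < √(4 * q - u ^ 2) := Real.sqrt_pos.2 (by linarith)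
  have hsv : 0 < √(4 * q - v ^ 2) := Real.sqrt_pos.2 (by linarith)
  rcases le_or_gt 0 v with hv0 | hv0
  · exact add_pos_of_pos_of_nonneg (div_pos hu0 hsu) (div_nonneg hv0 hsv.le)
  · have hle : √(4 * q - u ^ 2) ≤ √(4 * q - v ^ 2) := Real.sqrt_le_sqrt (by nlinarith)
    have hlt : cotOf q (-v) < cotOf q u := by
      unfold cotOf
      rw [neg_sq]
      exact div_lt_div₀ (by linarith) hle hu0.le hsu
    rw [cotOf_neg] at hlt
    linarith

lemma cotOf_add_nonneg {q u v : ℝ} (hu : u ^ 2 < 4 * q) (hv : v ^ 2 < 4 * q) (h : 0 ≤ u + v) :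
    0 ≤ cotOf q u + cotOf q v := by
  rcases h.eq_or_lt with h | h
  · rw [show v = -u by linarith, cotOf_neg, add_neg_cancel]
  · exact (cotOf_add_pos hu hv h).le

lemma hasDerivAt_apexAngle {p q : ℝ → ℝ} {p' q' s t : ℝ} (hp : HasDerivAt p p' t)
    (hq : HasDerivAt q q' t) (hp0 : 0 < p t) (hq0 : 0 < q t) (hs : 0 < s)
    (hnd : ((p t - q t + s ^ 2) / s) ^ 2 < 4 * p t) :
    HasDerivAt (fun τ => apexAngle (p τ) (q τ) (s ^ 2))
      (-(p' / (2 * p t) * cotOf (p t) ((p t - q t + s ^ 2) / s) +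
        q' / (2 * q t) * cotOf (q t) ((q t - p t + s ^ 2) / s))) t := by
  have hpq : 0 < p t * q t := mul_pos hp0 hq0
  set m := √(p t * q t) with hm
  have hm0 : 0 < m := Real.sqrt_pos.2 hpq
  have hm2 : m ^ 2 = p t * q t := Real.sq_sqrt hpq.le
  set d := 4 * (p t * q t) - (p t + q t - s ^ 2) ^ 2 with hd
  have hd1 : 4 * p t - ((p t - q t + s ^ 2) / s) ^ 2 = d / s ^ 2 := by
    rw [hd]; field_simp; ring
  have hd2 : 4 * q t - ((q t - p t + s ^ 2) / s) ^ 2 = d / s ^ 2 := by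
    rw [hd]; field_simp; ring
  have hd0 : 0 < d := by
    have h : 0 < d / s ^ 2 := by linarith
    rwa [div_pos_iff_of_pos_right (by positivity)] at h
  set D := √d with hD
  have hD0 : 0 < D := Real.sqrt_pos.2 hd0
  have hg1 : 1 - ((p t + q t - s ^ 2) / (2 * m)) ^ 2 = d / (2 * m) ^ 2 := by
    rw [hd]; field_simp; rw [hm2]; ring
  have hg1' : 0 < 1 - ((p t + q t - s ^ 2) / (2 * m)) ^ 2 := by
    rw [hg1]; positivity
  have hlt := (sq_lt_one_iff_abs_lt_one _).1 (by linarith :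
    ((p t + q t - s ^ 2) / (2 * m)) ^ 2 < 1)
  have hroot := (hp.mul hq).sqrt hpq.ne'
  have hfrac := ((hp.add hq).sub_const (s ^ 2)).div (hroot.const_mul 2)
    (by positivity)
  have hfin := (Real.hasDerivAt_arccos (abs_lt.1 hlt).1.ne' (abs_lt.1 hlt).2.ne).comp t hfrac
  refine hfin.congr_deriv ?_
  simp only [cotOf, hd1, hd2, Pi.mul_apply, Pi.add_apply]
  rw [hg1, Real.sqrt_div hd0.le, Real.sqrt_div hd0.le, Real.sqrt_sq hs.le,
    Real.sqrt_sq (by positivity), ← hD, ← hm]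
  field_simp
  rw [hm2]
  ring

/-- Twice the length of the radius times the cosine sum at a vertex of a star polygon whose
squared radii are `q` and whose sides are `s`; it is nonnegative iff the polygon is convex there. -/
noncomputable def vertexExcess {n : ℕ} (s q : ZMod n → ℝ) (i : ZMod n) : ℝ :=
  (q i - q (i + 1) + s i ^ 2) / s i + (q i - q (i - 1) + s (i - 1) ^ 2) / s (i - 1)

lemma sum_comp_sub_one {n : ℕ} [NeZero n] (g : ZMod n → ℝ) :
    ∑ i, g (i - 1) = ∑ i, g i :=
  Equiv.sum_comp (Equiv.subRight (1 : ZMod n)) g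

lemma eq_of_forall_eq_add_one {n : ℕ} [NeZero n] {g : ZMod n → ℝ} (h : ∀ i, g i = g (i + 1))
    (i : ZMod n) : g i = g 0 := by
  have key : ∀ k : ℕ, g (k : ZMod n) = g 0 := by
    intro k
    induction k with
    | zero => simp
    | succ k ih => rw [Nat.cast_succ, ← h, ih]
  simpa using key i.val

lemma sum_vertexExcess {n : ℕ} [NeZero n] {s : ZMod n → ℝ} (hs : ∀ i, 0 < s i)
    (q : ZMod n → ℝ) : ∑ i, vertexExcess s q i = ∑ i, 2 * s i := by
  have h := sum_comp_sub_one (fun i => (q (i + 1) - q i + s i ^ 2) / s i)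
  simp only [sub_add_cancel] at h
  simp only [vertexExcess]
  rw [Finset.sum_add_distrib, h, ← Finset.sum_add_distrib]
  refine Finset.sum_congr rfl fun i _ => ?_
  have := (hs i).ne'
  field_simp
  ring

lemma sum_mul_vertexExcess_sub {n : ℕ} [NeZero n] {s : ZMod n → ℝ} (hs : ∀ i, 0 < s i)
    (q d : ZMod n → ℝ) (t t' : ℝ) :
    ∑ i, d i * (vertexExcess s (fun j => q j + t' * d j) i
      - vertexExcess s (fun j => q j + t * d j) i)
      = (t' - t) * ∑ i, (d i - d (i + 1)) ^ 2 / s i := by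
  have h := sum_comp_sub_one (fun i => (t' - t) * (d (i + 1) * ((d (i + 1) - d i) / s i)))
  simp only [sub_add_cancel] at h
  have hsplit : ∀ i, d i * (vertexExcess s (fun j => q j + t' * d j) i
      - vertexExcess s (fun j => q j + t * d j) i)
      = (t' - t) * (d i * ((d i - d (i + 1)) / s i))
        + (t' - t) * (d i * ((d i - d (i - 1)) / s (i - 1))) := by
    intro i
    have h1 := (hs i).ne'
    have h2 := (hs (i - 1)).ne'
    simp only [vertexExcess]
    field_simp
    ring
  rw [Finset.sum_congr rfl fun i _ => hsplit i, Finset.sum_add_distrib, h,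
    ← Finset.sum_add_distrib, Finset.mul_sum]
  refine Finset.sum_congr rfl fun i _ => ?_
  have := (hs i).ne'
  field_simp
  ring

/-- A parabola is strictly convex: an open segment between two distinct points of the closed
region it bounds, one dominating the other, lies in the open region. -/
lemma sq_lt_of_mem_segment {p q a b s t : ℝ} (hs : 0 < s) (ha : 0 ≤ a) (hb : 0 ≤ b)
    (hab : ¬ (a = 0 ∧ b = 0)) (ht : t ∈ Set.Ioo (0 : ℝ) 1)
    (h0 : ((p - q + s ^ 2) / s) ^ 2 ≤ 4 * p)
    (h1 : ((p + a - (q + b) + s ^ 2) / s) ^ 2 ≤ 4 * (p + a)) :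
    ((p + t * a - (q + t * b) + s ^ 2) / s) ^ 2 < 4 * (p + t * a) := by
  obtain ⟨ht0, ht1⟩ := ht
  have e1 : (p + a - (q + b) + s ^ 2) / s = (p - q + s ^ 2) / s + (a - b) / s := by ring
  have e2 : (p + t * a - (q + t * b) + s ^ 2) / s = (p - q + s ^ 2) / s + t * ((a - b) / s) := by
    ring
  rw [e1] at h1
  rw [e2]
  set u := (p - q + s ^ 2) / s
  rcases eq_or_ne a b with rfl | hne
  · have : 0 < a := lt_of_le_of_ne ha fun h => hab ⟨h.symm, h.symm⟩
    have := mul_pos ht0 this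
    simp only [sub_self, zero_div, mul_zero, add_zero]
    linarith
  · have hv : (a - b) / s ≠ 0 := div_ne_zero (sub_ne_zero.2 hne) hs.ne'
    set v := (a - b) / s
    have h2 : 0 < t * (1 - t) * v ^ 2 :=
      mul_pos (mul_pos ht0 (by linarith)) (by positivity)
    have h3 := mul_le_mul_of_nonneg_left h0 (by linarith : 0 ≤ 1 - t)
    have h4 := mul_le_mul_of_nonneg_left h1 ht0.le
    nlinarith

/-- Two convex star polygons with the same sides: if the squared radii of the second dominate
those of the first and its cone angle is not smaller, then the radii agree. -/
lemma eq_zero_of_sum_apexAngle_le {n : ℕ} [NeZero n] {s q d : ZMod n → ℝ}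
    (hs : ∀ i, 0 < s i) (hq : ∀ i, 0 < q i) (hd : ∀ i, 0 ≤ d i)
    (h0 : ∀ i, ((q i - q (i + 1) + s i ^ 2) / s i) ^ 2 ≤ 4 * q i)
    (h1 : ∀ i, ((q i + d i - (q (i + 1) + d (i + 1)) + s i ^ 2) / s i) ^ 2 ≤ 4 * (q i + d i))
    (hE0 : ∀ i, 0 ≤ vertexExcess s q i)
    (hE1 : ∀ i, 0 ≤ vertexExcess s (fun j => q j + d j) i)
    (hle : ∑ i, apexAngle (q i) (q (i + 1)) (s i ^ 2) ≤
      ∑ i, apexAngle (q i + d i) (q (i + 1) + d (i + 1)) (s i ^ 2)) :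
    ∀ i, d i = 0 := by
  set F : ℝ → ℝ := fun t =>
    ∑ i, apexAngle (q i + t * d i) (q (i + 1) + t * d (i + 1)) (s i ^ 2) with hF
  set u : ℝ → ZMod n → ℝ := fun t i =>
    (q i + t * d i - (q (i + 1) + t * d (i + 1)) + s i ^ 2) / s i with hu
  set v : ℝ → ZMod n → ℝ := fun t i =>
    (q (i + 1) + t * d (i + 1) - (q i + t * d i) + s i ^ 2) / s i with hv
  set T : ℝ → ZMod n → ℝ := fun t i =>
    d i / (2 * (q i + t * d i)) *
      (cotOf (q i + t * d i) (u t i) + cotOf (q i + t * d i) (v t (i - 1))) with hT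
  have hpos : ∀ t : ℝ, 0 ≤ t → ∀ i, 0 < q i + t * d i := fun t ht i =>
    add_pos_of_pos_of_nonneg (hq i) (mul_nonneg ht (hd i))
  have hulin : ∀ t i, vertexExcess s (fun j => q j + t * d j) i = u t i + v t (i - 1) := by
    intro t i
    simp [vertexExcess, hu, hv]
  have hE : ∀ t ∈ Set.Ioo (0 : ℝ) 1, ∀ i, 0 ≤ u t i + v t (i - 1) := by
    intro t ht i
    have e : u t i + v t (i - 1) = (1 - t) * vertexExcess s q i
        + t * vertexExcess s (fun j => q j + d j) i := by
      simp only [hu, hv, vertexExcess, sub_add_cancel]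
      ring
    rw [e]
    exact add_nonneg (mul_nonneg (by linarith [ht.2]) (hE0 i)) (mul_nonneg ht.1.le (hE1 i))
  have hu4 : ∀ t ∈ Set.Ioo (0 : ℝ) 1, ∀ i, ¬ (d i = 0 ∧ d (i + 1) = 0) →
      u t i ^ 2 < 4 * (q i + t * d i) := fun t ht i hne =>
    sq_lt_of_mem_segment (hs i) (hd i) (hd (i + 1)) hne ht (h0 i) (h1 i)
  have hv4 : ∀ t ∈ Set.Ioo (0 : ℝ) 1, ∀ i, ¬ (d i = 0 ∧ d (i + 1) = 0) →
      v t i ^ 2 < 4 * (q (i + 1) + t * d (i + 1)) := by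
    intro t ht i hne
    have h := hu4 t ht i hne
    have e : 4 * (q (i + 1) + t * d (i + 1)) - v t i ^ 2 = 4 * (q i + t * d i) - u t i ^ 2 := by
      have := (hs i).ne'
      simp only [hu, hv]
      field_simp
      ring
    linarith
  have hderiv : ∀ t ∈ Set.Ioo (0 : ℝ) 1, HasDerivAt F (-∑ i, T t i) t := by
    intro t ht
    have hterm : ∀ i, HasDerivAt
        (fun τ => apexAngle (q i + τ * d i) (q (i + 1) + τ * d (i + 1)) (s i ^ 2))
        (-(d i / (2 * (q i + t * d i)) * cotOf (q i + t * d i) (u t i) +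
          d (i + 1) / (2 * (q (i + 1) + t * d (i + 1))) *
            cotOf (q (i + 1) + t * d (i + 1)) (v t i))) t := by
      intro i
      by_cases hz : d i = 0 ∧ d (i + 1) = 0
      · simpa [hz.1, hz.2] using hasDerivAt_const t (apexAngle (q i) (q (i + 1)) (s i ^ 2))
      · have hl : ∀ j, HasDerivAt (fun τ : ℝ => q j + τ * d j) (d j) t := fun j => by
          simpa using ((hasDerivAt_id t).mul_const (d j)).const_add (q j)
        exact hasDerivAt_apexAngle (hl i) (hl (i + 1)) (hpos t ht.1.le i)
          (hpos t ht.1.le (i + 1)) (hs i) (hu4 t ht i hz)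
    refine (HasDerivAt.fun_sum fun i _ => hterm i).congr_deriv ?_
    have hshift := sum_comp_sub_one (fun i => d (i + 1) / (2 * (q (i + 1) + t * d (i + 1))) *
            cotOf (q (i + 1) + t * d (i + 1)) (v t i))
    simp only [sub_add_cancel] at hshift
    simp only [hT, mul_add (d _ / _)]
    rw [Finset.sum_neg_distrib, Finset.sum_add_distrib, Finset.sum_add_distrib, hshift]
  have hT0 : ∀ t ∈ Set.Ioo (0 : ℝ) 1, ∀ i, 0 ≤ T t i := by
    intro t ht i
    rcases (hd i).eq_or_lt with hz | hz
    · simp [hT, ← hz]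
    · have h2 := hv4 t ht (i - 1) (by simp [hz.ne'])
      rw [sub_add_cancel] at h2
      exact mul_nonneg (div_nonneg hz.le (by linarith [hpos t ht.1.le i]))
        (cotOf_add_nonneg (hu4 t ht i (by simp [hz.ne'])) h2 (hE t ht i))
  have hcont : ContinuousOn F (Set.Icc 0 1) := by
    refine continuousOn_finsetSum _ fun i _ => ?_
    refine Real.continuous_arccos.comp_continuousOn (ContinuousOn.div (by fun_prop)
      (by fun_prop) fun t ht => ?_)
    have := Real.sqrt_pos.2 (mul_pos (hpos t ht.1 i) (hpos t ht.1 (i + 1)))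
    positivity
  have hanti : AntitoneOn F (Set.Icc 0 1) := by
    refine antitoneOn_of_deriv_nonpos (convex_Icc 0 1) hcont ?_ ?_
    · rw [interior_Icc]
      exact fun t ht => (hderiv t ht).differentiableAt.differentiableWithinAt
    · rw [interior_Icc]
      intro t ht
      rw [(hderiv t ht).deriv, neg_nonpos]
      exact Finset.sum_nonneg fun i _ => hT0 t ht i
  have hF01 : F 0 ≤ F 1 := by simpa [hF] using hle
  have hconst : ∀ t ∈ Set.Icc (0 : ℝ) 1, F t = F 0 := fun t ht =>
    le_antisymm (hanti ⟨le_rfl, zero_le_one⟩ ht ht.1)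
      (hF01.trans (hanti ht ⟨zero_le_one, le_rfl⟩ ht.2))
  have hTz : ∀ t ∈ Set.Ioo (0 : ℝ) 1, ∀ i, T t i = 0 := by
    intro t ht
    have hev : F =ᶠ[nhds t] fun _ => F 0 := by
      filter_upwards [Ioo_mem_nhds ht.1 ht.2] with τ hτ
      exact hconst τ ⟨hτ.1.le, hτ.2.le⟩
    have h := (hderiv t ht).unique ((hasDerivAt_const t (F 0)).congr_of_eventuallyEq hev)
    have h' : ∑ i, T t i = 0 := by linarith
    intro i
    exact (Finset.sum_eq_zero_iff_of_nonneg fun i _ => hT0 t ht i).1 h' i (Finset.mem_univ i)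
  have hflat : ∀ t ∈ Set.Ioo (0 : ℝ) 1, ∀ i,
      d i * vertexExcess s (fun j => q j + t * d j) i = 0 := by
    intro t ht i
    rcases (hd i).eq_or_lt with hz | hz
    · simp [← hz]
    · rw [hulin]
      by_contra hne
      have hlt : 0 < u t i + v t (i - 1) :=
        lt_of_le_of_ne (hE t ht i) fun h => hne (by rw [← h, mul_zero])
      have h2 := hv4 t ht (i - 1) (by simp [hz.ne'])
      rw [sub_add_cancel] at h2
      have hTpos : 0 < T t i := mul_pos (div_pos hz (by linarith [hpos t ht.1.le i]))
        (cotOf_add_pos (hu4 t ht i (by simp [hz.ne'])) h2 hlt)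
      exact hTpos.ne' (hTz t ht i)
  have ht1 : (1 / 3 : ℝ) ∈ Set.Ioo (0 : ℝ) 1 := by norm_num
  have ht2 : (2 / 3 : ℝ) ∈ Set.Ioo (0 : ℝ) 1 := by norm_num
  have hdir := sum_mul_vertexExcess_sub hs q d (1 / 3) (2 / 3)
  simp only [mul_sub, hflat _ ht1, hflat _ ht2, sub_zero, Finset.sum_const_zero] at hdir
  have hdir' : ∑ i, (d i - d (i + 1)) ^ 2 / s i = 0 := by linarith
  have hstep : ∀ i, d i = d (i + 1) := by
    intro i
    have h := (Finset.sum_eq_zero_iff_of_nonneg fun i _ =>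
      div_nonneg (sq_nonneg _) (hs i).le).1 hdir' i (Finset.mem_univ i)
    have h2 : (d i - d (i + 1)) ^ 2 = 0 := by
      simpa [(hs i).ne'] using h
    exact sub_eq_zero.1 (pow_eq_zero_iff two_ne_zero |>.1 h2)
  have hd0 := eq_of_forall_eq_add_one hstep
  by_contra hne
  push Not at hne
  obtain ⟨k, hk⟩ := hne
  have hall : ∀ i, vertexExcess s (fun j => q j + 1 / 3 * d j) i = 0 := fun i =>
    (mul_eq_zero.1 (hflat _ ht1 i)).resolve_left (by rwa [hd0 i, ← hd0 k])
  have hsum := sum_vertexExcess hs (fun j => q j + 1 / 3 * d j)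
  simp only [hall, Finset.sum_const_zero] at hsum
  have : 0 < ∑ i, 2 * s i :=
    Finset.sum_pos (fun i _ => mul_pos two_pos (hs i)) ⟨0, Finset.mem_univ 0⟩
  linarith

lemma IsGenTri.triAngle_eq_apexAngle {p q r : ℝ} (h : IsGenTri p q r) {k : ℝ} (hk : 0 < k) :
    triAngle p q r = apexAngle ((k / p) ^ 2) ((k / q) ^ 2) ((k * r / (p * q)) ^ 2) := by
  obtain ⟨hp, hq, hr, -⟩ := h
  unfold triAngle apexAngle
  rw [← mul_pow, Real.sqrt_sq (by positivity)]
  congr 1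
  field_simp
  ring

lemma IsGenTri.inverted_sq_le {p q r : ℝ} (h : IsGenTri p q r) {k : ℝ} (hk : 0 < k) :
    (((k / p) ^ 2 - (k / q) ^ 2 + (k * r / (p * q)) ^ 2) / (k * r / (p * q))) ^ 2 ≤
      4 * (k / p) ^ 2 := by
  obtain ⟨hp, hq, hr, h1, h2, h3⟩ := h
  have e : 4 * (k / p) ^ 2 -
      (((k / p) ^ 2 - (k / q) ^ 2 + (k * r / (p * q)) ^ 2) / (k * r / (p * q))) ^ 2 =
      k ^ 2 * ((p + r - q) * (p + q - r) * (q + r - p) * (p + q + r)) / (p * q * r) ^ 2 := by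
    field_simp
    ring
  have : 0 ≤ k ^ 2 * ((p + r - q) * (p + q - r) * (q + r - p) * (p + q + r)) / (p * q * r) ^ 2 := by
    have a1 : 0 ≤ p + r - q := by linarith
    have a2 : 0 ≤ p + q - r := by linarith
    have a3 : 0 ≤ q + r - p := by linarith
    positivity
  linarith

lemma IsGenTri.cos_mem {p q r : ℝ} (h : IsGenTri p q r) :
    -1 ≤ (p ^ 2 + q ^ 2 - r ^ 2) / (2 * p * q) ∧ (p ^ 2 + q ^ 2 - r ^ 2) / (2 * p * q) ≤ 1 := by
  obtain ⟨hp, hq, hr, h1, h2, h3⟩ := h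
  rw [le_div_iff₀ (by positivity), div_le_iff₀ (by positivity)]
  constructor <;> nlinarith

lemma IsGenTri.rotate {p q r : ℝ} (h : IsGenTri p q r) : IsGenTri q r p := by
  obtain ⟨hp, hq, hr, h1, h2, h3⟩ := h
  exact ⟨hq, hr, hp, by linarith, by linarith, by linarith⟩

lemma IsGenTri.swap {p q r : ℝ} (h : IsGenTri p q r) : IsGenTri q p r := by
  obtain ⟨hp, hq, hr, h1, h2, h3⟩ := h
  exact ⟨hq, hp, hr, by linarith, by linarith, by linarith⟩

lemma add_nonneg_of_arccos_add_le {u v : ℝ} (hu : -1 ≤ u) (hv : -1 ≤ v)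
    (h : Real.arccos u + Real.arccos v ≤ π) : 0 ≤ u + v := by
  by_contra! hlt
  have := Real.arccos_lt_arccos hu (by linarith : u < -v) (by linarith)
  rw [Real.arccos_neg] at this
  linarith

/-- Inversion at `v₀` turns the Delaunay condition into convexity. -/
lemma vertexExcess_nonneg_of_delaunay {n : ℕ} {X Y s : ZMod n → ℝ} {k : ℝ} (hk : 0 < k)
    (h : ∀ i, IsGenTri (X i) (X (i + 1)) (Y i))
    (hs : ∀ i, s i = k * Y i / (X i * X (i + 1))) (i : ZMod n)
    (hDel : triAngle (X (i + 1)) (Y i) (X i) + triAngle (X (i - 1)) (Y (i - 1)) (X i) ≤ π) :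
    0 ≤ vertexExcess s (fun j => (k / X j) ^ 2) i := by
  have hi := h i
  have hj := h (i - 1)
  rw [sub_add_cancel] at hj
  have hsum := add_nonneg_of_arccos_add_le hi.rotate.cos_mem.1 hj.swap.rotate.cos_mem.1 hDel
  have e : vertexExcess s (fun j => (k / X j) ^ 2) i = 2 * k / X i *
      ((X (i + 1) ^ 2 + Y i ^ 2 - X i ^ 2) / (2 * X (i + 1) * Y i) +
        (X (i - 1) ^ 2 + Y (i - 1) ^ 2 - X i ^ 2) / (2 * X (i - 1) * Y (i - 1))) := by
    simp only [vertexExcess, hs, sub_add_cancel]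
    have := hi.1
    have := hi.2.1
    have := hi.2.2.1
    have := hj.1
    have := hj.2.2.1
    field_simp
    ring
  rw [e]
  have := hi.1
  positivity

/-- (Maximum principle, Theorem 3.1.)  If a Delaunay generalized PL metric on the star
triangulation of an `n`-gon is vertex-scaled by `(w₀, w)` to a Delaunay generalized PL
metric whose cone angle at `v₀` is not smaller (curvature at `v₀` not larger), and `w₀`
is the maximum of the conformal factors, then `w ≡ w₀`. -/
theorem star_maximum_principle
    (n : ℕ) [NeZero n] (hn : 3 ≤ n) (x y : ZMod n → ℝ)
    (hbase : ∀ i : ZMod n, IsGenTri (x i) (x (i + 1)) (y i))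
    (hbaseDel : ∀ i : ZMod n, aAng n x y 0 0 i + bAng n x y 0 0 i ≤ π)
    (w0 : ℝ) (w : ZMod n → ℝ)
    (htri : ∀ i : ZMod n,
      IsGenTri (Xl n x w0 w i) (Xl n x w0 w (i + 1)) (Yl n y w i))
    (hDel : ∀ i : ZMod n, aAng n x y w0 w i + bAng n x y w0 w i ≤ π)
    (hα : coneAngle n x y 0 0 ≤ coneAngle n x y w0 w)
    (hmax : ∀ i : ZMod n, w i ≤ w0) :
    ∀ i : ZMod n, w i = w0 := by
  have hX0 : Xl n x 0 0 = x := by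
    funext i
    simp [Xl]
  have hY0 : Yl n y 0 = y := by
    funext i
    simp [Yl]
  simp only [aAng, bAng, cAng, coneAngle, hX0, hY0] at hbaseDel hDel hα
  set X := Xl n x w0 w with hX
  set Y := Yl n y w with hY
  set k := Real.exp (2 * w0) with hk
  have hk0 : 0 < k := Real.exp_pos _
  set s : ZMod n → ℝ := fun i => 1 * y i / (x i * x (i + 1)) with hs
  have hsX : ∀ i, s i = k * Y i / (X i * X (i + 1)) := by
    intro i
    have h1 := (hbase i).1
    have h2 := (hbase i).2.1
    have e : Real.exp (w0 + w i) * Real.exp (w0 + w (i + 1)) =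
        Real.exp (2 * w0) * Real.exp (w i + w (i + 1)) := by
      rw [← Real.exp_add, ← Real.exp_add]
      ring_nf
    simp only [hs, hX, hY, hk, Xl, Yl]
    rw [mul_mul_mul_comm (Real.exp (w0 + w i)), e, ← mul_assoc, one_mul]
    exact (mul_div_mul_left _ _ (by positivity)).symm
  have hkX : ∀ i, k / X i = Real.exp (w0 - w i) * (1 / x i) := by
    intro i
    have h1 := (hbase i).1
    have e : k = Real.exp (w0 - w i) * Real.exp (w0 + w i) := by
      rw [hk, ← Real.exp_add]
      ring_nf
    rw [e]
    simp only [hX, Xl]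
    field_simp
  have hs0 : ∀ i, 0 < s i := fun i => by
    have h1 := (hbase i).1
    have h2 := (hbase i).2.1
    have h3 := (hbase i).2.2.1
    simp only [hs]
    positivity
  have hq0 : ∀ i, 0 < (1 / x i) ^ 2 := fun i => by
    have h1 := (hbase i).1
    positivity
  have hmono : ∀ i, (1 / x i) ^ 2 ≤ (k / X i) ^ 2 := fun i => by
    rw [hkX, mul_pow]
    exact le_mul_of_one_le_left (hq0 i).le
      (one_le_pow₀ (Real.one_le_exp (by linarith [hmax i])))
  have hd := eq_zero_of_sum_apexAngle_le (s := s) (q := fun i => (1 / x i) ^ 2)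
    (d := fun i => (k / X i) ^ 2 - (1 / x i) ^ 2) hs0 hq0
    (fun i => sub_nonneg.2 (hmono i))
    (fun i => (hbase i).inverted_sq_le one_pos)
    (fun i => by
      simp only [add_sub_cancel, hsX]
      exact (htri i).inverted_sq_le hk0)
    (fun i => vertexExcess_nonneg_of_delaunay one_pos hbase (fun _ => rfl) i (hbaseDel i))
    (fun i => by
      simp only [add_sub_cancel]
      exact vertexExcess_nonneg_of_delaunay hk0 htri hsX i (hDel i))
    (by
      simp only [add_sub_cancel]
      rw [Finset.sum_congr rfl fun i _ => (hbase i).triAngle_eq_apexAngle one_pos,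
        Finset.sum_congr rfl fun i _ => (htri i).triAngle_eq_apexAngle hk0] at hα
      simpa only [← hsX] using hα)
  intro i
  have h := hd i
  rw [hkX, mul_pow, sub_eq_zero] at h
  have h1 : Real.exp (w0 - w i) ^ 2 = 1 := (mul_eq_right₀ (hq0 i).ne').1 h
  have h2 : Real.exp (w0 - w i) = 1 :=
    (pow_eq_one_iff_of_nonneg (Real.exp_pos _).le two_ne_zero).1 h1
  linarith [Real.exp_eq_one_iff _ |>.1 h2]
end

section
/- (Ratio Lemma 3.3.) Let (x, y) be a generalized PL metric on the star triangulation of an n-gon (n ≥ 3) which is flat at v₀, i.e. α(0) = 2π. Then there exists a constant λ > 0, depending only on (x, y), with the following property: for every w₀ ∈ ℝ and w : ℤ/nℤ → ℝ such that the vertex-scaled lengths (x_i(w), x_{i+1}(w), y_i(w)) satisfy the weak triangle inequalities for every i and the scaled metric has zero curvature at v₀ (that is, α(w) = 2π), one has x_i(w)/y_i(w) ≤ λ for all i ∈ ℤ/nℤ. -/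
open Real

/-- If `r² ≤ k² p q`, the angle opposite `r` is at most `π k / 2`. -/
lemma triAngle_le {p q r k : ℝ} (hp : 0 < p) (hq : 0 < q) (hk : 0 ≤ k)
    (h : r ^ 2 ≤ k ^ 2 * (p * q)) : triAngle p q r ≤ π / 2 * k := by
  have hπ := Real.pi_pos
  unfold triAngle
  rcases le_or_gt k 2 with hk2 | hk2
  · have hu0 : 0 ≤ π / 2 * k := by positivity
    have huπ : π / 2 * k ≤ π := by nlinarith
    rw [← Real.arccos_cos hu0 huπ]
    apply Real.arccos_le_arccos
    refine (Real.cos_le_one_sub_mul_cos_sq (by rwa [abs_of_nonneg hu0])).trans ?_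
    have he : 1 - 2 / π ^ 2 * (π / 2 * k) ^ 2 = 1 - k ^ 2 / 2 := by
      field_simp
    rw [he, le_div_iff₀ (by positivity)]
    nlinarith [sq_nonneg (p - q)]
  · exact (Real.arccos_le_pi _).trans (by nlinarith)

/-- A function on `ℤ/nℤ` whose forward increments are at most `M` has oscillation at
most `n * M`. -/
lemma ZMod.le_add_mul_of_succ_le {n : ℕ} [NeZero n] {R : ZMod n → ℝ} {M : ℝ} (hM : 0 ≤ M)
    (hR : ∀ i, R (i + 1) ≤ R i + M) (i j : ZMod n) : R i ≤ R j + n * M := by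
  have key : ∀ k : ℕ, R (j + k) ≤ R j + k * M := by
    intro k
    induction k with
    | zero => simp
    | succ k ih =>
      have h := hR (j + k)
      push_cast
      rw [← add_assoc]
      linarith
  have h := key (i - j).val
  rw [ZMod.natCast_zmod_val, add_sub_cancel] at h
  have hlt : ((i - j).val : ℝ) ≤ n := by exact_mod_cast (ZMod.val_lt (i - j)).le
  nlinarith

/-- (Ratio Lemma 3.3.)  Let `(x, y)` be a generalized PL metric on the star triangulation
of an `n`-gon which is flat at `v₀` (`α(0) = 2π`).  Then there is a constant `λ > 0`
depending only on `(x, y)` such that for any conformal factors `(w₀, w)` for which all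
scaled triangles satisfy the weak triangle inequalities and the scaled cone angle at `v₀`
is `2π`, the ratio `xᵢ(w)/yᵢ(w)` is at most `λ` for every `i`. -/
theorem star_ratio_lemma
    (n : ℕ) [NeZero n] (hn : 3 ≤ n) (x y : ZMod n → ℝ)
    (hbase : ∀ i : ZMod n, IsGenTri (x i) (x (i + 1)) (y i))
    (hflat : coneAngle n x y 0 0 = 2 * π) :
    ∃ lam : ℝ, 0 < lam ∧
      ∀ (w0 : ℝ) (w : ZMod n → ℝ),
        (∀ i : ZMod n,
          IsGenTri (Xl n x w0 w i) (Xl n x w0 w (i + 1)) (Yl n y w i)) →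
        coneAngle n x y w0 w = 2 * π →
        ∀ i : ZMod n, Xl n x w0 w i / Yl n y w i ≤ lam := by
  have hx : ∀ i, 0 < x i := fun i => (hbase i).1
  have hy : ∀ i, 0 < y i := fun i => (hbase i).2.2.1
  -- Inverting at `v₀` turns the edge `vᵢ v_{i+1}` into one of length `m i`, independent of `w`.
  set m : ZMod n → ℝ := fun i => y i / (x i * x (i + 1)) with hm_def
  have hm : ∀ i, 0 < m i := fun i => div_pos (hy i) (mul_pos (hx i) (hx (i + 1)))
  set M : ℝ := ∑ i, m i with hM_def
  have hmM : ∀ i, m i ≤ M := fun i =>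
    Finset.single_le_sum (fun j _ => (hm j).le) (Finset.mem_univ i)
  have hM : 0 < M := (hm 0).trans_le (hmM 0)
  set B : ℝ := M + n * M with hB_def
  have hB : 0 < B := by positivity
  have hBm : ∀ i, 0 < B / m i := fun i => div_pos hB (hm i)
  refine ⟨∑ i, B / m i, Finset.sum_pos (fun i _ => hBm i) Finset.univ_nonempty, ?_⟩
  intro w0 w htri hcone i
  set X : ZMod n → ℝ := Xl n x w0 w with hX_def
  set Y : ZMod n → ℝ := Yl n y w with hY_def
  have hX : ∀ j, 0 < X j := fun j => (htri j).1
  set s : ℝ := Real.exp (2 * w0) with hs_def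
  have hs : 0 < s := Real.exp_pos _
  have hY : ∀ j, s * Y j = X j * X (j + 1) * m j := by
    intro j
    have hxj := (hx j).ne'
    have hxj' := (hx (j + 1)).ne'
    have he : s * Real.exp (w j + w (j + 1))
        = Real.exp (w0 + w j) * Real.exp (w0 + w (j + 1)) := by
      rw [hs_def, ← Real.exp_add, ← Real.exp_add]
      congr 1
      ring
    simp only [hX_def, hY_def, Xl, Yl, hm_def]
    field_simp
    linear_combination y j * he
  set R : ZMod n → ℝ := fun j => s / X j with hR_def
  have hRstep : ∀ j, R (j + 1) ≤ R j + M := by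
    intro j
    have h : R (j + 1) ≤ R j + m j := by
      have h1 : s * X j ≤ s * (X (j + 1) + Y j) :=
        mul_le_mul_of_nonneg_left (htri j).2.2.2.1 hs.le
      have h2 : R j + m j = (s * X (j + 1) + X j * X (j + 1) * m j) / (X j * X (j + 1)) := by
        have := (hX j).ne'
        have := (hX (j + 1)).ne'
        simp only [hR_def]
        field_simp
      have h3 : R (j + 1) = s * X j / (X j * X (j + 1)) := by
        have := (hX j).ne'
        have := (hX (j + 1)).ne'
        simp only [hR_def]
        field_simp
      rw [h2, h3, ← hY j, ← mul_add]
      exact div_le_div_of_nonneg_right h1 (mul_pos (hX j) (hX (j + 1))).le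
    linarith [hmM j]
  obtain ⟨j, hj⟩ : ∃ j, R j ≤ M := by
    by_contra! hlarge
    have hXM : ∀ j, X j * M ≤ s := fun j => by
      have := (lt_div_iff₀ (hX j)).1 (hlarge j)
      linarith
    have hc : ∀ j, cAng n x y w0 w j ≤ π / 2 * (m j / M) := by
      intro j
      refine triAngle_le (hX j) (hX (j + 1)) (div_pos (hm j) hM).le ?_
      have hXX : X j * M * (X (j + 1) * M) ≤ s * s :=
        mul_le_mul (hXM j) (hXM (j + 1)) (mul_pos (hX _) hM).le hs.le
      change Y j ^ 2 ≤ _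
      have hYj : Y j = X j * X (j + 1) * m j / s := by
        rw [← hY j]
        field_simp
      have hP := mul_pos (hX j) (hX (j + 1))
      rw [hYj, div_pow, div_pow, div_mul_eq_mul_div, div_le_div_iff₀ (by positivity)
        (by positivity)]
      have := mul_le_mul_of_nonneg_left hXX (mul_pos hP (pow_pos (hm j) 2)).le
      linarith
    have hsum : coneAngle n x y w0 w ≤ π / 2 := by
      refine (Finset.sum_le_sum fun j _ => hc j).trans_eq ?_
      rw [← Finset.mul_sum, ← Finset.sum_div, ← hM_def, div_self hM.ne', mul_one]
    linarith [Real.pi_pos]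
  have hRB : R (i + 1) ≤ B := by
    linarith [ZMod.le_add_mul_of_succ_le hM.le hRstep (i + 1) j]
  have hratio : X i / Y i = R (i + 1) / m i := by
    have hYi : Y i = X i * X (i + 1) * m i / s := by
      rw [← hY i]
      field_simp
    have := (hX i).ne'
    have := (hX (i + 1)).ne'
    have := (hm i).ne'
    rw [hYi]
    simp only [hR_def]
    field_simp
  rw [hratio]
  exact (div_le_div_of_nonneg_right hRB (hm i).le).trans
    (Finset.single_le_sum (f := fun i => B / m i) (fun j _ => (hBm j).le) (Finset.mem_univ i))
end

section
/- (Proposition 2.1(a).) Let l = (l₁, l₂, l₃) be the side lengths of a generalized triangle. For any two distinct indices i, j ∈ {1, 2, 3} and any constants c_i, c_j ∈ ℝ, the set {w ∈ ℝ³ : w_i = c_i, w_j = c_j, and the vertex-scaled lengths w*l satisfy the weak triangle inequalities} is a preconnected subset of ℝ³ (i.e. it is either empty or connected). -/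
open Real

/-- Vertex-scaled side lengths `w*l`: `(w*l)ᵢ = e^{wⱼ+w_k} lᵢ` for `{i,j,k} = {1,2,3}`
(indices taken in `Fin 3`, cyclically). -/
noncomputable def wl (l w : Fin 3 → ℝ) (i : Fin 3) : ℝ :=
  Real.exp (w (i + 1) + w (i + 2)) * l i

/-- Weak triangle inequalities for positive side lengths (a generalized triangle). -/
def IsGenTriF (l : Fin 3 → ℝ) : Prop :=
  (∀ i, 0 < l i) ∧ ∀ i : Fin 3, l i ≤ l (i + 1) + l (i + 2)

/-- Strict triangle inequalities for positive side lengths (a nondegenerate triangle). -/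
def IsTriF (l : Fin 3 → ℝ) : Prop :=
  (∀ i, 0 < l i) ∧ ∀ i : Fin 3, l i < l (i + 1) + l (i + 2)

/-- The inner angle `aᵢ(w)` at the vertex `vᵢ` of the scaled triangle `w*l`,
i.e. the angle opposite the side of length `(w*l)ᵢ`. -/
noncomputable def angF (l : Fin 3 → ℝ) (i : Fin 3) (w : Fin 3 → ℝ) : ℝ :=
  triAngle (wl l w (i + 1)) (wl l w (i + 2)) (wl l w i)

theorem wl_eq_exp_sum_mul (l w : Fin 3 → ℝ) (m : Fin 3) :
    wl l w m = Real.exp (w 0 + w 1 + w 2) * (Real.exp (-w m) * l m) := by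
  rw [wl, ← mul_assoc, ← Real.exp_add]
  congr 2
  fin_cases m <;> simp <;> ring

/-- In the coordinates `exp (-w m)` the weak triangle inequalities become linear. -/
theorem isGenTriF_wl_iff {l : Fin 3 → ℝ} (hl : ∀ m, 0 < l m) (w : Fin 3 → ℝ) :
    IsGenTriF (wl l w) ↔ ∀ m : Fin 3, Real.exp (-w m) * l m ≤
      Real.exp (-w (m + 1)) * l (m + 1) + Real.exp (-w (m + 2)) * l (m + 2) := by
  have hpos : ∀ m, 0 < wl l w m := fun m => mul_pos (Real.exp_pos _) (hl m)
  simp only [IsGenTriF, hpos, implies_true, true_and]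
  refine forall_congr' fun m => ?_
  rw [wl_eq_exp_sum_mul, wl_eq_exp_sum_mul, wl_eq_exp_sum_mul, ← mul_add,
    mul_le_mul_iff_right₀ (Real.exp_pos _)]

theorem exp_neg_mem_segment {s t r : ℝ} (h : r ∈ segment ℝ s t) :
    Real.exp (-r) ∈ segment ℝ (Real.exp (-s)) (Real.exp (-t)) := by
  rw [segment_eq_uIcc, Set.mem_uIcc] at h ⊢
  simpa [and_comm, or_comm] using h

/-- (Proposition 2.1(a).)  For a generalized triangle `l` and any two distinct indices
`i, j` and constants `cᵢ, cⱼ`, the set of conformal factors `w` with `wᵢ = cᵢ`, `wⱼ = cⱼ`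
for which `w*l` satisfies the weak triangle inequalities is preconnected
(either empty or connected). -/
theorem vertex_scaling_slice_preconnected
    (l : Fin 3 → ℝ) (hl : IsGenTriF l) (i j : Fin 3) (hij : i ≠ j) (ci cj : ℝ) :
    IsPreconnected {w : Fin 3 → ℝ | w i = ci ∧ w j = cj ∧ IsGenTriF (wl l w)} := by
  refine Convex.isPreconnected fun w hw v hv a b ha hb hab => ?_
  obtain ⟨hwi, hwj, hw⟩ := hw
  obtain ⟨hvi, hvj, hv⟩ := hv
  rw [isGenTriF_wl_iff hl.1] at hw hv
  obtain ⟨k, hk⟩ : ∃ k : Fin 3, ∀ m, m = i ∨ m = j ∨ m = k := by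
    clear * - hij
    revert i j
    decide
  set u := a • w + b • v with hu
  have hui : u i = ci := by
    simp [hu, hwi, hvi, ← add_mul, hab]
  have huj : u j = cj := by
    simp [hu, hwj, hvj, ← add_mul, hab]
  obtain ⟨p, q, hp, hq, hpq, huk⟩ :=
    exp_neg_mem_segment (show u k ∈ segment ℝ (w k) (v k) from ⟨a, b, ha, hb, hab, rfl⟩)
  have hexp : ∀ m, Real.exp (-u m) = p * Real.exp (-w m) + q * Real.exp (-v m) := by
    intro m
    rcases hk m with rfl | rfl | rfl
    · rw [hui, hwi, hvi, ← add_mul, hpq, one_mul]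
    · rw [huj, hwj, hvj, ← add_mul, hpq, one_mul]
    · exact huk.symm
  refine ⟨hui, huj, (isGenTriF_wl_iff hl.1 u).2 fun m => ?_⟩
  simp only [hexp]
  linarith [mul_le_mul_of_nonneg_left (hw m) hp, mul_le_mul_of_nonneg_left (hv m) hq]
end
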